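/- Let k ≥ 6 and ε > 0. For all real numbers α₁ and α_k and all sufficiently large N (in terms of k and ε), there exists an integer n with 1 ≤ n ≤ N such that ‖α_k n^k + α₁ n‖ ≤ C(k,ε) · N^{−1/(k(k−1)) + ε}, where C(k,ε) is a constant depending only on k and ε. -/

import Mathlib

/-- Distance from a real number to the nearest integer. -/
noncomputable def nearestIntDist (x : ℝ) : ℝ := |x - round x|

open Finset

namespace VM

/-- half of the critical exponent -/
def tri (l : ℕ) : ℕ := l * (l + 1) / 2

/-- the block of `i` in `S` at level `h` -/
def blk (p : ℕ) (z : ℤ → ℤ) (h : ℕ) (S : Finset ℤ) (i : ℤ) : Finset ℤ :=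
  S.filter (fun j => (p : ℤ) ^ h ∣ z j - z i)

/-- partition of `S` in blocks at level `h` -/
def blocks (p : ℕ) (z : ℤ → ℤ) (h : ℕ) (S : Finset ℤ) : Finset (Finset ℤ) :=
  S.image (blk p z h S)

variable {p : ℕ} {z : ℤ → ℤ}

lemma mem_blk {h : ℕ} {S : Finset ℤ} {i j : ℤ} :
    j ∈ blk p z h S i ↔ j ∈ S ∧ (p : ℤ) ^ h ∣ z j - z i := by
  simp [blk]

lemma self_mem_blk {h : ℕ} {S : Finset ℤ} {i : ℤ} (hi : i ∈ S) : i ∈ blk p z h S i := by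
  simp [blk, hi]

lemma mem_blocks {h : ℕ} {S J : Finset ℤ} :
    J ∈ blocks p z h S ↔ ∃ i ∈ S, blk p z h S i = J := by
  simp [blocks]

lemma blocks_subset {h : ℕ} {S J : Finset ℤ} (hJ : J ∈ blocks p z h S) : J ⊆ S := by
  obtain ⟨i, hi, rfl⟩ := mem_blocks.1 hJ
  exact Finset.filter_subset _ _

lemma blocks_nonempty {h : ℕ} {S J : Finset ℤ} (hJ : J ∈ blocks p z h S) : J.Nonempty := by
  obtain ⟨i, hi, rfl⟩ := mem_blocks.1 hJ
  exact ⟨i, self_mem_blk hi⟩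

lemma blocks_dvd {h : ℕ} {S J : Finset ℤ} (hJ : J ∈ blocks p z h S) {i j : ℤ} (hi : i ∈ J)
    (hj : j ∈ J) : (p : ℤ) ^ h ∣ z i - z j := by
  obtain ⟨m, hm, rfl⟩ := mem_blocks.1 hJ
  have h1 := (mem_blk.1 hi).2
  have h2 := (mem_blk.1 hj).2
  have := dvd_sub h1 h2
  simpa using this

lemma blocks_eq_blk {h : ℕ} {S J : Finset ℤ} (hJ : J ∈ blocks p z h S) {i : ℤ} (hi : i ∈ J) :
    J = blk p z h S i := by
  obtain ⟨m, hm, rfl⟩ := mem_blocks.1 hJ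
  have h1 := (mem_blk.1 hi).2
  ext j
  rw [mem_blk, mem_blk]
  refine and_congr_right fun _ => ⟨fun h2 => ?_, fun h2 => ?_⟩
  · have := dvd_sub h2 h1; simpa using this
  · have := dvd_add h2 h1; simpa using this

lemma blk_mem_blocks {h : ℕ} {S : Finset ℤ} {i : ℤ} (hi : i ∈ S) :
    blk p z h S i ∈ blocks p z h S := mem_blocks.2 ⟨i, hi, rfl⟩

lemma blocks_eq_of_mem {h : ℕ} {S J J2 : Finset ℤ} (hJ : J ∈ blocks p z h S)
    (hJ2 : J2 ∈ blocks p z h S) {i : ℤ} (hi : i ∈ J) (hi2 : i ∈ J2) : J = J2 := by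
  rw [blocks_eq_blk hJ hi, blocks_eq_blk hJ2 hi2]

lemma blocks_disj {h : ℕ} {S : Finset ℤ} :
    Set.PairwiseDisjoint (↑(blocks p z h S) : Set (Finset ℤ)) id := by
  intro J hJ J2 hJ2 hne
  rw [Function.onFun, Finset.disjoint_left]
  intro i hi hi2
  exact hne (blocks_eq_of_mem hJ hJ2 hi hi2)

lemma sum_blocks {M : Type*} [AddCommMonoid M] (h : ℕ) (S : Finset ℤ) (g : ℤ → M) :
    ∑ i ∈ S, g i = ∑ J ∈ blocks p z h S, ∑ i ∈ J, g i := by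
  have : S = (blocks p z h S).biUnion id := by
    ext i
    simp only [mem_biUnion, id]
    constructor
    · intro hi; exact ⟨_, blk_mem_blocks hi, self_mem_blk hi⟩
    · rintro ⟨J, hJ, hi⟩; exact blocks_subset hJ hi
  conv_lhs => rw [this]
  rw [Finset.sum_biUnion blocks_disj]; rfl

lemma blk_blk {a h : ℕ} (hah : a ≤ h) {S : Finset ℤ} {i : ℤ} :
    blk p z h (blk p z a S i) i = blk p z h S i := by
  ext j
  simp only [mem_blk]
  constructor
  · rintro ⟨⟨h1, h2⟩, h3⟩; exact ⟨h1, h3⟩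
  · rintro ⟨h1, h3⟩; exact ⟨⟨h1, (pow_dvd_pow _ hah).trans h3⟩, h3⟩

lemma blocks_refine {a h : ℕ} (hah : a ≤ h) (S : Finset ℤ) :
    blocks p z h S = (blocks p z a S).biUnion (blocks p z h) := by
  ext J
  simp only [mem_biUnion]
  constructor
  · intro hJ
    obtain ⟨i, hi, rfl⟩ := mem_blocks.1 hJ
    refine ⟨blk p z a S i, blk_mem_blocks hi, ?_⟩
    rw [← blk_blk hah]
    exact blk_mem_blocks (self_mem_blk hi)
  · rintro ⟨I, hI, hJ⟩
    obtain ⟨i, hi, rfl⟩ := mem_blocks.1 hJ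
    have := blocks_eq_blk hI hi
    rw [this, blk_blk hah]
    exact blk_mem_blocks (blocks_subset hI hi)

lemma sum_blocks_refine {M : Type*} [AddCommMonoid M] {a h : ℕ} (hah : a ≤ h) (S : Finset ℤ)
    (G : Finset ℤ → M) :
    ∑ J ∈ blocks p z h S, G J = ∑ I ∈ blocks p z a S, ∑ J ∈ blocks p z h I, G J := by
  rw [blocks_refine hah, Finset.sum_biUnion]
  intro I hI I2 hI2 hne
  rw [Function.onFun, Finset.disjoint_left]
  intro J hJ hJ2
  obtain ⟨i, hi⟩ := blocks_nonempty hJ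
  exact hne (blocks_eq_of_mem hI hI2 (blocks_subset hJ hi) (blocks_subset hJ2 hi))

lemma card_blocks (hp : 0 < p) (h : ℕ) (S : Finset ℤ) : (blocks p z h S).card ≤ p ^ h := by
  have : (blocks p z h S).card ≤ (Finset.Ico (0:ℤ) ((p:ℤ)^h)).card := by
    have hpos : (0:ℤ) < (p:ℤ)^h := by positivity
    choose! c hc using fun J (hJ : J ∈ blocks p z h S) => blocks_nonempty hJ
    refine Finset.card_le_card_of_injOn (fun J => z (c J) % (p:ℤ)^h) ?_ ?_
    · intro J hJ
      simp only [coe_Ico, Set.mem_Ico]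
      exact ⟨Int.emod_nonneg _ hpos.ne', Int.emod_lt_of_pos _ hpos⟩
    · intro J hJ J2 hJ2 heq
      have h1 : (p:ℤ)^h ∣ z (c J2) - z (c J) := Int.ModEq.dvd heq
      have h2 : c J2 ∈ J := by
        rw [blocks_eq_blk hJ (hc J hJ)]
        exact mem_blk.2 ⟨blocks_subset hJ2 (hc J2 hJ2), h1⟩
      exact blocks_eq_of_mem hJ hJ2 h2 (hc J2 hJ2)
  rw [Int.card_Ico, sub_zero] at this
  exact_mod_cast this.trans (le_of_eq (by rw [← Nat.cast_pow, Int.toNat_natCast]))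

lemma blocks_congr {z2 : ℤ → ℤ} {h h2 : ℕ} {S : Finset ℤ}
    (H : ∀ i ∈ S, ∀ j ∈ S, ((p : ℤ) ^ h ∣ z j - z i ↔ (p : ℤ) ^ h2 ∣ z2 j - z2 i)) :
    blocks p z h S = blocks p z2 h2 S := by
  apply Finset.image_congr
  intro i hi
  apply Finset.filter_congr
  intro j hj
  exact H i hi j hj

lemma blocks_empty (h : ℕ) : blocks p z h ∅ = ∅ := by simp [blocks]

-- Norms

variable {Ω : Type*} [Fintype Ω]

/-- squared norm of the sum over `T` -/
noncomputable def nn (s : ℕ) (F : ℤ → Ω → ℂ) (T : Finset ℤ) : ℝ :=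
  (∑ t, ‖∑ i ∈ T, F i t‖ ^ (2 * s)) ^ ((1 : ℝ) / s)

/-- square function norm -/
noncomputable def NN (p : ℕ) (z : ℤ → ℤ) (h s : ℕ) (F : ℤ → Ω → ℂ) (S : Finset ℤ) : ℝ :=
  ∑ J ∈ blocks p z h S, nn s F J

lemma nn_nonneg (s : ℕ) (F : ℤ → Ω → ℂ) (T : Finset ℤ) : 0 ≤ nn s F T := by
  unfold nn; positivity

lemma NN_nonneg (h s : ℕ) (F : ℤ → Ω → ℂ) (T : Finset ℤ) : 0 ≤ NN p z h s F T :=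
  Finset.sum_nonneg fun _ _ => nn_nonneg _ _ _

lemma NN_refine {a h : ℕ} (hah : a ≤ h) (s : ℕ) (F : ℤ → Ω → ℂ) (S : Finset ℤ) :
    NN p z h s F S = ∑ I ∈ blocks p z a S, NN p z h s F I := by
  unfold NN; exact sum_blocks_refine hah S _

lemma NN_block_le {a h : ℕ} (hah : a ≤ h) (s : ℕ) (F : ℤ → Ω → ℂ) {S I : Finset ℤ}
    (hI : I ∈ blocks p z a S) : NN p z h s F I ≤ NN p z h s F S := by
  rw [NN_refine hah s F S]
  exact Finset.single_le_sum (f := fun I => NN p z h s F I) (fun _ _ => NN_nonneg _ _ _ _) hI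

lemma minkowski {K : Type*} (𝓑 : Finset K) (s : ℕ) (hs : 1 ≤ s) (Y : K → Ω → ℝ)
    (hY : ∀ J t, 0 ≤ Y J t) :
    (∑ t, (∑ J ∈ 𝓑, Y J t) ^ s) ^ ((1:ℝ)/s) ≤ ∑ J ∈ 𝓑, (∑ t, Y J t ^ s) ^ ((1:ℝ)/s) := by
  classical
  have hs0 : (s:ℝ) ≠ 0 := by positivity
  induction 𝓑 using Finset.induction_on with
  | empty => 
             have : s ≠ 0 := by omega
             simp [this]
  | insert J 𝓑 hJ ih =>
    rw [Finset.sum_insert hJ]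
    have h1 := Real.Lp_add_le_of_nonneg (s := (Finset.univ : Finset Ω)) (p := (s:ℝ)) (f := Y J)
      (g := fun t => ∑ J ∈ 𝓑, Y J t) (by exact_mod_cast hs) (fun t _ => hY J t)
      (fun t _ => Finset.sum_nonneg fun _ _ => hY _ _)
    simp only [Real.rpow_natCast] at h1
    refine le_trans (le_of_eq ?_) (h1.trans (add_le_add le_rfl ih))
    congr 1
    refine Finset.sum_congr rfl fun t _ => ?_
    rw [Finset.sum_insert hJ]

lemma rpow_inv_pow {x : ℝ} (hx : 0 ≤ x) {s : ℕ} (hs : 1 ≤ s) : (x ^ ((1:ℝ)/s)) ^ s = x := by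
  rw [one_div]; exact Real.rpow_inv_natCast_pow hx (by omega)

lemma minkowski2 {K : Type*} (𝓑 : Finset K) (s : ℕ) (hs : 1 ≤ s) (X : K → Ω → ℝ)
    (hX : ∀ J t, 0 ≤ X J t) :
    ∑ t, (∑ J ∈ 𝓑, X J t ^ ((1:ℝ)/s)) ^ s ≤ (∑ J ∈ 𝓑, (∑ t, X J t) ^ ((1:ℝ)/s)) ^ s := by
  have h := minkowski 𝓑 s hs (fun J t => X J t ^ ((1:ℝ)/s)) (fun J t => by
    have := hX J t; positivity)
  have hnn : 0 ≤ ∑ t, (∑ J ∈ 𝓑, X J t ^ ((1:ℝ)/s)) ^ s :=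
    Finset.sum_nonneg fun t _ => pow_nonneg (Finset.sum_nonneg fun J _ =>
      Real.rpow_nonneg (hX J t) _) _
  have h2 := pow_le_pow_left₀ (Real.rpow_nonneg hnn _) h s
  rw [rpow_inv_pow hnn hs] at h2
  refine h2.trans (le_of_eq ?_)
  congr 1
  refine Finset.sum_congr rfl fun J _ => ?_
  congr 1
  exact Finset.sum_congr rfl fun t _ => rpow_inv_pow (hX J t) hs

/-- averaging over shifts -/
lemma shift_dec [AddCommGroup Ω] {V : Type*} [Fintype V] [Nonempty V] (σ : V → Ω)
    (F : ℤ → Ω → ℂ) (g : Ω → ℝ) (hg0 : ∀ t, 0 ≤ g t) (hg : ∀ t v, g (t + σ v) = g t)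
    (s : ℕ) (hs : 1 ≤ s) (I : Finset ℤ) (𝓑 : Finset (Finset ℤ)) (E : ℝ) (hE : 0 ≤ E)
    (H : ∀ t, ∑ v, ‖∑ i ∈ I, F i (t + σ v)‖ ^ (2 * s) ≤
      E * (∑ J ∈ 𝓑, (∑ v, ‖∑ i ∈ J, F i (t + σ v)‖ ^ (2 * s)) ^ ((1:ℝ)/s)) ^ s) :
    ∑ t, g t * ‖∑ i ∈ I, F i t‖ ^ (2 * s) ≤
      E * (∑ J ∈ 𝓑, (∑ t, g t * ‖∑ i ∈ J, F i t‖ ^ (2 * s)) ^ ((1:ℝ)/s)) ^ s := by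
  have key : ∀ J : Finset ℤ, ∑ t, g t * ∑ v, ‖∑ i ∈ J, F i (t + σ v)‖ ^ (2 * s) =
      (Fintype.card V : ℝ) * ∑ t, g t * ‖∑ i ∈ J, F i t‖ ^ (2 * s) := by
    intro J
    simp_rw [Finset.mul_sum]
    rw [Finset.sum_comm]
    have : ∀ v : V, ∑ t, g t * ‖∑ i ∈ J, F i (t + σ v)‖ ^ (2 * s) =
        ∑ t, g t * ‖∑ i ∈ J, F i t‖ ^ (2 * s) := by
      intro v
      rw [← Equiv.sum_comp (Equiv.addRight (σ v)) (fun t => g t * ‖∑ i ∈ J, F i t‖ ^ (2 * s))]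
      refine Finset.sum_congr rfl fun t _ => ?_
      simp [hg]
    rw [Finset.sum_congr rfl fun v _ => this v]
    simp [Finset.mul_sum]
  have hcard : (0:ℝ) < Fintype.card V := by exact_mod_cast Fintype.card_pos
  have hX : ∀ (J : Finset ℤ) (t : Ω), 0 ≤ g t * ∑ v, ‖∑ i ∈ J, F i (t + σ v)‖ ^ (2 * s) :=
    fun J t => mul_nonneg (hg0 t) (Finset.sum_nonneg fun _ _ => by positivity)
  have h1 : ∑ t, g t * ∑ v, ‖∑ i ∈ I, F i (t + σ v)‖ ^ (2 * s) ≤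
      E * ∑ t, (∑ J ∈ 𝓑, (g t * ∑ v, ‖∑ i ∈ J, F i (t + σ v)‖ ^ (2 * s)) ^ ((1:ℝ)/s)) ^ s := by
    rw [Finset.mul_sum]
    refine Finset.sum_le_sum fun t _ => ?_
    refine (mul_le_mul_of_nonneg_left (H t) (hg0 t)).trans (le_of_eq ?_)
    have : ∀ J ∈ 𝓑, (g t * ∑ v, ‖∑ i ∈ J, F i (t + σ v)‖ ^ (2 * s)) ^ ((1:ℝ)/s) =
        g t ^ ((1:ℝ)/s) * (∑ v, ‖∑ i ∈ J, F i (t + σ v)‖ ^ (2 * s)) ^ ((1:ℝ)/s) := fun J _ =>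
      Real.mul_rpow (hg0 t) (Finset.sum_nonneg fun _ _ => by positivity)
    rw [Finset.sum_congr rfl this, ← Finset.mul_sum, mul_pow, rpow_inv_pow (hg0 t) hs]
    ring
  have h2 := h1.trans (mul_le_mul_of_nonneg_left (minkowski2 𝓑 s hs _ hX) hE)
  rw [key] at h2
  simp_rw [key] at h2
  have : ∀ J ∈ 𝓑, ((Fintype.card V : ℝ) * ∑ t, g t * ‖∑ i ∈ J, F i t‖ ^ (2 * s)) ^ ((1:ℝ)/s) =
      (Fintype.card V : ℝ) ^ ((1:ℝ)/s) * (∑ t, g t * ‖∑ i ∈ J, F i t‖ ^ (2 * s)) ^ ((1:ℝ)/s) :=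
    fun J _ => Real.mul_rpow hcard.le (Finset.sum_nonneg fun t _ => mul_nonneg (hg0 t)
      (by positivity))
  rw [Finset.sum_congr rfl this, ← Finset.mul_sum, mul_pow, rpow_inv_pow hcard.le hs] at h2
  have h3 : (Fintype.card V : ℝ) * ∑ t, g t * ‖∑ i ∈ I, F i t‖ ^ (2 * s) ≤
    (Fintype.card V : ℝ) * (E * (∑ J ∈ 𝓑, (∑ t, g t * ‖∑ i ∈ J, F i t‖ ^ (2 * s)) ^ ((1:ℝ)/s)) ^ s) := by
    refine h2.trans (le_of_eq ?_); ring
  exact le_of_mul_le_mul_left h3 hcard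

end VM

open Finset Polynomial

namespace VM

set_option linter.unusedSectionVars false

variable {p B : ℕ} [Fact p.Prime] {l : ℕ}

/-- value of the linear family of polynomials -/
noncomputable def ev (φ : Fin l → (ZMod (p ^ B))[X]) (t : Fin l → ZMod (p ^ B)) (x : ℤ) :
    ZMod (p ^ B) := ∑ j, t j * (φ j).eval (x : ZMod (p ^ B))

/-- families congruent to the moment curve modulo `p` -/
def InC (φ : Fin l → (ZMod (p ^ B))[X]) : Prop :=
  ∀ j, ∃ G, φ j = X ^ ((j : ℕ) + 1) + C (p : ZMod (p ^ B)) * G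

noncomputable def Fam (c : ZMod (p ^ B)) (φ : Fin l → (ZMod (p ^ B))[X]) (z : ℤ → ℤ) (w : ℤ → ℂ) :
    ℤ → (Fin l → ZMod (p ^ B)) → ℂ := fun i t => w i * ZMod.stdAddChar (c * ev φ t (z i))

def Dec (p B l H : ℕ) [Fact p.Prime] (E : ℝ) : Prop :=
  ∀ φ : Fin l → (ZMod (p ^ B))[X], InC φ → ∀ (z : ℤ → ℤ) (w : ℤ → ℂ) (S : Finset ℤ),
    ∑ t, ‖∑ i ∈ S, Fam ((p : ZMod (p ^ B)) ^ (B - l * H)) φ z w i t‖ ^ (2 * tri l) ≤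
      E * (NN p z H (tri l) (Fam ((p : ZMod (p ^ B)) ^ (B - l * H)) φ z w) S) ^ tri l

noncomputable def jet (φ : Fin l → (ZMod (p ^ B))[X]) (ξ : ℤ) :
    Matrix (Fin l) (Fin l) (ZMod (p ^ B)) :=
  fun i j => (taylor (ξ : ZMod (p ^ B)) (φ j)).coeff ((i : ℕ) + 1)

lemma ev_add (φ : Fin l → (ZMod (p ^ B))[X]) (t u : Fin l → ZMod (p ^ B)) (x : ℤ) :
    ev φ (t + u) x = ev φ t x + ev φ u x := by
  simp [ev, add_mul, Finset.sum_add_distrib]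

lemma Fam_add (c : ZMod (p ^ B)) (φ : Fin l → (ZMod (p ^ B))[X]) (z : ℤ → ℤ) (w : ℤ → ℂ)
    (i : ℤ) (t u : Fin l → ZMod (p ^ B)) :
    Fam c φ z w i (t + u) = Fam c φ z w i t * ZMod.stdAddChar (c * ev φ u (z i)) := by
  simp only [Fam, ev_add, mul_add, AddChar.map_add_eq_mul]; ring

lemma norm_char (x : ZMod (p ^ B)) : ‖(ZMod.stdAddChar x : ℂ)‖ = 1 := by
  exact AddChar.norm_apply _ _

/-- normalised basis of the family at `ξ` -/
lemma exists_basis (φ : Fin l → (ZMod (p ^ B))[X]) (ξ : ℤ) (hu : IsUnit (jet φ ξ).det) :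
    ∃ (τ : Fin l → Fin l → ZMod (p ^ B)) (c : Fin l → ZMod (p ^ B))
      (T : Fin l → (ZMod (p ^ B))[X]),
      (∀ m, ∑ j, C (τ m j) * taylor (ξ : ZMod (p ^ B)) (φ j) =
        C (c m) + X ^ ((m : ℕ) + 1) + X ^ (l + 1) * T m) := by
  classical
  set M := jet φ ξ with hM
  have hinv : M * M⁻¹ = 1 := Matrix.mul_nonsing_inv _ hu
  have : ∀ m : Fin l, ∃ c T, ∑ j, C (M⁻¹ j m) * taylor (ξ : ZMod (p ^ B)) (φ j) =
        C c + X ^ ((m : ℕ) + 1) + X ^ (l + 1) * T := by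
    intro m
    set Q := ∑ j, C (M⁻¹ j m) * taylor (ξ : ZMod (p ^ B)) (φ j) with hQ
    have hc : ∀ i : Fin l, Q.coeff ((i : ℕ) + 1) = if i = m then 1 else 0 := by
      intro i
      rw [hQ, Polynomial.finsetSum_coeff]
      have := congrFun (congrFun hinv i) m
      rw [Matrix.mul_apply, Matrix.one_apply] at this
      rw [← this]
      refine Finset.sum_congr rfl fun j _ => ?_
      rw [Polynomial.coeff_C_mul, hM, jet, mul_comm]
    have : X ^ (l + 1) ∣ Q - C (Q.coeff 0) - X ^ ((m : ℕ) + 1) := by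
      rw [Polynomial.X_pow_dvd_iff]
      intro d hd
      rcases d with _ | d
      · simp
      · have h1 := hc ⟨d, by omega⟩
        simp only at h1
        rw [Polynomial.coeff_sub, Polynomial.coeff_sub, h1, Polynomial.coeff_X_pow]
        simp [Fin.ext_iff]
    obtain ⟨T, hT⟩ := this
    refine ⟨Q.coeff 0, T, ?_⟩
    rw [← hT]; ring
  choose c T h using this
  exact ⟨fun m j => M⁻¹ j m, c, T, h⟩

lemma ev_basis (φ : Fin l → (ZMod (p ^ B))[X]) (ξ : ℤ)
    (τ : Fin l → Fin l → ZMod (p ^ B)) (c : Fin l → ZMod (p ^ B))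
      (T : Fin l → (ZMod (p ^ B))[X])
      (h : ∀ m, ∑ j, C (τ m j) * taylor (ξ : ZMod (p ^ B)) (φ j) =
        C (c m) + X ^ ((m : ℕ) + 1) + X ^ (l + 1) * T m)
      (u : Fin l → ZMod (p ^ B)) (x y : ℤ) (hx : x = ξ + y) :
    ev φ (fun j => ∑ m, u m * τ m j) x = ∑ m, u m * (c m + (y : ZMod (p ^ B)) ^ ((m : ℕ) + 1)
      + (y : ZMod (p ^ B)) ^ (l + 1) * (T m).eval (y : ZMod (p ^ B))) := by
  have h2 : ∀ m, ∑ j, τ m j * (φ j).eval (x : ZMod (p ^ B)) =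
      c m + (y : ZMod (p ^ B)) ^ ((m : ℕ) + 1)
      + (y : ZMod (p ^ B)) ^ (l + 1) * (T m).eval (y : ZMod (p ^ B)) := by
    intro m
    have := congrArg (Polynomial.eval (y : ZMod (p ^ B))) (h m)
    simp only [Polynomial.eval_finsetSum, Polynomial.eval_mul, Polynomial.eval_C,
      Polynomial.taylor_eval, Polynomial.eval_add, Polynomial.eval_pow, Polynomial.eval_X] at this
    rw [← this]
    refine Finset.sum_congr rfl fun j _ => ?_
    rw [hx]; push_cast; rw [add_comm]
  simp_rw [← h2]
  unfold ev
  simp_rw [Finset.sum_mul, Finset.mul_sum]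
  rw [Finset.sum_comm]
  refine Finset.sum_congr rfl fun m _ => Finset.sum_congr rfl fun j _ => by ring

lemma tri_pos (hl : 1 ≤ l) : 1 ≤ tri l := by
  unfold tri
  rw [Nat.le_div_iff_mul_le (by norm_num)]
  nlinarith

/-- decoupling of a nondegenerate family on a residue class -/
lemma dec_class (hl : 1 ≤ l) (φ : Fin l → (ZMod (p ^ B))[X]) (ξ : ℤ)
    (hu : IsUnit (jet φ ξ).det) {a a' : ℕ} (ha : 1 ≤ a) (haa : a ≤ a') (hB : l * a' ≤ B)
    {E : ℝ} (hE : 0 ≤ E) (hD : Dec p B l (a' - a) E) (I : Finset ℤ) (z : ℤ → ℤ) (w : ℤ → ℂ)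
    (hI : ∀ i ∈ I, (p : ℤ) ^ a ∣ z i - ξ) :
    ∑ t, ‖∑ i ∈ I, Fam ((p : ZMod (p ^ B)) ^ (B - l * a')) φ z w i t‖ ^ (2 * tri l) ≤
      E * (NN p z a' (tri l) (Fam ((p : ZMod (p ^ B)) ^ (B - l * a')) φ z w) I) ^ tri l := by
  classical
  have hp : p.Prime := Fact.out
  have hpz : (p:ℤ) ≠ 0 := by exact_mod_cast hp.ne_zero
  obtain ⟨τ, c, T, hb⟩ := exists_basis φ ξ hu
  set P : ZMod (p ^ B) := (p : ZMod (p ^ B)) with hP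
  -- the rescaled variable
  set y : ℤ → ℤ := fun i => (z i - ξ) / (p:ℤ) ^ a with hy
  have hyz : ∀ i ∈ I, z i = ξ + (p:ℤ) ^ a * y i := by
    intro i hi
    rw [hy]; simp only
    rw [Int.mul_ediv_cancel' (hI i hi)]; ring
  set φ' : Fin l → (ZMod (p ^ B))[X] := fun m => X ^ ((m:ℕ) + 1) + C P *
    (C (P ^ (a * (l - m) - 1)) * X ^ (l + 1) * (T m).comp (C (P ^ a) * X)) with hφ'
  have hin : InC φ' := fun j => ⟨_, rfl⟩
  set σ : (Fin l → ZMod (p ^ B)) → (Fin l → ZMod (p ^ B)) :=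
    fun v j => ∑ m : Fin l, (P ^ (a * (l - 1 - (m:ℕ))) * v m) * τ m j with hσ
  set cst : (Fin l → ZMod (p ^ B)) → ZMod (p ^ B) :=
    fun v => ∑ m : Fin l, P ^ (a * (l - 1 - (m:ℕ))) * v m * c m with hcst
  have hev : ∀ v, ∀ i ∈ I, ev φ (σ v) (z i) = cst v + P ^ (a * l) * ev φ' v (y i) := by
    intro v i hi
    rw [hσ]; simp only
    rw [ev_basis φ ξ τ c T hb (fun m : Fin l => P ^ (a * (l - 1 - (m:ℕ))) * v m) (z i) ((p:ℤ) ^ a * y i)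
      (hyz i hi)]
    rw [hcst]; simp only [ev]
    rw [Finset.mul_sum, ← Finset.sum_add_distrib]
    refine Finset.sum_congr rfl fun m _ => ?_
    rw [hφ']
    simp only [eval_add, eval_mul, eval_pow, eval_X, eval_C, eval_comp]
    push_cast
    rw [← hP]
    have hm := m.2
    have e1 : P ^ (a * (l - 1 - m)) * (P ^ a) ^ ((m:ℕ) + 1) = P ^ (a * l) := by
      rw [← pow_mul, ← pow_add]; congr 1
      rw [← Nat.mul_add]; congr 1; omega
    have e2 : P ^ (a * (l - 1 - m)) * (P ^ a) ^ (l + 1) = P ^ (a * l) * (P * P ^ (a * (l - m) - 1)) := by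
      rw [← pow_mul, ← pow_add, ← pow_succ', ← pow_add]; congr 1
      have : 1 ≤ a * (l - m) := Nat.one_le_iff_ne_zero.2 (by
        have : 0 < l - m := by omega
        positivity)
      rw [Nat.sub_add_cancel this, ← Nat.mul_add, ← Nat.mul_add]; congr 1; omega
    set yy : ZMod (p ^ B) := (y i : ZMod (p ^ B))
    calc P ^ (a * (l - 1 - m)) * v m * (c m + (P ^ a * yy) ^ ((m:ℕ) + 1) +
          (P ^ a * yy) ^ (l + 1) * eval (P ^ a * yy) (T m))
        = P ^ (a * (l - 1 - m)) * v m * c m + (P ^ (a * (l - 1 - m)) * (P ^ a) ^ ((m:ℕ) + 1)) * v m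
            * yy ^ ((m:ℕ)+1) + (P ^ (a * (l - 1 - m)) * (P ^ a) ^ (l + 1)) * v m * yy ^ (l+1)
            * eval (P ^ a * yy) (T m) := by ring
      _ = _ := by rw [e1, e2]; ring
  -- the block structure
  have hblk : blocks p y (a' - a) I = blocks p z a' I := by
    apply blocks_congr
    intro i hi j hj
    rw [hyz i hi, hyz j hj]
    have : ξ + (p:ℤ) ^ a * y j - (ξ + (p:ℤ) ^ a * y i) = (p:ℤ) ^ a * (y j - y i) := by ring
    rw [this]
    conv_rhs => rw [← Nat.add_sub_cancel' haa, pow_add]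
    rw [mul_dvd_mul_iff_left (pow_ne_zero _ hpz)]
  have hpw : P ^ (B - l * a') * P ^ (a * l) = P ^ (B - l * (a' - a)) := by
    rw [← pow_add]; congr 1
    have : l * a' = l * (a' - a) + l * a := by rw [← Nat.mul_add, Nat.sub_add_cancel haa]
    have h3 : a * l = l * a := mul_comm _ _
    omega
  have hnorm : ∀ (t v : Fin l → ZMod (p ^ B)) (J : Finset ℤ), J ⊆ I →
      ‖∑ i ∈ J, Fam (P ^ (B - l * a')) φ z w i (t + σ v)‖ =
      ‖∑ i ∈ J, Fam (P ^ (B - l * (a' - a))) φ' y (fun i => Fam (P ^ (B - l * a')) φ z w i t) i v‖ := by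
    intro t v J hJ
    have : ∑ i ∈ J, Fam (P ^ (B - l * a')) φ z w i (t + σ v) =
      (ZMod.stdAddChar (P ^ (B - l * a') * cst v) : ℂ) * ∑ i ∈ J,
        Fam (P ^ (B - l * (a' - a))) φ' y (fun i => Fam (P ^ (B - l * a')) φ z w i t) i v := by
      rw [Finset.mul_sum]
      refine Finset.sum_congr rfl fun i hi => ?_
      rw [Fam_add, hev v i (hJ hi), mul_add, AddChar.map_add_eq_mul, ← mul_assoc, ← mul_assoc, hpw]
      conv_rhs => rw [Fam]
      ring
    rw [this, norm_mul, norm_char, one_mul]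
  have main := shift_dec (V := Fin l → ZMod (p ^ B)) σ (Fam (P ^ (B - l * a')) φ z w) (fun _ => 1)
    (fun _ => zero_le_one) (fun _ _ => rfl) (tri l) (tri_pos hl) I (blocks p z a' I) E hE (by
      intro t
      have h1 := hD φ' hin y (fun i => Fam (P ^ (B - l * a')) φ z w i t) I
      rw [NN, hblk] at h1
      simp_rw [nn] at h1
      rw [Finset.sum_congr rfl fun v _ => by rw [hnorm t v I subset_rfl]]
      refine h1.trans (le_of_eq ?_)
      congr 2
      refine Finset.sum_congr rfl fun J hJ => ?_
      congr 1
      refine Finset.sum_congr rfl fun v _ => ?_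
      rw [hnorm t v J (blocks_subset hJ)])
  simp only [one_mul] at main
  exact main

end VM

open Finset Polynomial

namespace VM

lemma det_ne_zero_field {p : ℕ} [Fact p.Prime] {k l : ℕ} (hl : l ≤ k) (hk : k < p) (w : ZMod p)
    (hw : w ≠ 0 ∨ l = k) :
    (Matrix.of (fun (i m : Fin l) => (taylor w ((X : (ZMod p)[X]) ^ (k - l + (m:ℕ) + 1))).coeff
      ((i:ℕ) + 1))).det ≠ 0 := by
  intro hdet
  obtain ⟨v, hv0, hv⟩ := Matrix.exists_mulVec_eq_zero_iff.2 hdet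
  apply hv0
  set Q : (ZMod p)[X] := ∑ m : Fin l, C (v m) * X ^ (k - l + (m:ℕ) + 1) with hQ
  set S : (ZMod p)[X] := ∑ m : Fin l, C (v m * ((k - l + (m:ℕ) + 1 : ℕ) : ZMod p)) * X ^ (m:ℕ) with hS
  have hcoef : ∀ i : Fin l, (taylor w Q).coeff ((i:ℕ) + 1) = 0 := by
    intro i
    have := congrFun hv i
    simp only [Matrix.mulVec, dotProduct, Matrix.of_apply, Pi.zero_apply] at this
    rw [← this, hQ, map_sum, finsetSum_coeff]
    refine Finset.sum_congr rfl fun m _ => ?_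
    rw [taylor_mul, taylor_C, coeff_C_mul, mul_comm]
  have hder : derivative Q = X ^ (k - l) * S := by
    rw [hQ, hS, derivative_sum, Finset.mul_sum]
    refine Finset.sum_congr rfl fun m _ => ?_
    rw [derivative_C_mul, derivative_X_pow, C_mul]
    simp only [Nat.add_sub_cancel]
    rw [pow_add]; ring
  have htd : derivative (taylor w Q) = taylor w (derivative Q) := by
    rw [taylor_apply, taylor_apply, derivative_comp]; simp
  have hdvd : X ^ l ∣ taylor w (derivative Q) := by
    rw [X_pow_dvd_iff]
    intro d hd
    rw [← htd, coeff_derivative, hcoef ⟨d, hd⟩, zero_mul]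
  rw [hder, taylor_mul] at hdvd
  have hcop : IsCoprime ((X : (ZMod p)[X]) ^ l) (taylor w (X ^ (k - l))) := by
    rcases hw with hw | hw
    · rw [taylor_apply]
      simp only [pow_comp, X_comp]
      apply IsCoprime.pow
      refine ⟨-C w⁻¹, C w⁻¹, ?_⟩
      have : (C w⁻¹ * C w : (ZMod p)[X]) = 1 := by rw [← C_mul, inv_mul_cancel₀ hw, C_1]
      linear_combination this
    · simp [hw, taylor_apply, isCoprime_one_right]
  have h2 : X ^ l ∣ taylor w S := hcop.dvd_of_dvd_mul_left hdvd
  have hdeg : S.degree < l := by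
    rw [hS]
    refine (degree_sum_le _ _).trans_lt ?_
    rw [Finset.sup_lt_iff (by exact WithBot.bot_lt_coe _)]
    intro m _
    exact (degree_C_mul_X_pow_le _ _).trans_lt (by exact_mod_cast m.2)
  have hS0 : taylor w S = 0 := by
    by_contra hne
    have h3 := degree_le_of_dvd h2 hne
    rw [degree_X_pow, degree_taylor] at h3
    exact absurd (h3.trans_lt hdeg) (lt_irrefl _)
  have hS1 : S = 0 := by
    have := taylor_injective w (by rw [hS0, map_zero] : taylor w S = taylor w 0)
    exact this
  funext m
  have h4 : S.coeff m = v m * ((k - l + (m:ℕ) + 1 : ℕ) : ZMod p) := by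
    rw [hS, finsetSum_coeff, Finset.sum_eq_single m]
    · rw [coeff_C_mul_X_pow, if_pos rfl]
    · intro b _ hb
      rw [coeff_C_mul_X_pow, if_neg]
      intro h; exact hb (Fin.ext h.symm)
    · simp
  rw [hS1, coeff_zero] at h4
  have h5 : ((k - l + (m:ℕ) + 1 : ℕ) : ZMod p) ≠ 0 := by
    rw [Ne, ZMod.natCast_eq_zero_iff]
    intro hd
    have := Nat.le_of_dvd (by omega) hd
    have := m.2
    omega
  simpa using (mul_eq_zero.1 h4.symm).resolve_right h5

variable {p B : ℕ} [Fact p.Prime]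

/-- reduction modulo `p` -/
def red (hB : B ≠ 0) : ZMod (p ^ B) →+* ZMod p := ZMod.castHom (dvd_pow_self p hB) (ZMod p)

lemma isUnit_of_red (hB : B ≠ 0) (x : ZMod (p ^ B)) (hx : red hB x ≠ 0) : IsUnit x := by
  obtain ⟨n, rfl⟩ := ZMod.natCast_zmod_surjective x
  rw [ZMod.isUnit_iff_coprime]
  apply Nat.Coprime.pow_right
  rw [map_natCast, Ne, ZMod.natCast_eq_zero_iff] at hx
  exact ((Nat.Prime.coprime_iff_not_dvd Fact.out).2 hx).symm

lemma red_p (hB : B ≠ 0) : red hB (p : ZMod (p ^ B)) = 0 := by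
  simp

lemma isUnit_jet {k l : ℕ} (hl : l ≤ k) (hk : k < p) (ξ : ℤ)
    (hw : ((ξ : ℤ) : ZMod p) ≠ 0 ∨ l = k) (φ : Fin l → (ZMod (p ^ B))[X])
    (h : ∀ m, ∃ c G, φ m = C c + X ^ (k - l + (m:ℕ) + 1) + C (p : ZMod (p ^ B)) * G) :
    IsUnit (jet φ ξ).det := by
  rcases Nat.eq_zero_or_pos B with hB | hB
  · subst hB
    have : Subsingleton (ZMod (p ^ 0)) := by rw [pow_zero]; infer_instance
    exact isUnit_of_subsingleton _
  · have hB' : B ≠ 0 := by omega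
    apply isUnit_of_red hB'
    rw [RingHom.map_det]
    convert det_ne_zero_field hl hk (ξ : ZMod p) hw using 2
    ext i m
    obtain ⟨c, G, hG⟩ := h m
    simp only [RingHom.mapMatrix_apply, Matrix.map_apply, jet, Matrix.of_apply]
    have e : (taylor (ξ : ZMod (p ^ B)) (φ m)).map (red hB') =
        taylor (ξ : ZMod p) ((φ m).map (red hB')) := by
      rw [taylor_apply, taylor_apply, map_comp]; simp
    rw [← coeff_map, e, hG]
    simp [red_p, coeff_C]

lemma isUnit_jet_InC {k : ℕ} (hk : k < p) (ξ : ℤ) (φ : Fin k → (ZMod (p ^ B))[X]) (h : InC φ) :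
    IsUnit (jet φ ξ).det := by
  refine isUnit_jet le_rfl hk ξ (Or.inr rfl) φ fun m => ?_
  obtain ⟨G, hG⟩ := h m
  exact ⟨0, G, by simp [hG]⟩

end VM

open Finset Polynomial

namespace VM

set_option linter.unusedSectionVars false

variable {p B : ℕ} [Fact p.Prime]

lemma p_nilp : IsNilpotent (p : ZMod (p ^ B)) := ⟨B, by
  have := ZMod.natCast_self (p ^ B); push_cast at this; exact this⟩

lemma ppow_zero {m : ℕ} (h : B ≤ m) : (p : ZMod (p ^ B)) ^ m = 0 := by
  obtain ⟨c, rfl⟩ := Nat.exists_eq_add_of_le h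
  have := ZMod.natCast_self (p ^ B); push_cast at this
  rw [pow_add, this, zero_mul]

lemma orth_sq {Ω : Type*} [Fintype Ω] (F : ℤ → Ω → ℂ) (J : Finset ℤ) :
    ((∑ t, ‖∑ i ∈ J, F i t‖ ^ 2 : ℝ) : ℂ) =
      ∑ i ∈ J, ∑ j ∈ J, ∑ t, F i t * (starRingEnd ℂ) (F j t) := by
  push_cast
  have : ∀ t, (‖∑ i ∈ J, F i t‖ : ℂ) ^ 2 = ∑ i ∈ J, ∑ j ∈ J, F i t * (starRingEnd ℂ) (F j t) := by
    intro t
    rw [← Complex.mul_conj', map_sum, Finset.sum_mul_sum]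
  simp_rw [this]
  rw [Finset.sum_comm]
  refine Finset.sum_congr rfl fun i _ => ?_
  rw [Finset.sum_comm]

lemma dec_one {H : ℕ} (hH : H ≤ B) : Dec p B 1 H 1 := by
  classical
  intro φ hφ z w S
  have ht : tri 1 = 1 := rfl
  rw [ht]
  set F := Fam ((p : ZMod (p ^ B)) ^ (B - 1 * H)) φ z w with hF
  obtain ⟨G, hG⟩ := hφ 0
  have horth : ∀ i j, ¬ ((p:ℤ) ^ H ∣ z j - z i) → ∑ t, F i t * (starRingEnd ℂ) (F j t) = 0 := by
    intro i j hij
    set P : ZMod (p ^ B) := (p : ZMod (p ^ B)) with hP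
    set d : ZMod (p ^ B) := P ^ (B - H) * ((φ 0).eval (z i : ZMod (p ^ B)) - (φ 0).eval (z j : ZMod (p ^ B))) with hd
    have hd0 : d ≠ 0 := by
      obtain ⟨q, hq⟩ := Polynomial.sub_dvd_eval_sub (z i : ZMod (p ^ B)) (z j : ZMod (p ^ B)) G
      have e : d = P ^ (B - H) * ((z i : ZMod (p ^ B)) - z j) * (1 + P * q) := by
        rw [hd, hG]; simp only [Fin.val_zero, eval_add, eval_mul, eval_pow, eval_X, eval_C]
        linear_combination P ^ (B - H) * P * hq
      have hu : IsUnit (1 + P * q) := IsNilpotent.isUnit_one_add ((Commute.all _ _).isNilpotent_mul_right p_nilp)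
      rw [e]
      intro h0
      have h1 := (hu.mul_left_eq_zero).1 h0
      apply hij
      have h2 : (((p:ℤ) ^ (B - H) * (z i - z j) : ℤ) : ZMod (p ^ B)) = 0 := by
        push_cast; exact h1
      rw [ZMod.intCast_zmod_eq_zero_iff_dvd] at h2
      push_cast at h2
      have h3 : (p:ℤ) ^ B = (p:ℤ) ^ (B - H) * (p:ℤ) ^ H := by
        rw [← pow_add, Nat.sub_add_cancel hH]
      rw [h3, mul_dvd_mul_iff_left (by
        have := (Fact.out : p.Prime).ne_zero; positivity)] at h2
      rw [← neg_sub, dvd_neg]; exact h2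
    have e : ∀ t : Fin 1 → ZMod (p ^ B), F i t * (starRingEnd ℂ) (F j t) =
        w i * (starRingEnd ℂ) (w j) * ZMod.stdAddChar (t 0 * d) := by
      intro t
      rw [hF, Fam, Fam, map_mul (starRingEnd ℂ), ← AddChar.map_neg_eq_conj]
      rw [mul_mul_mul_comm, ← AddChar.map_add_eq_mul]
      congr 2
      simp only [ev, Fin.sum_univ_one, hd, one_mul]; ring
    simp_rw [e]
    rw [← Finset.mul_sum]
    have := (Equiv.funUnique (Fin 1) (ZMod (p ^ B))).sum_comp
      (fun x => (ZMod.stdAddChar (x * d) : ℂ))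
    simp only [Equiv.funUnique_apply] at this
    have e2 : ∑ t : Fin 1 → ZMod (p ^ B), (ZMod.stdAddChar (t 0 * d) : ℂ) = 0 := by
      refine this.trans ?_
      rw [AddChar.sum_mulShift d (ZMod.isPrimitive_stdAddChar _), if_neg hd0]
      simp
    rw [e2, mul_zero]
  have key : ∑ t, ‖∑ i ∈ S, F i t‖ ^ 2 = ∑ J ∈ blocks p z H S, ∑ t, ‖∑ i ∈ J, F i t‖ ^ 2 := by
    have : ((∑ t, ‖∑ i ∈ S, F i t‖ ^ 2 : ℝ) : ℂ) =
        ((∑ J ∈ blocks p z H S, ∑ t, ‖∑ i ∈ J, F i t‖ ^ 2 : ℝ) : ℂ) := by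
      rw [orth_sq, Complex.ofReal_sum]
      simp_rw [orth_sq]
      rw [sum_blocks (p := p) (z := z) H S]
      refine Finset.sum_congr rfl fun J hJ => Finset.sum_congr rfl fun i hi => ?_
      symm
      apply Finset.sum_subset (blocks_subset hJ)
      intro j hj hjJ
      apply horth
      intro hd
      apply hjJ
      rw [blocks_eq_blk hJ hi]
      exact mem_blk.2 ⟨hj, hd⟩
    exact_mod_cast this
  rw [NN]
  simp only [nn, mul_one, Nat.cast_one, div_one, Real.rpow_one, pow_one, one_mul]
  rw [key]

end VM

open Finset Polynomial

namespace VM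

lemma tri_two (l : ℕ) : 2 * tri l = l * (l + 1) := by
  unfold tri
  exact Nat.mul_div_cancel' (Nat.even_mul_succ_self l).two_dvd

lemma tri_mono {l k : ℕ} (h : l ≤ k) : tri l ≤ tri k := by
  have h1 := tri_two l
  have h2 := tri_two k
  have : l * (l + 1) ≤ k * (k + 1) := by gcongr
  omega

lemma holder_nat {Ω : Type*} [Fintype Ω] (a b : ℕ) (X A C : Ω → ℝ)
    (hX : ∀ t, 0 ≤ X t) (hA : ∀ t, 0 ≤ A t) (hC : ∀ t, 0 ≤ C t) (hab : 1 ≤ a + b)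
    (h : ∀ t, X t ^ (a + b) ≤ A t ^ a * C t ^ b) :
    (∑ t, X t) ^ (a + b) ≤ (∑ t, A t) ^ a * (∑ t, C t) ^ b := by
  have hSX : 0 ≤ ∑ t, X t := Finset.sum_nonneg fun t _ => hX t
  have hSA : 0 ≤ ∑ t, A t := Finset.sum_nonneg fun t _ => hA t
  have hSC : 0 ≤ ∑ t, C t := Finset.sum_nonneg fun t _ => hC t
  rcases Nat.eq_zero_or_pos a with ha | ha
  · subst ha
    simp only [zero_add, pow_zero, one_mul] at h ⊢
    gcongr with t
    exact le_of_pow_le_pow_left₀ (by omega) (hC t) (h t)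
  rcases Nat.eq_zero_or_pos b with hb | hb
  · subst hb
    simp only [add_zero, pow_zero, mul_one] at h ⊢
    gcongr with t
    exact le_of_pow_le_pow_left₀ (by omega) (hA t) (h t)
  have haR : (0:ℝ) < a := by exact_mod_cast ha
  have hbR : (0:ℝ) < b := by exact_mod_cast hb
  set n : ℝ := (a:ℝ) + b with hn
  have hn0 : 0 < n := by positivity
  have hconj : (n / a).HolderConjugate (n / b) := by
    rw [Real.holderConjugate_iff]
    constructor
    · rw [lt_div_iff₀ haR]; linarith
    · rw [inv_div, inv_div, ← add_div]; exact div_self hn0.ne'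
  have key := Real.inner_le_Lp_mul_Lq_of_nonneg (s := (Finset.univ : Finset Ω)) (f := fun t => A t ^ ((a:ℝ) / n))
    (g := fun t => C t ^ ((b:ℝ) / n)) hconj (fun t _ => Real.rpow_nonneg (hA t) _)
    (fun t _ => Real.rpow_nonneg (hC t) _)
  have e1 : ∀ x : ℝ, 0 ≤ x → ∀ c : ℝ, 0 < c → (x ^ (c / n)) ^ (n / c) = x := by
    intro x hx c hc
    rw [← Real.rpow_mul hx, div_mul_div_comm, mul_comm, div_self (by positivity), Real.rpow_one]
  simp only [e1 _ (hA _) _ haR, e1 _ (hC _) _ hbR, one_div_div] at key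
  have hX2 : ∀ t, X t ≤ A t ^ ((a:ℝ) / n) * C t ^ ((b:ℝ) / n) := by
    intro t
    refine le_of_pow_le_pow_left₀ (n := a + b) (by omega) (mul_nonneg (Real.rpow_nonneg (hA t) _) (Real.rpow_nonneg (hC t) _)) ?_
    refine (h t).trans (le_of_eq ?_)
    rw [mul_pow]
    have e2 : ∀ x : ℝ, 0 ≤ x → ∀ c : ℕ, (x ^ ((c:ℝ) / n)) ^ (a + b) = x ^ c := by
      intro x hx c
      rw [← Real.rpow_natCast, ← Real.rpow_mul hx, ← Real.rpow_natCast]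
      congr 1; push_cast; rw [← hn]; field_simp
    rw [e2 _ (hA t), e2 _ (hC t)]
  have h3 := (Finset.sum_le_sum fun t (_ : t ∈ Finset.univ) => hX2 t).trans key
  have h4 := pow_le_pow_left₀ hSX h3 (a + b)
  refine h4.trans (le_of_eq ?_)
  rw [mul_pow]
  have e2 : ∀ x : ℝ, 0 ≤ x → ∀ c : ℕ, (x ^ ((c:ℝ) / n)) ^ (a + b) = x ^ c := by
    intro x hx c
    rw [← Real.rpow_natCast, ← Real.rpow_mul hx, ← Real.rpow_natCast]
    congr 1; push_cast; rw [← hn]; field_simp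
  rw [e2 _ hSA, e2 _ hSC]

/-- bilinear estimate -/
def Bil (p B k H l a b : ℕ) [Fact p.Prime] (M : ℝ) : Prop :=
  ∀ φ : Fin k → (ZMod (p ^ B))[X], InC φ → ∀ (z : ℤ → ℤ) (w : ℤ → ℂ) (I I' : Finset ℤ) (ξ η : ℤ),
    (∀ i ∈ I, (p:ℤ) ^ a ∣ z i - ξ) → (∀ i ∈ I', (p:ℤ) ^ b ∣ z i - η) → ¬ ((p:ℤ) ∣ ξ - η) →
    ∑ t, ‖∑ i ∈ I', Fam ((p : ZMod (p ^ B)) ^ (B - k * H)) φ z w i t‖ ^ (2 * (tri k - tri l)) *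
      ‖∑ i ∈ I, Fam ((p : ZMod (p ^ B)) ^ (B - k * H)) φ z w i t‖ ^ (2 * tri l) ≤
      M * NN p z H (tri k) (Fam ((p : ZMod (p ^ B)) ^ (B - k * H)) φ z w) I ^ tri l *
        NN p z H (tri k) (Fam ((p : ZMod (p ^ B)) ^ (B - k * H)) φ z w) I' ^ (tri k - tri l)

variable {p B k H : ℕ} [Fact p.Prime]

lemma dec_mono {l h : ℕ} {E E' : ℝ} (hE : E ≤ E') (h1 : Dec p B l h E) : Dec p B l h E' := by
  intro φ hφ z w S
  refine (h1 φ hφ z w S).trans ?_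
  have := NN_nonneg (p := p) (z := z) h (tri l) (Fam ((p : ZMod (p ^ B)) ^ (B - l * h)) φ z w) S
  gcongr

lemma bil_mono {l a b : ℕ} {M M' : ℝ} (hM : M ≤ M') (h1 : Bil p B k H l a b M) :
    Bil p B k H l a b M' := by
  intro φ hφ z w I I' ξ η hI hI' hξ
  refine (h1 φ hφ z w I I' ξ η hI hI' hξ).trans ?_
  have := NN_nonneg (p := p) (z := z) H (tri k) (Fam ((p : ZMod (p ^ B)) ^ (B - k * H)) φ z w) I
  have := NN_nonneg (p := p) (z := z) H (tri k) (Fam ((p : ZMod (p ^ B)) ^ (B - k * H)) φ z w) I'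
  gcongr

lemma bil_E (hk : 1 ≤ k) (hkp : k < p) (hB : k * H ≤ B) {l a b : ℕ} (hl : l ≤ k) (ha : 1 ≤ a) (haH : a ≤ H)
    (hb : 1 ≤ b) (hbH : b ≤ H) {E : ℝ} (hE : 0 ≤ E) (h1 : Dec p B k (H - a) E)
    (h2 : Dec p B k (H - b) E) : Bil p B k H l a b E := by
  intro φ hφ z w I I' ξ η hI hI' hξ
  set F := Fam ((p : ZMod (p ^ B)) ^ (B - k * H)) φ z w with hF
  have d1 := dec_class hk φ ξ (isUnit_jet_InC hkp ξ φ hφ) ha haH hB hE h1 I z w hI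
  have d2 := dec_class hk φ η (isUnit_jet_InC hkp η φ hφ) hb hbH hB hE h2 I' z w hI'
  rw [← hF] at d1 d2
  have n1 := NN_nonneg (p := p) (z := z) H (tri k) F I
  have n2 := NN_nonneg (p := p) (z := z) H (tri k) F I'
  have hm := tri_mono hl
  have hkp := tri_pos hk
  refine le_of_pow_le_pow_left₀ (n := tri k - tri l + tri l) (by omega) (by positivity) ?_
  refine (holder_nat (tri k - tri l) (tri l) _ (fun t => ‖∑ i ∈ I', F i t‖ ^ (2 * tri k))
    (fun t => ‖∑ i ∈ I, F i t‖ ^ (2 * tri k)) (fun t => by positivity) (fun t => by positivity)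
    (fun t => by positivity) (by omega) ?_).trans ?_
  · intro t
    rw [mul_pow, ← pow_mul, ← pow_mul, ← pow_mul, ← pow_mul, Nat.sub_add_cancel hm]
    apply le_of_eq; congr 2 <;> ring
  · calc _ ≤ (E * NN p z H (tri k) F I' ^ tri k) ^ (tri k - tri l) *
          (E * NN p z H (tri k) F I ^ tri k) ^ (tri l) := by
          gcongr
      _ = _ := by
        have e : tri k = tri k - tri l + tri l := by omega
        generalize tri k - tri l = u at *
        generalize tri l = v at *
        rw [e]
        ring

/-- the case `l = 0` -/
lemma bil_zero (hk : 1 ≤ k) (hkp : k < p) (hB : k * H ≤ B) {a b : ℕ} 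
    (hb : 1 ≤ b) (hbH : b ≤ H) {E : ℝ} (hE : 0 ≤ E) 
    (h2 : Dec p B k (H - b) E) : Bil p B k H 0 a b E := by
  intro φ hφ z w I I' ξ η hI hI' hξ
  have d2 := dec_class hk φ η (isUnit_jet_InC hkp η φ hφ) hb hbH hB hE h2 I' z w hI'
  simpa [tri] using d2

lemma bil_Ho {l a b : ℕ} (hl : 1 ≤ l) (hlk : l + 1 ≤ k) {M1 M2 M : ℝ} (hM1 : 0 ≤ M1)
    (hM2 : 0 ≤ M2) (hM : 0 ≤ M) (h1 : Bil p B k H (k - l) b a M1) (h2 : Bil p B k H (l - 1) a b M2)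
    (hMM : M1 * M2 ^ (k - l) ≤ M ^ (k - l + 1)) : Bil p B k H l a b M := by
  intro φ hφ z w I I' ξ η hI hI' hξ
  have d1 := h1 φ hφ z w I' I η ξ hI' hI (by rwa [← neg_sub, dvd_neg])
  have d2 := h2 φ hφ z w I I' ξ η hI hI' hξ
  set F := Fam ((p : ZMod (p ^ B)) ^ (B - k * H)) φ z w with hF
  have n1 := NN_nonneg (p := p) (z := z) H (tri k) F I
  have n2 := NN_nonneg (p := p) (z := z) H (tri k) F I'
  have t1 := tri_two k
  have t2 := tri_two l
  have t3 := tri_two (k - l)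
  have t4 := tri_two (l - 1)
  have m1 := tri_mono (show l ≤ k by omega)
  have m2 := tri_mono (show k - l ≤ k by omega)
  have m3 := tri_mono (show l - 1 ≤ k by omega)
  obtain ⟨q, rfl⟩ : ∃ q, k = l + q := ⟨k - l, by omega⟩
  obtain ⟨r, rfl⟩ : ∃ r, l = r + 1 := ⟨l - 1, by omega⟩
  simp only [Nat.add_sub_cancel_left, Nat.add_sub_cancel] at *
  have i1 : (q + 1) * tri (r + 1) = (tri (r + 1 + q) - tri q) + q * tri r := by
    zify [m2]; zify at t1 t2 t3 t4
    refine mul_left_cancel₀ (two_ne_zero (α := ℤ)) ?_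
    linear_combination ((q:ℤ)+1)*t2 - t1 + t3 - q*t4
  have i2 : (q + 1) * (tri (r + 1 + q) - tri (r + 1)) = tri q + q * (tri (r + 1 + q) - tri r) := by
    zify [m1, m3]; zify at t1 t2 t3 t4
    refine mul_left_cancel₀ (two_ne_zero (α := ℤ)) ?_
    linear_combination t1 - ((q:ℤ)+1)*t2 - t3 + q*t4
  generalize tri (r + 1 + q) - tri (r + 1) = u1 at *
  generalize tri (r + 1 + q) - tri q = u2 at *
  generalize tri (r + 1 + q) - tri r = u3 at *
  refine le_of_pow_le_pow_left₀ (n := 1 + q) (by omega) (by positivity) ?_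
  refine (holder_nat 1 q _ _ _ (fun t => by positivity) (fun t => ?_)
    (fun t => ?_) (by omega) (fun t => le_of_eq ?_)).trans 
     ((mul_le_mul (pow_le_pow_left₀ ?_ d1 1) (pow_le_pow_left₀ ?_ d2 q) ?_ ?_).trans ?_)
  · positivity
  · positivity
  · generalize ‖∑ i ∈ I, F i t‖ = x 
    generalize ‖∑ i ∈ I', F i t‖ = y 
    calc _ = y ^ (2 * ((q+1) * u1)) * x ^ (2 * ((q+1) * tri (r+1))) := by ring
      _ = _ := by rw [i1, i2]; ring
  · positivity
  · positivity
  · positivity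
  · positivity
  · generalize NN p z H (tri (r + 1 + q)) F I = x at *
    generalize NN p z H (tri (r + 1 + q)) F I' = y at *
    calc _ = (M1 * M2 ^ q) * x ^ (u2 + q * tri r) * y ^ (tri q + q * u3) := by ring
      _ ≤ M ^ (q + 1) * x ^ (u2 + q * tri r) * y ^ (tri q + q * u3) := by gcongr
      _ = _ := by rw [← i1, ← i2]; ring

end VM

open Finset Polynomial

namespace VM

variable {p B k H : ℕ} [Fact p.Prime]

lemma basis_T_dvd (φ : Fin k → (ZMod (p ^ B))[X]) (hφ : InC φ) (η : ℤ)
    (τ : Fin k → Fin k → ZMod (p ^ B)) (c : Fin k → ZMod (p ^ B))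
      (T : Fin k → (ZMod (p ^ B))[X])
      (h : ∀ m, ∑ j, C (τ m j) * taylor (η : ZMod (p ^ B)) (φ j) =
        C (c m) + X ^ ((m : ℕ) + 1) + X ^ (k + 1) * T m) (m : Fin k) :
    C (p : ZMod (p ^ B)) ∣ T m := by
  rw [C_dvd_iff_dvd_coeff]
  intro i
  have h1 := congrArg (fun Q => coeff Q (i + (k + 1))) (h m)
  simp only [coeff_add, coeff_X_pow_mul, finsetSum_coeff, coeff_C_mul, coeff_C, coeff_X_pow] at h1
  rw [if_neg (by omega), if_neg (by have := m.2; omega), zero_add, zero_add] at h1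
  rw [← h1]
  refine Finset.dvd_sum fun j _ => Dvd.dvd.mul_left ?_ _
  obtain ⟨G, hG⟩ := hφ j
  rw [hG, map_add, taylor_mul, taylor_C, coeff_add, coeff_C_mul]
  rw [coeff_eq_zero_of_natDegree_lt, zero_add]
  · exact dvd_mul_right _ _
  · rw [natDegree_taylor]
    refine (natDegree_X_pow_le _).trans_lt ?_
    have := j.2; omega

lemma bil_L {l a a' b : ℕ} (hkp : k < p) (hB : k * H ≤ B) (hl : 1 ≤ l) (hlk : l + 1 ≤ k)
    (hab : l * a' ≤ (k - l + 1) * b) (ha : 1 ≤ a) (haa : a ≤ a') (haH : a' ≤ H)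
    {D M : ℝ} (hD : 0 ≤ D) (hM : 0 ≤ M) (hdec : Dec p B l (a' - a) D)
    (hbil : Bil p B k H l a' b M) : Bil p B k H l a b (D * M) := by
  classical
  intro φ hφ z w I I' ξ η hI hI' hξ
  have hp : p.Prime := Fact.out
  set P : ZMod (p ^ B) := (p : ZMod (p ^ B)) with hP
  set F := Fam (P ^ (B - k * H)) φ z w with hF
  obtain ⟨τ, c, T, hb⟩ := exists_basis φ η (isUnit_jet_InC hkp η φ hφ)
  have hla : l * a' ≤ k * H := Nat.mul_le_mul (by omega) haH
  let ι : Fin l → Fin k := fun m => ⟨k - l + m, by have := m.2; omega⟩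
  set φ' : Fin l → (ZMod (p ^ B))[X] :=
    fun m => ∑ j, C (τ (ι m) j) * taylor (η : ZMod (p ^ B)) (φ j) with hφ'
  have hnd : IsUnit (jet φ' (ξ - η)).det := by
    refine isUnit_jet (k := k) (by omega) hkp (ξ - η) (Or.inl ?_) φ' fun m => ?_
    · rw [Ne, ZMod.intCast_zmod_eq_zero_iff_dvd]; exact hξ
    · obtain ⟨G, hG⟩ := basis_T_dvd φ hφ η τ c T hb (ι m)
      refine ⟨c (ι m), X ^ (k + 1) * G, ?_⟩
      rw [hφ']; simp only
      rw [hb, hG]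
      ring
  set σ : (Fin l → ZMod (p ^ B)) → (Fin k → ZMod (p ^ B)) :=
    fun v j => ∑ m : Fin l, (P ^ (k * H - l * a') * v m) * τ (ι m) j with hσ
  have hpw : P ^ (B - k * H) * P ^ (k * H - l * a') = P ^ (B - l * a') := by
    rw [← pow_add]; congr 1; omega
  have hev : ∀ v x, P ^ (B - k * H) * ev φ (σ v) x = P ^ (B - l * a') * ev φ' v (x - η) := by
    intro v x
    rw [← hpw, mul_assoc]; congr 1
    simp only [ev, hσ, hφ', eval_finsetSum, eval_mul, eval_C, taylor_eval, Finset.mul_sum,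
      Finset.sum_mul]
    rw [Finset.sum_comm]
    refine Finset.sum_congr rfl fun m _ => Finset.sum_congr rfl fun j _ => ?_
    push_cast
    rw [sub_add_cancel]; ring
  -- invariance
  have hinv : ∀ t v, ‖∑ i ∈ I', F i (t + σ v)‖ = ‖∑ i ∈ I', F i t‖ := by
    intro t v
    have : ∑ i ∈ I', F i (t + σ v) = (ZMod.stdAddChar (P ^ (B - l * a') * ∑ m, v m * c (ι m)) : ℂ)
        * ∑ i ∈ I', F i t := by
      rw [Finset.mul_sum]
      refine Finset.sum_congr rfl fun i hi => ?_
      rw [hF, Fam_add, hev, mul_comm]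
      congr 2
      obtain ⟨y, hy⟩ := hI' i hi
      rw [hy]
      simp only [ev, Finset.mul_sum]
      refine Finset.sum_congr rfl fun m _ => ?_
      have e := congrArg (Polynomial.eval (((p:ℤ) ^ b * y : ℤ) : ZMod (p ^ B))) (hb (ι m))
      rw [hφ']; simp only
      rw [e]
      simp only [eval_add, eval_mul, eval_pow, eval_X, eval_C]
      push_cast
      rw [← hP]
      have z1 : P ^ (B - l * a') * (P ^ b) ^ (k - l + 1) = 0 := by
        rw [← pow_mul, ← pow_add, hP]
        apply ppow_zero
        rw [mul_comm b]; omega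
      have e1 : (P ^ b * (y : ZMod (p ^ B))) ^ ((ι m : ℕ) + 1) = (P ^ b) ^ (k - l + 1) *
          ((P ^ b) ^ (m:ℕ) * (y : ZMod (p ^ B)) ^ ((ι m : ℕ) + 1)) := by
        rw [mul_pow, ← mul_assoc, ← pow_add]
        congr 2; simp only [ι]; omega
      have e2 : (P ^ b * (y : ZMod (p ^ B))) ^ (k + 1) = (P ^ b) ^ (k - l + 1) *
          ((P ^ b) ^ l * (y : ZMod (p ^ B)) ^ (k + 1)) := by
        rw [mul_pow, ← mul_assoc, ← pow_add]
        congr 2; omega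
      rw [e1, e2]
      linear_combination (v m * (P ^ b) ^ (m:ℕ) * (y : ZMod (p ^ B)) ^ ((ι m : ℕ) + 1) +
        v m * (P ^ b) ^ l * (y : ZMod (p ^ B)) ^ (k + 1) * eval (P ^ b * (y : ZMod (p ^ B))) (T (ι m))) * z1
    rw [this, norm_mul, norm_char, one_mul]
  have hshift : ∀ t v i, F i (t + σ v) = Fam (P ^ (B - l * a')) φ' (fun i => z i - η)
      (fun i => F i t) i v := by
    intro t v i
    rw [hF, Fam_add, hev]; rfl
  have hblk : blocks p (fun i => z i - η) a' I = blocks p z a' I := by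
    apply blocks_congr
    intro i _ j _
    rw [sub_sub_sub_cancel_right]
  have main := shift_dec (V := Fin l → ZMod (p ^ B)) σ F
    (fun t => ‖∑ i ∈ I', F i t‖ ^ (2 * (tri k - tri l)))
    (fun _ => by positivity) (fun t v => by simp only [hinv]) (tri l) (tri_pos hl) I
    (blocks p z a' I) D hD (by
      intro t
      have h1 := dec_class hl φ' (ξ - η) hnd ha haa (by omega) hD hdec I (fun i => z i - η)
        (fun i => F i t) (by intro i hi; rw [sub_sub_sub_cancel_right]; exact hI i hi)
      rw [NN, hblk] at h1
      simp_rw [nn, ← hP, ← hshift] at h1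
      exact h1)
  refine main.trans ?_
  have n2 := NN_nonneg (p := p) (z := z) H (tri k) F I'
  have hs0 : tri l ≠ 0 := by have := tri_pos hl; omega
  have hs0' : (tri l : ℝ) ≠ 0 := by exact_mod_cast hs0
  have step : ∀ J ∈ blocks p z a' I, (∑ t, ‖∑ i ∈ I', F i t‖ ^ (2 * (tri k - tri l)) *
      ‖∑ i ∈ J, F i t‖ ^ (2 * tri l)) ^ ((1:ℝ) / tri l) ≤
      (M * NN p z H (tri k) F I' ^ (tri k - tri l)) ^ ((1:ℝ) / tri l) * NN p z H (tri k) F J := by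
    intro J hJ
    have n1 := NN_nonneg (p := p) (z := z) H (tri k) F J
    obtain ⟨i0, hi0⟩ := blocks_nonempty hJ
    have hd := hbil φ hφ z w J I' (z i0) η (fun i hi => blocks_dvd hJ hi hi0) hI' (by
      intro hdd
      apply hξ
      have h3 : (p:ℤ) ∣ z i0 - ξ := (dvd_pow_self _ (by omega)).trans (hI i0 (blocks_subset hJ hi0))
      have := dvd_sub hdd h3
      simpa using this)
    rw [← hP, ← hF] at hd
    have e : NN p z H (tri k) F J = (NN p z H (tri k) F J ^ tri l) ^ ((1:ℝ) / tri l) := by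
      rw [one_div, Real.pow_rpow_inv_natCast n1 hs0]
    rw [e, ← Real.mul_rpow (by positivity) (by positivity)]
    refine Real.rpow_le_rpow (Finset.sum_nonneg fun _ _ => by positivity) (hd.trans (le_of_eq ?_)) (by positivity)
    ring
  have n3 : 0 ≤ ∑ J ∈ blocks p z a' I, (∑ t, ‖∑ i ∈ I', F i t‖ ^ (2 * (tri k - tri l)) *
      ‖∑ i ∈ J, F i t‖ ^ (2 * tri l)) ^ ((1:ℝ) / tri l) :=
    Finset.sum_nonneg fun _ _ => Real.rpow_nonneg (Finset.sum_nonneg fun _ _ => by positivity) _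
  have h4 := pow_le_pow_left₀ n3 (Finset.sum_le_sum step) (tri l)
  rw [← Finset.mul_sum, ← NN_refine haH, mul_pow, rpow_inv_pow (by positivity) (tri_pos hl)] at h4
  calc _ ≤ D * (M * NN p z H (tri k) F I' ^ (tri k - tri l) * NN p z H (tri k) F I ^ tri l) := by
        gcongr
    _ = _ := by ring

end VM

open Finset Polynomial

namespace VM

/-- exponents gained in the iteration -/
noncomputable def eta (k : ℕ) (e δ : ℝ) : ℕ → ℕ → ℝ
  | 0, l => if l = 0 then e else 0
  | n + 1, l => if l = 0 then e else
      eta k e δ n (k - l) / l + ((k - l : ℕ) : ℝ) / ((k - l + 1 : ℕ) : ℝ) * eta k e δ n (l - 1) - δ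

lemma eta_zero (k : ℕ) (e δ : ℝ) (n : ℕ) : eta k e δ n 0 = e := by
  cases n <;> simp [eta]

lemma eta_succ (k : ℕ) (e δ : ℝ) (n l : ℕ) (hl : 1 ≤ l) : eta k e δ (n + 1) l =
    eta k e δ n (k - l) / l + ((k - l : ℕ) : ℝ) / ((k - l + 1 : ℕ) : ℝ) * eta k e δ n (l - 1) - δ := by
  rw [eta, if_neg (by omega)]

lemma eta_sum (K : ℕ) (e δ : ℝ) (n : ℕ) :
    ∑ i ∈ range (K + 1), eta (K + 2) e δ (n + 1) (i + 1) =
      ∑ i ∈ range (K + 1), eta (K + 2) e δ n (i + 1) + ((K + 1 : ℕ) : ℝ) / ((K + 2 : ℕ) : ℝ) * e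
        - (K + 1) * δ := by
  set g := eta (K + 2) e δ n with hg
  have h1 : ∀ i ∈ range (K + 1), eta (K + 2) e δ (n + 1) (i + 1) =
      g (K + 1 - i) / ((i + 1 : ℕ) : ℝ) + ((K + 1 - i : ℕ) : ℝ) / ((K + 2 - i : ℕ) : ℝ) * g i - δ := by
    intro i hi
    rw [Finset.mem_range] at hi
    rw [eta_succ _ _ _ _ _ (by omega)]
    have e1 : K + 2 - (i + 1) = K + 1 - i := by omega
    have e2 : K + 1 - i + 1 = K + 2 - i := by omega
    rw [e1, e2, Nat.add_sub_cancel]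
  rw [Finset.sum_congr rfl h1, Finset.sum_sub_distrib, Finset.sum_add_distrib, Finset.sum_const,
    Finset.card_range, nsmul_eq_mul]
  have h2 : ∑ i ∈ range (K + 1), g (K + 1 - i) / ((i + 1 : ℕ) : ℝ) =
      ∑ i ∈ range (K + 1), g (i + 1) / ((K + 1 - i : ℕ) : ℝ) := by
    rw [← Finset.sum_range_reflect]
    refine Finset.sum_congr rfl fun i hi => ?_
    rw [Finset.mem_range] at hi
    congr 2
    · omega
    · omega
  have h3 : ∑ i ∈ range (K + 1), ((K + 1 - i : ℕ) : ℝ) / ((K + 2 - i : ℕ) : ℝ) * g i =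
      ∑ i ∈ range (K + 1), ((K - i : ℕ) : ℝ) / ((K + 1 - i : ℕ) : ℝ) * g (i + 1)
       + ((K + 1 : ℕ) : ℝ) / ((K + 2 : ℕ) : ℝ) * e := by
    rw [Finset.sum_range_succ' (fun i => ((K + 1 - i : ℕ) : ℝ) / ((K + 2 - i : ℕ) : ℝ) * g i)]
    conv_rhs => rw [Finset.sum_range_succ]
    simp only [Nat.sub_self, Nat.cast_zero, zero_div, zero_mul, add_zero, Nat.sub_zero]
    rw [hg, eta_zero]
    congr 1
    refine Finset.sum_congr rfl fun i hi => ?_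
    have e1 : K + 1 - (i + 1) = K - i := by omega
    have e2 : K + 2 - (i + 1) = K + 1 - i := by omega
    rw [e1, e2]
  rw [h2, h3, ← add_assoc, ← Finset.sum_add_distrib]
  have h4 : ∀ i ∈ range (K + 1), g (i + 1) / ((K + 1 - i : ℕ) : ℝ) + ((K - i : ℕ) : ℝ) / ((K + 1 - i : ℕ) : ℝ) * g (i + 1)
      = g (i + 1) := by
    intro i hi
    rw [Finset.mem_range] at hi
    have e2 : K + 1 - i = K - i + 1 := by omega
    rw [e2]
    have : ((K - i : ℕ) : ℝ) + 1 ≠ 0 := by positivity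
    push_cast
    field_simp
    ring
  rw [Finset.sum_congr rfl h4]
  push_cast; ring

lemma eta_large (k : ℕ) (hk : 2 ≤ k) (e : ℝ) (he : 0 < e) (R : ℝ) :
    ∃ n l, 1 ≤ l ∧ l < k ∧ R ≤ eta k e (e / (2 * k)) n l := by
  obtain ⟨K, rfl⟩ : ∃ K, k = K + 2 := ⟨k - 2, by omega⟩
  set δ := e / (2 * ((K + 2 : ℕ) : ℝ)) with hδ
  have hs : ∀ n : ℕ, ∑ i ∈ range (K + 1), eta (K + 2) e δ n (i + 1) = n * ((K + 1) * δ) := by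
    intro n
    induction n with
    | zero => simp [eta]
    | succ n ih =>
      rw [eta_sum, ih, hδ]; push_cast; field_simp; ring
  have hδ0 : 0 < δ := by positivity
  obtain ⟨n, hn⟩ := exists_nat_ge (R / δ)
  refine ⟨n, ?_⟩
  by_contra hcon
  push Not at hcon
  have : ∑ i ∈ range (K + 1), eta (K + 2) e δ n (i + 1) < ∑ i ∈ range (K + 1), R := by
    refine Finset.sum_lt_sum_of_nonempty ⟨0, by simp⟩ fun i hi => ?_
    rw [Finset.mem_range] at hi
    exact hcon (i + 1) (by omega) (by omega)
  rw [hs, Finset.sum_const, Finset.card_range, nsmul_eq_mul] at this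
  rw [div_le_iff₀ hδ0] at hn
  push_cast at this
  have h5 : ((K:ℝ) + 1) * (n * δ) < ((K:ℝ) + 1) * R := by linarith
  have := lt_of_mul_lt_mul_left h5 (by positivity)
  linarith

variable {p B k H : ℕ} [Fact p.Prime]

lemma bil_iter (hk : 2 ≤ k) (hkp : k < p) (hB : k * H ≤ B) {C C' Λ ε e : ℝ} (hC : 1 ≤ C) (hC' : 1 ≤ C')
    (hε : 0 ≤ ε) (he : 0 ≤ e) (heΛ : e ≤ Λ)
    (hlow : ∀ l, 1 ≤ l → l < k → ∀ h, l * h ≤ B → Dec p B l h (C' * (p:ℝ) ^ (ε * h)))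
    (hdk : ∀ h, k * h ≤ B → Dec p B k h (C * (p:ℝ) ^ (Λ * h))) :
    ∀ (n b l a : ℕ), 1 ≤ l → l < k → 1 ≤ b → (k.factorial ^ 2) ^ n ∣ b → k ^ (n + 1) * b ≤ H →
      l * a = (k - l + 1) * b →
      Bil p B k H l a b (C' ^ n * C * (p:ℝ) ^ (Λ * H - eta k e (ε * k ^ 2) n l * b)) := by
  have hp : p.Prime := Fact.out
  have hp1 : (1:ℝ) ≤ p := by exact_mod_cast hp.one_lt.le
  have hp0 : (0:ℝ) < p := by linarith
  intro n
  induction n with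
  | zero =>
    intro b l a hl hlk hb _ hH hla
    rw [zero_add, pow_one] at hH
    have ha : 1 ≤ a := by
      rcases Nat.eq_zero_or_pos a with h | h
      · subst h; rw [mul_zero] at hla
        have : 0 < (k - l + 1) * b := by positivity
        omega
      · exact h
    have hakb : a ≤ k * b := by
      calc a ≤ l * a := Nat.le_mul_of_pos_left _ hl
        _ = (k - l + 1) * b := hla
        _ ≤ k * b := Nat.mul_le_mul_right _ (by omega)
    have haH : a ≤ H := hakb.trans hH
    have hbH : b ≤ H := (Nat.le_mul_of_pos_left b (by omega)).trans hH
    have hE : ∀ c, c ≤ H → Dec p B k (H - c) (C * (p:ℝ) ^ (Λ * H)) := by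
      intro c hc
      refine dec_mono ?_ (hdk (H - c) ((Nat.mul_le_mul_left k (Nat.sub_le H c)).trans hB))
      refine mul_le_mul_of_nonneg_left (Real.rpow_le_rpow_of_exponent_le hp1 ?_) (by positivity)
      refine mul_le_mul_of_nonneg_left ?_ (he.trans heΛ)
      exact_mod_cast Nat.sub_le H c
    have := bil_E (l := l) (by omega) hkp hB hlk.le ha haH hb hbH (by positivity) (hE a haH) (hE b hbH)
    convert this using 2
    · simp
    · have : l ≠ 0 := by omega
      simp [eta, this]
  | succ n ih =>
    intro b l a hl hlk hb hdvd hH hla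
    -- integrality
    obtain ⟨c, hc⟩ := hdvd
    have hdl : ∀ m, 1 ≤ m → m ≤ k → m ∣ k.factorial := fun m h1 h2 => Nat.dvd_factorial h1 h2
    obtain ⟨f, hf⟩ := hdl l hl hlk.le
    have hkf : k.factorial ∣ b := by
      rw [hc, pow_succ, pow_two]
      exact ⟨(k.factorial * k.factorial) ^ n * k.factorial * c, by ring⟩
    have ha_eq : a = (k - l + 1) * f * k.factorial * (k.factorial ^ 2) ^ n * c := by
      refine Nat.eq_of_mul_eq_mul_left (show 0 < l by omega) ?_
      rw [hla, hc, pow_succ]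
      calc _ = (k - l + 1) * ((k.factorial ^ 2) ^ n * (k.factorial * k.factorial) * c) := by ring
        _ = (k - l + 1) * ((k.factorial ^ 2) ^ n * ((l * f) * k.factorial) * c) := by rw [← hf]
        _ = _ := by ring
    have hdvda : (k.factorial ^ 2) ^ n ∣ a := by
      rw [ha_eq]; exact ⟨(k - l + 1) * f * k.factorial * c, by ring⟩
    have hkfa : k.factorial ∣ a := by
      rw [ha_eq]; exact ⟨(k - l + 1) * f * (k.factorial ^ 2) ^ n * c, by ring⟩
    have hdvdb : (k.factorial ^ 2) ^ n ∣ b := by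
      rw [hc, pow_succ]; exact ⟨k.factorial ^ 2 * c, by ring⟩
    obtain ⟨a2, ha2⟩ : ∃ a2, (k - l) * a2 = (l + 1) * a := by
      obtain ⟨u, hu⟩ := ((hdl (k - l) (by omega) (by omega)).trans hkfa).mul_left (l + 1)
      exact ⟨u, hu.symm⟩
    have ha : 1 ≤ a := by
      rcases Nat.eq_zero_or_pos a with h | h
      · rw [h, mul_zero] at hla
        have : 0 < (k - l + 1) * b := by positivity
        omega
      · exact h
    have hba : b ≤ a2 := by
      by_contra hcon
      push Not at hcon
      have e1 : (k - l) * l * a2 = (l + 1) * ((k - l + 1) * b) := by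
        rw [← hla]; calc _ = l * ((k - l) * a2) := by ring
          _ = _ := by rw [ha2]; ring
      have h0 : 0 < (k - l) * l := by
        have : 0 < k - l := by omega
        positivity
      have e2 : (k - l) * l * a2 < (k - l) * l * b := Nat.mul_lt_mul_of_pos_left hcon h0
      have e3 : (k - l) * l * b ≤ (l + 1) * ((k - l + 1) * b) := by nlinarith
      omega
    have hakb : a ≤ k * b := by
      calc a ≤ l * a := Nat.le_mul_of_pos_left _ hl
        _ = (k - l + 1) * b := hla
        _ ≤ k * b := Nat.mul_le_mul_right _ (by omega)
    have ha2kb : a2 ≤ k ^ 2 * b := by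
      calc a2 ≤ (k - l) * a2 := Nat.le_mul_of_pos_left _ (by omega)
        _ = (l + 1) * a := ha2
        _ ≤ k * (k * b) := Nat.mul_le_mul (by omega) hakb
        _ = _ := by ring
    have hkpow : k ^ 2 * b ≤ H := by
      refine le_trans (Nat.mul_le_mul_right _ (Nat.pow_le_pow_right (by omega) (by omega))) hH
    have hkb : k * b ≤ H := le_trans (Nat.mul_le_mul_right _ (by nlinarith)) hkpow
    have hbH : b ≤ H := (Nat.le_mul_of_pos_left b (by omega)).trans hkb
    have hkna : k ^ (n + 1) * a ≤ H := by
      calc k ^ (n + 1) * a ≤ k ^ (n + 1) * (k * b) := Nat.mul_le_mul_left _ hakb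
        _ = k ^ (n + 1 + 1) * b := by ring
        _ ≤ H := hH
    have hknb : k ^ (n + 1) * b ≤ H := by
      refine le_trans (Nat.mul_le_mul_right _ (Nat.pow_le_pow_right (by omega) (by omega))) hH
    set δ := ε * (k:ℝ) ^ 2 with hδ
    have hCC : 1 ≤ C' ^ n := one_le_pow₀ hC'
    -- lower degree decoupling
    have hlow2 : ∀ m, 1 ≤ m → m < k → ∀ h g, h ≤ k ^ 2 * b → Dec p B m (h - g) (C' * (p:ℝ) ^ (δ * b)) := by
      intro m h1 h2 h g hh
      refine dec_mono ?_ (hlow m h1 h2 (h - g) ?_)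
      · refine mul_le_mul_of_nonneg_left (Real.rpow_le_rpow_of_exponent_le hp1 ?_) (by positivity)
        rw [hδ, mul_assoc]
        refine mul_le_mul_of_nonneg_left ?_ hε
        have : h - g ≤ k ^ 2 * b := (Nat.sub_le _ _).trans hh
        exact_mod_cast this
      · exact le_trans (Nat.mul_le_mul h2.le ((Nat.sub_le _ _).trans (hh.trans hkpow))) hB
    have B1 : Bil p B k H (k - l) b a ((C' * (p:ℝ) ^ (δ * b)) *
        (C' ^ n * C * (p:ℝ) ^ (Λ * H - eta k e δ n (k - l) * a))) := by
      refine bil_L (a' := a2) hkp hB (by omega) (by omega) ?_ hb hba (ha2kb.trans hkpow)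
        (by positivity) (by positivity) (hlow2 _ (by omega) (by omega) _ _ ha2kb) ?_
      · rw [ha2]; apply le_of_eq; congr 1; omega
      · refine ih a (k - l) a2 (by omega) (by omega) ha hdvda hkna ?_
        rw [ha2]; congr 1; omega
    have B2 : Bil p B k H (l - 1) a b ((C' * (p:ℝ) ^ (δ * b)) *
        (C' ^ n * C * (p:ℝ) ^ (Λ * H - eta k e δ n (l - 1) * b))) := by
      rcases Nat.eq_or_lt_of_le hl with h1 | h1
      · subst h1
        rw [Nat.sub_self, eta_zero]
        refine bil_zero (by omega) hkp hB hb hbH (by positivity) 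
          (dec_mono ?_ (hdk (H - b) ((Nat.mul_le_mul_left k (Nat.sub_le H b)).trans hB)))
        have x1 : C * (p:ℝ) ^ (Λ * (H - b : ℕ)) ≤ C * (p:ℝ) ^ (Λ * H - e * b) := by
          refine mul_le_mul_of_nonneg_left (Real.rpow_le_rpow_of_exponent_le hp1 ?_) (by positivity)
          push_cast [hbH]
          nlinarith [(Nat.cast_nonneg b : (0:ℝ) ≤ b)]
        refine x1.trans ?_
        have x2 : 1 ≤ (p:ℝ) ^ (δ * b) := Real.one_le_rpow hp1 (by positivity)
        have x3 : 1 ≤ C' * (p:ℝ) ^ (δ * b) * C' ^ n := 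
          one_le_mul_of_one_le_of_one_le (one_le_mul_of_one_le_of_one_le hC' x2) hCC
        calc C * (p:ℝ) ^ (Λ * H - e * b) ≤ (C' * (p:ℝ) ^ (δ * b) * C' ^ n) * (C * (p:ℝ) ^ (Λ * H - e * b)) :=
              le_mul_of_one_le_left (by positivity) x3
          _ = _ := by ring
      · obtain ⟨a3, ha3⟩ : ∃ a3, (l - 1) * a3 = (k - l + 2) * b := by
          obtain ⟨u, hu⟩ := ((hdl (l - 1) (by omega) (by omega)).trans hkf).mul_left (k - l + 2)
          exact ⟨u, hu.symm⟩
        have ha3k : a3 ≤ k * b := by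
          calc a3 ≤ (l - 1) * a3 := Nat.le_mul_of_pos_left _ (by omega)
            _ = (k - l + 2) * b := ha3
            _ ≤ k * b := Nat.mul_le_mul_right _ (by omega)
        have haa3 : a ≤ a3 := by
          have e1 : (l - 1) * a ≤ (l - 1) * a3 := by
            calc (l - 1) * a ≤ l * a := Nat.mul_le_mul_right _ (by omega)
              _ = (k - l + 1) * b := hla
              _ ≤ (k - l + 2) * b := Nat.mul_le_mul_right _ (by omega)
              _ = _ := ha3.symm
          exact Nat.le_of_mul_le_mul_left e1 (by omega)
        refine bil_L (a' := a3) hkp hB (by omega) (by omega) ?_ ha haa3 (ha3k.trans hkb)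
          (by positivity) (by positivity) (hlow2 _ (by omega) (by omega) _ _ (ha3k.trans ?_)) ?_
        · rw [ha3]; apply le_of_eq; congr 1; omega
        · exact Nat.mul_le_mul_right _ (by nlinarith)
        · refine ih b (l - 1) a3 (by omega) (by omega) hb hdvdb hknb ?_
          rw [ha3]; congr 1; omega
    refine bil_Ho hl (by omega) (by positivity) (by positivity) (by positivity) B1 B2 (le_of_eq ?_)
    rw [eta_succ _ _ _ _ _ hl]
    generalize eta k e δ n (k - l) = x
    generalize eta k e δ n (l - 1) = y
    obtain ⟨q, rfl⟩ : ∃ q, k = l + q := ⟨k - l, by omega⟩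
    simp only [Nat.add_sub_cancel_left] at *
    have haR : (a:ℝ) = (q + 1) * b / l := by
      rw [eq_div_iff (by positivity)]
      have : ((l * a : ℕ):ℝ) = (((q + 1) * b : ℕ) : ℝ) := by rw [hla]
      push_cast at this; linarith
    have e1 : C' * (p:ℝ) ^ (δ * b) * (C' ^ n * C * (p:ℝ) ^ (Λ * H - x * a)) =
        (C' ^ (n + 1) * C) * (p:ℝ) ^ (δ * b + (Λ * H - x * a)) := by
      rw [Real.rpow_add hp0]; ring
    have e2 : C' * (p:ℝ) ^ (δ * b) * (C' ^ n * C * (p:ℝ) ^ (Λ * H - y * b)) =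
        (C' ^ (n + 1) * C) * (p:ℝ) ^ (δ * b + (Λ * H - y * b)) := by
      rw [Real.rpow_add hp0]; ring
    rw [e1, e2, mul_pow, mul_pow _ _ (q + 1), pow_succ _ q]
    have e3 : (p:ℝ) ^ (δ * b + (Λ * H - x * a)) * ((p:ℝ) ^ (δ * b + (Λ * H - y * b))) ^ q =
        ((p:ℝ) ^ (Λ * H - (x / l + (q:ℝ) / ((q + 1 : ℕ) : ℝ) * y - δ) * b)) ^ (q + 1) := by
      rw [← Real.rpow_natCast, ← Real.rpow_natCast, ← Real.rpow_mul hp0.le, ← Real.rpow_mul hp0.le,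
        ← Real.rpow_add hp0]
      congr 1
      rw [haR]; push_cast; field_simp; ring
    rw [← e3]; ring

end VM

open Finset Polynomial

namespace VM

lemma sum_pow_le' {K : Type*} (𝓑 : Finset K) (x : K → ℝ) (hx : ∀ J ∈ 𝓑, 0 ≤ x J) (m : ℕ) (hm : 1 ≤ m) :
    ∑ J ∈ 𝓑, x J ^ m ≤ (∑ J ∈ 𝓑, x J) ^ m := by
  obtain ⟨n, rfl⟩ : ∃ n, m = n + 1 := ⟨m - 1, by omega⟩
  rw [pow_succ, Finset.mul_sum]
  refine Finset.sum_le_sum fun J hJ => ?_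
  rw [pow_succ]
  have := Finset.single_le_sum hx hJ
  have h0 := hx J hJ
  gcongr

lemma norm_split {K : Type*} (𝓑 : Finset K) (x : K → ℂ) (m : ℕ) (hm : 1 ≤ m) (P : ℝ) (hP : 1 ≤ P)
    (hc : (𝓑.card : ℝ) ≤ P) : ‖∑ J ∈ 𝓑, x J‖ ^ m ≤ P ^ m * ∑ J ∈ 𝓑, ‖x J‖ ^ m := by
  obtain ⟨n, rfl⟩ : ∃ n, m = n + 1 := ⟨m - 1, by omega⟩
  have h1 := pow_sum_le_card_mul_sum_pow (s := 𝓑) (f := fun J => ‖x J‖) (fun _ _ => norm_nonneg _) n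
  have h2 : ‖∑ J ∈ 𝓑, x J‖ ^ (n + 1) ≤ (∑ J ∈ 𝓑, ‖x J‖) ^ (n + 1) :=
    pow_le_pow_left₀ (norm_nonneg _) (norm_sum_le _ _) _
  refine h2.trans (h1.trans ?_)
  have h3 : (𝓑.card : ℝ) ^ n ≤ P ^ (n + 1) := by
    calc (𝓑.card : ℝ) ^ n ≤ P ^ n := by gcongr
      _ ≤ P ^ (n + 1) := pow_le_pow_right₀ hP (by omega)
  have h4 : 0 ≤ ∑ J ∈ 𝓑, ‖x J‖ ^ (n + 1) := Finset.sum_nonneg fun _ _ => by positivity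
  gcongr

lemma bl_pointwise {K : Type*} [DecidableEq K] (𝓑 : Finset K) (x : K → ℝ) (hx : ∀ J ∈ 𝓑, 0 ≤ x J) (P : ℝ) (hP : 1 ≤ P)
    (hc : (𝓑.card : ℝ) ≤ P) (s1 s2 : ℕ) (hs : 1 ≤ s1 + s2) :
    (∑ J ∈ 𝓑, x J) ^ (2 * (s1 + s2)) ≤ 4 ^ (s1 + s2) * ∑ J ∈ 𝓑, x J ^ (2 * (s1 + s2)) +
      P ^ (4 * (s1 + s2)) * ∑ I ∈ 𝓑, ∑ J ∈ 𝓑.erase I, x J ^ (2 * s2) * x I ^ (2 * s1) := by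
  have hP0 : 0 ≤ P := by linarith
  have n1 : 0 ≤ ∑ J ∈ 𝓑, x J ^ (2 * (s1 + s2)) := Finset.sum_nonneg fun J hJ => by
    have := hx J hJ; positivity
  have n3 : ∀ I ∈ 𝓑, 0 ≤ ∑ J ∈ 𝓑.erase I, x J ^ (2 * s2) * x I ^ (2 * s1) := fun I hI =>
    Finset.sum_nonneg fun J hJ => by
      have := hx J (Finset.mem_of_mem_erase hJ)
      have := hx I hI
      positivity
  have n2 : 0 ≤ ∑ I ∈ 𝓑, ∑ J ∈ 𝓑.erase I, x J ^ (2 * s2) * x I ^ (2 * s1) :=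
    Finset.sum_nonneg n3
  rcases 𝓑.eq_empty_or_nonempty with h0 | h0
  · subst h0
    rw [Finset.sum_empty, zero_pow (by omega)]; simp
  obtain ⟨I, hI, hmax⟩ := Finset.exists_max_image 𝓑 x h0
  have xI := hx I hI
  have nS : 0 ≤ ∑ J ∈ 𝓑, x J := Finset.sum_nonneg hx
  by_cases hcase : ∃ J ∈ 𝓑.erase I, x I ≤ P * x J
  · obtain ⟨J, hJ, hIJ⟩ := hcase
    have xJ := hx J (Finset.mem_of_mem_erase hJ)
    have h1 : ∑ J ∈ 𝓑, x J ≤ P * x I := by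
      calc ∑ J ∈ 𝓑, x J ≤ ∑ J ∈ 𝓑, x I := Finset.sum_le_sum hmax
        _ = 𝓑.card * x I := by simp
        _ ≤ P * x I := by gcongr
    have h2 : x J ^ (2 * s2) * x I ^ (2 * s1) ≤ ∑ I ∈ 𝓑, ∑ J ∈ 𝓑.erase I, x J ^ (2 * s2) * x I ^ (2 * s1) := by
      refine le_trans ?_ (Finset.single_le_sum n3 hI)
      refine Finset.single_le_sum (f := fun J => x J ^ (2 * s2) * x I ^ (2 * s1)) (fun J hJ => ?_) hJ
      have := hx J (Finset.mem_of_mem_erase hJ)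
      positivity
    calc (∑ J ∈ 𝓑, x J) ^ (2 * (s1 + s2)) ≤ (P * x I) ^ (2 * (s1 + s2)) := by gcongr
      _ = P ^ (2 * (s1 + s2)) * (x I ^ (2 * s2) * x I ^ (2 * s1)) := by ring
      _ ≤ P ^ (2 * (s1 + s2)) * ((P * x J) ^ (2 * s2) * x I ^ (2 * s1)) := by gcongr
      _ = P ^ (2 * (s1 + s2) + 2 * s2) * (x J ^ (2 * s2) * x I ^ (2 * s1)) := by ring
      _ ≤ P ^ (4 * (s1 + s2)) * ∑ I ∈ 𝓑, ∑ J ∈ 𝓑.erase I, x J ^ (2 * s2) * x I ^ (2 * s1) := by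
        have := pow_le_pow_right₀ hP (show 2 * (s1 + s2) + 2 * s2 ≤ 4 * (s1 + s2) by omega)
        gcongr
      _ ≤ _ := by
        have : 0 ≤ (4:ℝ) ^ (s1 + s2) * ∑ J ∈ 𝓑, x J ^ (2 * (s1 + s2)) := by positivity
        linarith
  · push Not at hcase
    have h1 : ∑ J ∈ 𝓑, x J ≤ 2 * x I := by
      rw [← Finset.add_sum_erase 𝓑 x hI]
      have h2 : P * ∑ J ∈ 𝓑.erase I, x J ≤ P * x I := by
        rw [Finset.mul_sum]
        calc ∑ J ∈ 𝓑.erase I, P * x J ≤ ∑ J ∈ 𝓑.erase I, x I :=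
              Finset.sum_le_sum fun J hJ => (hcase J hJ).le
          _ = (𝓑.erase I).card * x I := by simp
          _ ≤ 𝓑.card * x I := by
            gcongr; exact Finset.erase_subset _ _
          _ ≤ P * x I := by gcongr
      have := le_of_mul_le_mul_left h2 (by linarith)
      linarith
    calc (∑ J ∈ 𝓑, x J) ^ (2 * (s1 + s2)) ≤ (2 * x I) ^ (2 * (s1 + s2)) := by gcongr
      _ = 4 ^ (s1 + s2) * x I ^ (2 * (s1 + s2)) := by
        rw [mul_pow, pow_mul 2 2]; norm_num
      _ ≤ 4 ^ (s1 + s2) * ∑ J ∈ 𝓑, x J ^ (2 * (s1 + s2)) := by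
        gcongr
        exact Finset.single_le_sum (f := fun J => x J ^ (2 * (s1 + s2))) (fun J hJ => by
          have := hx J hJ; positivity) hI
      _ ≤ _ := by
        have : 0 ≤ P ^ (4 * (s1 + s2)) * ∑ I ∈ 𝓑, ∑ J ∈ 𝓑.erase I, x J ^ (2 * s2) * x I ^ (2 * s1) := by positivity
        linarith

variable {p B k H : ℕ} [Fact p.Prime]

lemma tri_lt {l k : ℕ} (h : l < k) : tri l < tri k := by
  have h1 := tri_two l
  have h2 := tri_two k
  have : l * (l + 1) < k * (k + 1) := by nlinarith
  omega

lemma bil_b1 {l b : ℕ} (hlk : l < k) (hb : 1 ≤ b) (hbH : b ≤ H) {M : ℝ} (hM : 0 ≤ M)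
    (h : Bil p B k H l 1 b M) :
    Bil p B k H l 1 1 (((p:ℝ) ^ b) ^ (2 * (tri k - tri l)) * M) := by
  intro φ hφ z w I I' ξ η hI hI' hξ
  have hp : p.Prime := Fact.out
  have hp1 : (1:ℝ) ≤ p := by exact_mod_cast hp.one_lt.le
  set F := Fam ((p : ZMod (p ^ B)) ^ (B - k * H)) φ z w with hF
  have n1 := NN_nonneg (p := p) (z := z) H (tri k) F I
  have hm : 1 ≤ tri k - tri l := by have := tri_lt hlk; omega
  set m := tri k - tri l with hmdef
  have hstep : ∀ J ∈ blocks p z b I', ∑ t, ‖∑ i ∈ J, F i t‖ ^ (2 * m) * ‖∑ i ∈ I, F i t‖ ^ (2 * tri l) ≤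
      M * NN p z H (tri k) F I ^ tri l * NN p z H (tri k) F J ^ m := by
    intro J hJ
    obtain ⟨i0, hi0⟩ := blocks_nonempty hJ
    refine h φ hφ z w I J ξ (z i0) hI (fun i hi => blocks_dvd hJ hi hi0) ?_
    intro hdd
    apply hξ
    have h3 : (p:ℤ) ∣ z i0 - η := by simpa using hI' i0 (blocks_subset hJ hi0)
    have := dvd_add hdd h3
    simpa using this
  have hpt : ∀ t, ‖∑ i ∈ I', F i t‖ ^ (2 * m) ≤ ((p:ℝ) ^ b) ^ (2 * m) *
      ∑ J ∈ blocks p z b I', ‖∑ i ∈ J, F i t‖ ^ (2 * m) := by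
    intro t
    rw [sum_blocks (p := p) (z := z) b I']
    refine norm_split _ _ _ (by omega) _ (one_le_pow₀ hp1) ?_
    exact_mod_cast card_blocks hp.pos b I'
  calc ∑ t, ‖∑ i ∈ I', F i t‖ ^ (2 * m) * ‖∑ i ∈ I, F i t‖ ^ (2 * tri l)
      ≤ ∑ t, (((p:ℝ) ^ b) ^ (2 * m) * ∑ J ∈ blocks p z b I', ‖∑ i ∈ J, F i t‖ ^ (2 * m)) *
          ‖∑ i ∈ I, F i t‖ ^ (2 * tri l) := by
        gcongr with t; exact hpt t
    _ = ((p:ℝ) ^ b) ^ (2 * m) * ∑ J ∈ blocks p z b I', ∑ t, ‖∑ i ∈ J, F i t‖ ^ (2 * m) *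
          ‖∑ i ∈ I, F i t‖ ^ (2 * tri l) := by
        rw [Finset.sum_comm, Finset.mul_sum]
        refine Finset.sum_congr rfl fun t _ => ?_
        rw [mul_assoc, Finset.sum_mul]
    _ ≤ ((p:ℝ) ^ b) ^ (2 * m) * ∑ J ∈ blocks p z b I', M * NN p z H (tri k) F I ^ tri l * NN p z H (tri k) F J ^ m := by
        gcongr with J hJ; exact hstep J hJ
    _ = ((p:ℝ) ^ b) ^ (2 * m) * (M * NN p z H (tri k) F I ^ tri l * ∑ J ∈ blocks p z b I', NN p z H (tri k) F J ^ m) := by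
        rw [← Finset.mul_sum]
    _ ≤ ((p:ℝ) ^ b) ^ (2 * m) * (M * NN p z H (tri k) F I ^ tri l * NN p z H (tri k) F I' ^ m) := by
        rw [NN_refine hbH (tri k) F I']
        gcongr
        exact sum_pow_le' _ _ (fun J _ => NN_nonneg _ _ _ _) _ hm
    _ = _ := by ring

lemma dec_step {l : ℕ} (hl : 1 ≤ l) (hlk : l < k) (hkp : k < p) (hH : 1 ≤ H) (hB : k * H ≤ B) {E M : ℝ} (hE : 0 ≤ E)
    (hM : 0 ≤ M) (hD : Dec p B k (H - 1) E) (hbil : Bil p B k H l 1 1 M) :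
    Dec p B k H (4 ^ tri k * E + (p:ℝ) ^ (4 * tri k + 2) * M) := by
  classical
  intro φ hφ z w S
  have hp : p.Prime := Fact.out
  have hp1 : (1:ℝ) ≤ p := by exact_mod_cast hp.one_lt.le
  set F := Fam ((p : ZMod (p ^ B)) ^ (B - k * H)) φ z w with hF
  have hlt := tri_lt hlk
  have hN : ∀ T, 0 ≤ NN p z H (tri k) F T := fun T => NN_nonneg H (tri k) F T
  set 𝓑 := blocks p z 1 S with h𝓑
  have hcard : (𝓑.card : ℝ) ≤ p := by
    have := card_blocks (z := z) hp.pos 1 S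
    rw [pow_one] at this
    exact_mod_cast this
  have hsum : ∑ J ∈ 𝓑, NN p z H (tri k) F J = NN p z H (tri k) F S := (NN_refine hH _ F S).symm
  have hle : ∀ J ∈ 𝓑, NN p z H (tri k) F J ≤ NN p z H (tri k) F S := fun J hJ => NN_block_le hH _ F hJ
  have hpt : ∀ t, ‖∑ i ∈ S, F i t‖ ^ (2 * tri k) ≤ 4 ^ tri k * ∑ J ∈ 𝓑, ‖∑ i ∈ J, F i t‖ ^ (2 * tri k) +
      (p:ℝ) ^ (4 * tri k) * ∑ I ∈ 𝓑, ∑ J ∈ 𝓑.erase I, ‖∑ i ∈ J, F i t‖ ^ (2 * (tri k - tri l)) *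
        ‖∑ i ∈ I, F i t‖ ^ (2 * tri l) := by
    intro t
    have := bl_pointwise 𝓑 (fun J => ‖∑ i ∈ J, F i t‖) (fun _ _ => norm_nonneg _) p hp1 hcard (tri l) (tri k - tri l) (by omega)
    rw [Nat.add_sub_cancel' hlt.le] at this
    refine le_trans ?_ this
    rw [sum_blocks (p := p) (z := z) 1 S]
    gcongr
    exact norm_sum_le _ _
  have hdiag : ∀ J ∈ 𝓑, ∑ t, ‖∑ i ∈ J, F i t‖ ^ (2 * tri k) ≤ E * NN p z H (tri k) F J ^ tri k := by
    intro J hJ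
    obtain ⟨i0, hi0⟩ := blocks_nonempty hJ
    exact dec_class (by omega) φ (z i0) (isUnit_jet_InC hkp _ φ hφ) le_rfl hH hB hE hD J z w
      (fun i hi => blocks_dvd hJ hi hi0)
  have hoff : ∀ I ∈ 𝓑, ∀ J ∈ 𝓑.erase I, ∑ t, ‖∑ i ∈ J, F i t‖ ^ (2 * (tri k - tri l)) *
        ‖∑ i ∈ I, F i t‖ ^ (2 * tri l) ≤ M * NN p z H (tri k) F S ^ tri k := by
    intro I hI J hJ
    obtain ⟨hne, hJ'⟩ := Finset.mem_erase.1 hJ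
    obtain ⟨i0, hi0⟩ := blocks_nonempty hI
    obtain ⟨j0, hj0⟩ := blocks_nonempty hJ'
    refine (hbil φ hφ z w I J (z i0) (z j0) (fun i hi => blocks_dvd hI hi hi0)
      (fun i hi => blocks_dvd hJ' hi hj0) ?_).trans ?_
    · intro hdd
      apply hne
      refine blocks_eq_of_mem hJ' hI (i := i0) ?_ hi0
      rw [blocks_eq_blk hJ' hj0]
      exact mem_blk.2 ⟨blocks_subset hI hi0, by rwa [pow_one]⟩
    · rw [← hF]
      have e1 := hle I hI
      have e2 := hle J hJ'
      have e3 := hN I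
      have e4 := hN J
      have e5 := hN S
      calc _ ≤ M * NN p z H (tri k) F S ^ tri l * NN p z H (tri k) F S ^ (tri k - tri l) := by gcongr
        _ = _ := by rw [mul_assoc, ← pow_add, Nat.add_sub_cancel' hlt.le]
  have hS := hN S
  calc ∑ t, ‖∑ i ∈ S, F i t‖ ^ (2 * tri k)
      ≤ ∑ t, (4 ^ tri k * ∑ J ∈ 𝓑, ‖∑ i ∈ J, F i t‖ ^ (2 * tri k) +
      (p:ℝ) ^ (4 * tri k) * ∑ I ∈ 𝓑, ∑ J ∈ 𝓑.erase I, ‖∑ i ∈ J, F i t‖ ^ (2 * (tri k - tri l)) *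
        ‖∑ i ∈ I, F i t‖ ^ (2 * tri l)) := Finset.sum_le_sum fun t _ => hpt t
    _ = 4 ^ tri k * ∑ J ∈ 𝓑, ∑ t, ‖∑ i ∈ J, F i t‖ ^ (2 * tri k) +
      (p:ℝ) ^ (4 * tri k) * ∑ I ∈ 𝓑, ∑ J ∈ 𝓑.erase I, ∑ t, ‖∑ i ∈ J, F i t‖ ^ (2 * (tri k - tri l)) *
        ‖∑ i ∈ I, F i t‖ ^ (2 * tri l) := by
        rw [Finset.sum_add_distrib, ← Finset.mul_sum, ← Finset.mul_sum]
        congr 2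
        · rw [Finset.sum_comm]
        · rw [Finset.sum_comm]
          refine Finset.sum_congr rfl fun I _ => ?_
          rw [Finset.sum_comm]
    _ ≤ 4 ^ tri k * ∑ J ∈ 𝓑, E * NN p z H (tri k) F J ^ tri k +
      (p:ℝ) ^ (4 * tri k) * ∑ I ∈ 𝓑, ∑ J ∈ 𝓑.erase I, M * NN p z H (tri k) F S ^ tri k := by
        gcongr with J hJ I hI J hJ
        · exact hdiag J hJ
        · exact hoff I hI J hJ
    _ ≤ 4 ^ tri k * (E * NN p z H (tri k) F S ^ tri k) +
      (p:ℝ) ^ (4 * tri k) * ((p:ℝ) ^ 2 * (M * NN p z H (tri k) F S ^ tri k)) := by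
        gcongr
        · rw [← Finset.mul_sum]
          gcongr
          rw [← hsum]
          exact sum_pow_le' _ _ (fun J _ => hN J) _ (tri_pos (by omega))
        · calc ∑ I ∈ 𝓑, ∑ J ∈ 𝓑.erase I, M * NN p z H (tri k) F S ^ tri k 
              ≤ ∑ I ∈ 𝓑, ∑ J ∈ 𝓑, M * NN p z H (tri k) F S ^ tri k := by
                refine Finset.sum_le_sum fun I _ => ?_
                exact Finset.sum_le_sum_of_subset_of_nonneg (Finset.erase_subset _ _) (fun _ _ _ => by positivity)
            _ = (𝓑.card:ℝ) ^ 2 * (M * NN p z H (tri k) F S ^ tri k) := by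
                simp only [Finset.sum_const, nsmul_eq_mul]; ring
            _ ≤ _ := by gcongr
    _ = _ := by ring

lemma dec_triv (hk : 1 ≤ k) (H : ℕ) : Dec p B k H (((p:ℝ) ^ H) ^ (2 * tri k)) := by
  intro φ hφ z w S
  have hp : p.Prime := Fact.out
  have hp1 : (1:ℝ) ≤ p := by exact_mod_cast hp.one_lt.le
  set F := Fam ((p : ZMod (p ^ B)) ^ (B - k * H)) φ z w with hF
  have hs := tri_pos hk
  have hpt : ∀ t, ‖∑ i ∈ S, F i t‖ ^ (2 * tri k) ≤ ((p:ℝ) ^ H) ^ (2 * tri k) *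
      ∑ J ∈ blocks p z H S, ‖∑ i ∈ J, F i t‖ ^ (2 * tri k) := by
    intro t
    rw [sum_blocks (p := p) (z := z) H S]
    refine norm_split _ _ _ (by omega) _ (one_le_pow₀ hp1) ?_
    exact_mod_cast card_blocks hp.pos H S
  refine (Finset.sum_le_sum fun t _ => hpt t).trans ?_
  rw [← Finset.mul_sum, Finset.sum_comm]
  gcongr
  refine le_trans (le_of_eq ?_) (sum_pow_le' _ _ (fun J _ => nn_nonneg _ F J) _ hs)
  refine Finset.sum_congr rfl fun J _ => ?_
  rw [nn, rpow_inv_pow (Finset.sum_nonneg fun _ _ => by positivity) hs]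

lemma dec_zero (hk : 1 ≤ k) : Dec p B k 0 1 := by
  have := dec_triv (p := p) (B := B) hk 0
  simpa using this

end VM

open Finset Polynomial

namespace VM

variable {p k : ℕ} [Fact p.Prime]

lemma bil_gain (hk : 2 ≤ k) (hkp : k < p) {C C' Λ ε e : ℝ} (hC : 1 ≤ C) (hC' : 1 ≤ C')
    (hε : 0 ≤ ε) (he : 0 ≤ e) (heΛ : e ≤ Λ)
    (hlow : ∀ B l, 1 ≤ l → l < k → ∀ h, l * h ≤ B → Dec p B l h (C' * (p:ℝ) ^ (ε * h)))
    (hdk : ∀ B h, k * h ≤ B → Dec p B k h (C * (p:ℝ) ^ (Λ * h)))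
    {n l Kn : ℕ} (hl : 1 ≤ l) (hlk : l < k) (hR : ε * k + 2 * tri k + 1 ≤ eta k e (ε * k ^ 2) n l)
    (hKn : Kn = k ^ (n + 1) * (k.factorial ^ 2) ^ (n + 1)) {B H : ℕ} (hH : 1 ≤ H) (hB : k * H ≤ B) :
    Bil p B k H l 1 1 (C' ^ (n + 1) * C * p * (p:ℝ) ^ ((Λ - 1 / (2 * Kn)) * H)) := by
  have hp : p.Prime := Fact.out
  have hp1 : (1:ℝ) ≤ p := by exact_mod_cast hp.one_lt.le
  have hp0 : (0:ℝ) < p := by linarith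
  have hKn0 : 0 < Kn := by
    rw [hKn]
    have := Nat.factorial_pos k
    positivity
  have hKnR : (0:ℝ) < Kn := by exact_mod_cast hKn0
  have hCn : 1 ≤ C' ^ (n + 1) := one_le_pow₀ hC'
  rcases Nat.lt_or_ge H Kn with hlt | hge
  · have hE : Dec p B k (H - 1) (C * (p:ℝ) ^ (Λ * H)) := by
      refine dec_mono ?_ (hdk B (H - 1) ((Nat.mul_le_mul_left k (Nat.sub_le H 1)).trans hB))
      refine mul_le_mul_of_nonneg_left (Real.rpow_le_rpow_of_exponent_le hp1 ?_) (by positivity)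
      refine mul_le_mul_of_nonneg_left ?_ (he.trans heΛ)
      exact_mod_cast Nat.sub_le H 1
    refine bil_mono ?_ (bil_E (l := l) (by omega) hkp hB hlk.le le_rfl hH le_rfl hH (by positivity) hE hE)
    have h1 : (p:ℝ) ^ (Λ * H) ≤ p * (p:ℝ) ^ ((Λ - 1 / (2 * Kn)) * H) := by
      nth_rewrite 2 [← Real.rpow_one (p:ℝ)]
      rw [← Real.rpow_add hp0]
      apply Real.rpow_le_rpow_of_exponent_le hp1
      have : (1 / (2 * (Kn:ℝ))) * H ≤ 1 := by
        rw [one_div, inv_mul_le_iff₀ (by positivity)]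
        have : (H:ℝ) ≤ Kn := by exact_mod_cast hlt.le
        linarith
      linarith
    calc C * (p:ℝ) ^ (Λ * H) ≤ C * (p * (p:ℝ) ^ ((Λ - 1 / (2 * Kn)) * H)) := by gcongr
      _ ≤ C' ^ (n + 1) * (C * (p * (p:ℝ) ^ ((Λ - 1 / (2 * Kn)) * H))) := le_mul_of_one_le_left (by positivity) hCn
      _ = _ := by ring
  · set b := (k.factorial ^ 2) ^ (n + 1) * (H / Kn) with hb
    have hq : 1 ≤ H / Kn := (Nat.one_le_div_iff hKn0).2 hge
    have hb1 : 1 ≤ b := by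
      rw [hb]
      have := Nat.factorial_pos k
      exact Nat.mul_pos (by positivity) hq
    have hkb : k ^ (n + 1) * b ≤ H := by
      rw [hb, ← mul_assoc, ← hKn]; exact Nat.mul_div_le H Kn
    have hkb1 : k * b ≤ H := by
      refine le_trans (Nat.mul_le_mul_right _ ?_) hkb
      exact Nat.le_self_pow (by omega) k
    have hbH : b ≤ H := (Nat.le_mul_of_pos_left b (by omega)).trans hkb1
    have hkfb : k.factorial ∣ b := by
      rw [hb, pow_succ, pow_two]
      exact ⟨(k.factorial * k.factorial) ^ n * k.factorial * (H / Kn), by ring⟩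
    obtain ⟨a, ha⟩ : ∃ a, l * a = (k - l + 1) * b := by
      obtain ⟨u, hu⟩ := ((Nat.dvd_factorial (by omega) hlk.le).trans hkfb).mul_left (k - l + 1)
      exact ⟨u, hu.symm⟩
    have ha1 : 1 ≤ a := by
      rcases Nat.eq_zero_or_pos a with h | h
      · rw [h, mul_zero] at ha
        have : 0 < (k - l + 1) * b := by positivity
        omega
      · exact h
    have hakb : a ≤ k * b := by
      calc a ≤ l * a := Nat.le_mul_of_pos_left _ hl
        _ = (k - l + 1) * b := ha
        _ ≤ k * b := Nat.mul_le_mul_right _ (by omega)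
    have h1 := bil_iter hk hkp hB hC hC' hε he heΛ (hlow B) (hdk B) n b l a hl hlk hb1
      (by rw [hb, pow_succ]; exact ⟨k.factorial ^ 2 * (H / Kn), by ring⟩) hkb ha
    have h2 := bil_L (D := C' * (p:ℝ) ^ (ε * (a - 1 : ℕ))) hkp hB hl (by omega) ha.le le_rfl ha1 (hakb.trans hkb1) (by positivity) (by positivity)
      (hlow B l hl hlk (a - 1) (le_trans (Nat.mul_le_mul hlk.le ((Nat.sub_le _ _).trans (hakb.trans hkb1))) hB)) h1
    have h3 := bil_b1 hlk hb1 hbH (by positivity) h2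
    refine bil_mono ?_ h3
    set x := eta k e (ε * k ^ 2) n l with hx
    have hbr : (H:ℝ) / (2 * Kn) ≤ b := by
      have t1 : H < Kn * (H / Kn + 1) := Nat.lt_mul_div_succ H hKn0
      have t2 : (H:ℝ) ≤ Kn * ((H / Kn : ℕ) + 1) := by exact_mod_cast t1.le
      have t3 : (1:ℝ) ≤ ((H / Kn : ℕ):ℝ) := by exact_mod_cast hq
      have t4 : ((H / Kn : ℕ):ℝ) ≤ b := by
        have : H / Kn ≤ b := by
          rw [hb]; exact Nat.le_mul_of_pos_left _ (by have := Nat.factorial_pos k; positivity)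
        exact_mod_cast this
      rw [div_le_iff₀ (by positivity)]
      nlinarith
    have e1 : ((p:ℝ) ^ b) ^ (2 * (tri k - tri l)) = (p:ℝ) ^ ((b:ℝ) * (2 * ((tri k - tri l : ℕ) : ℝ))) := by
      rw [← pow_mul, ← Real.rpow_natCast]; push_cast; rfl
    have e2 : ((p:ℝ) ^ b) ^ (2 * (tri k - tri l)) * (C' * (p:ℝ) ^ (ε * (a - 1 : ℕ)) *
        (C' ^ n * C * (p:ℝ) ^ (Λ * H - x * b))) = C' ^ (n + 1) * C * 1 *
          (p:ℝ) ^ ((b:ℝ) * (2 * ((tri k - tri l : ℕ) : ℝ)) + ε * (a - 1 : ℕ) + (Λ * H - x * b)) := by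
      rw [e1, Real.rpow_add hp0, Real.rpow_add hp0]; ring
    rw [e2]
    gcongr ?_ * ?_ * ?_ * ?_
    apply Real.rpow_le_rpow_of_exponent_le hp1
    have f1 : ((tri k - tri l : ℕ) : ℝ) ≤ tri k := by exact_mod_cast Nat.sub_le _ _
    have f2 : ((a - 1 : ℕ):ℝ) ≤ k * b := by exact_mod_cast (Nat.sub_le _ _).trans hakb
    have f3 : ε * ((a - 1 : ℕ):ℝ) ≤ ε * (k * b) := mul_le_mul_of_nonneg_left f2 hε
    have hb0 : (0:ℝ) ≤ b := by positivity
    have f4 : (b:ℝ) * (2 * ((tri k - tri l : ℕ) : ℝ)) ≤ b * (2 * tri k) := by gcongr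
    have f5 : (ε * k + 2 * tri k + 1) * b ≤ x * b := mul_le_mul_of_nonneg_right hR hb0
    have f6 : (Λ - 1 / (2 * Kn)) * H = Λ * H - (H:ℝ) / (2 * Kn) := by ring
    rw [f6]
    linarith

lemma dec_gain (hk : 2 ≤ k) (hkp : k < p) {C C' Λ ε e : ℝ} (hC : 1 ≤ C) (hC' : 1 ≤ C')
    (hε : 0 ≤ ε) (he : 0 ≤ e) (heΛ : e ≤ Λ)
    (hlow : ∀ B l, 1 ≤ l → l < k → ∀ h, l * h ≤ B → Dec p B l h (C' * (p:ℝ) ^ (ε * h)))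
    (hdk : ∀ B h, k * h ≤ B → Dec p B k h (C * (p:ℝ) ^ (Λ * h)))
    {n l Kn : ℕ} (hl : 1 ≤ l) (hlk : l < k) (hR : ε * k + 2 * tri k + 1 ≤ eta k e (ε * k ^ 2) n l)
    (hKn : Kn = k ^ (n + 1) * (k.factorial ^ 2) ^ (n + 1))
    (hbig : 2 * 4 ^ tri k ≤ (p:ℝ) ^ (Λ - 1 / (2 * Kn))) :
    ∃ D : ℝ, 1 ≤ D ∧ ∀ B H, k * H ≤ B → Dec p B k H (D * (p:ℝ) ^ ((Λ - 1 / (2 * Kn)) * H)) := by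
  have hp : p.Prime := Fact.out
  have hp1 : (1:ℝ) ≤ p := by exact_mod_cast hp.one_lt.le
  have hp0 : (0:ℝ) < p := by linarith
  set μ : ℝ := Λ - 1 / (2 * Kn) with hμ
  set Q := C' ^ (n + 1) * C * p with hQ
  have hQ1 : 1 ≤ Q := one_le_mul_of_one_le_of_one_le
    (one_le_mul_of_one_le_of_one_le (one_le_pow₀ hC') hC) hp1
  set D := 2 * ((p:ℝ) ^ (4 * tri k + 2) * Q) with hD
  have hD1 : 1 ≤ D := by
    have : 1 ≤ (p:ℝ) ^ (4 * tri k + 2) * Q := one_le_mul_of_one_le_of_one_le (one_le_pow₀ hp1) hQ1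
    linarith
  refine ⟨D, hD1, fun B H => ?_⟩
  induction H with
  | zero => 
    intro _
    refine dec_mono ?_ (dec_zero (by omega))
    simpa using hD1
  | succ H ih =>
    intro hB
    have h1 := ih ((Nat.mul_le_mul_left k (Nat.le_succ H)).trans hB)
    have h2 := bil_gain hk hkp hC hC' hε he heΛ hlow hdk hl hlk hR hKn (Nat.succ_pos H) hB
    have h3 := dec_step hl hlk hkp (Nat.succ_pos H) hB (by positivity) (by positivity) h1 h2
    refine dec_mono ?_ h3
    rw [← hμ, ← hQ]
    have e : (p:ℝ) ^ (μ * ((H + 1 : ℕ):ℝ)) = (p:ℝ) ^ μ * (p:ℝ) ^ (μ * H) := by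
      rw [← Real.rpow_add hp0]; congr 1; push_cast; ring
    rw [e]
    have n1 : 0 < (p:ℝ) ^ (μ * H) := by positivity
    have n2 : 4 ^ tri k * (D * (p:ℝ) ^ (μ * H)) * 2 ≤ D * ((p:ℝ) ^ μ * (p:ℝ) ^ (μ * H)) := by
      calc _ = D * ((2 * 4 ^ tri k) * (p:ℝ) ^ (μ * H)) := by ring
        _ ≤ _ := by gcongr
    have n3 : (p:ℝ) ^ (4 * tri k + 2) * (Q * ((p:ℝ) ^ μ * (p:ℝ) ^ (μ * H))) * 2 = D * ((p:ℝ) ^ μ * (p:ℝ) ^ (μ * H)) := by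
      rw [hD]; ring
    linarith

/-- p-adic decoupling for the moment curve -/
theorem dec_all : ∀ k : ℕ, 1 ≤ k → ∀ e : ℝ, 0 < e → ∃ p0 : ℕ, ∀ p : ℕ, p0 ≤ p → ∀ [Fact p.Prime],
    ∃ C : ℝ, 1 ≤ C ∧ ∀ B H, k * H ≤ B → Dec p B k H (C * (p:ℝ) ^ (e * H)) := by
  intro k
  induction k using Nat.strong_induction_on with
  | _ k IH =>
  intro hk e he
  rcases Nat.eq_or_lt_of_le hk with h1 | h1
  · subst h1
    refine ⟨0, fun p _ _ => ⟨1, le_rfl, fun B H hB => ?_⟩⟩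
    have hp : p.Prime := Fact.out
    have hp1 : (1:ℝ) ≤ p := by exact_mod_cast hp.one_lt.le
    refine dec_mono ?_ (dec_one (by omega))
    rw [one_mul]
    exact Real.one_le_rpow hp1 (by positivity)
  · have hk2 : 2 ≤ k := h1
    have hkR : (0:ℝ) < k := by positivity
    set ε := e / (2 * k) / (k:ℝ) ^ 2 with hε
    have hε0 : 0 < ε := by positivity
    have hεk : ε * (k:ℝ) ^ 2 = e / (2 * k) := by rw [hε]; field_simp
    obtain ⟨n, l, hl, hlk, hR⟩ := eta_large k hk2 e he (ε * k + 2 * tri k + 1)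
    rw [← hεk] at hR
    have hlow : ∃ p1 : ℕ, ∀ p, p1 ≤ p → ∀ [Fact p.Prime], ∃ C' : ℝ, 1 ≤ C' ∧
        ∀ B l, 1 ≤ l → l < k → ∀ h, l * h ≤ B → Dec p B l h (C' * (p:ℝ) ^ (ε * h)) := by
      choose! f hf using fun l (hl : l < k) (h1 : 1 ≤ l) => IH l hl h1 ε hε0
      refine ⟨∑ l ∈ range k, f l, fun p hp inst => ?_⟩
      have h2 : ∀ l, l < k → 1 ≤ l → ∃ C : ℝ, 1 ≤ C ∧ ∀ B H, l * H ≤ B → Dec p B l H (C * (p:ℝ) ^ (ε * H)) := by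
        intro l hl h1
        refine hf l hl h1 p (le_trans ?_ hp)
        exact Finset.single_le_sum (f := f) (fun _ _ => Nat.zero_le _) (Finset.mem_range.2 hl)
      choose! c hc using h2
      refine ⟨1 + ∑ l ∈ range k, |c l|, ?_, ?_⟩
      · have : 0 ≤ ∑ l ∈ range k, |c l| := Finset.sum_nonneg fun _ _ => abs_nonneg _
        linarith
      · intro B l h1 hl h hB
        refine dec_mono ?_ ((hc l hl h1).2 B h hB)
        gcongr
        have : |c l| ≤ ∑ l ∈ range k, |c l| := Finset.single_le_sum (f := fun l => |c l|) (fun _ _ => abs_nonneg _) (Finset.mem_range.2 hl)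
        have := le_abs_self (c l)
        linarith
    obtain ⟨p1, hp1⟩ := hlow
    set Kn := k ^ (n + 1) * (k.factorial ^ 2) ^ (n + 1) with hKn
    have hKn0 : 0 < Kn := by
      have := Nat.factorial_pos k
      positivity
    have hKnR : (0:ℝ) < Kn := by exact_mod_cast hKn0
    obtain ⟨p2, hp2⟩ : ∃ p2 : ℕ, ∀ p : ℕ, p2 ≤ p → 2 * 4 ^ tri k ≤ (p:ℝ) ^ (e / 2) := by
      have := (tendsto_rpow_atTop (show 0 < e / 2 by positivity)).comp tendsto_natCast_atTop_atTop
      obtain ⟨N, hN⟩ := Filter.eventually_atTop.1 (this.eventually_ge_atTop (2 * 4 ^ tri k))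
      exact ⟨N, hN⟩
    -- choose the gain at most e/2 : enlarge by monotonicity
    refine ⟨p1 + p2 + (k + 1), fun p hp _ => ?_⟩
    have hpp : p.Prime := Fact.out
    have hpR : (1:ℝ) ≤ p := by exact_mod_cast hpp.one_lt.le
    obtain ⟨C', hC', hlow⟩ := hp1 p (by omega)
    set c : ℝ := min (1 / (2 * Kn)) (e / 2) with hc
    have hc0 : 0 < c := by positivity
    have step : ∀ Λ : ℝ, e ≤ Λ → (∃ C : ℝ, 1 ≤ C ∧ ∀ B H, k * H ≤ B → Dec p B k H (C * (p:ℝ) ^ (Λ * H))) →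
        ∃ C : ℝ, 1 ≤ C ∧ ∀ B H, k * H ≤ B → Dec p B k H (C * (p:ℝ) ^ (max e (Λ - c) * H)) := by
      rintro Λ heΛ ⟨C, hC, hdk⟩
      set Λ' := max Λ (1 / (2 * Kn) + e / 2) with hΛ'
      obtain ⟨D, hD, hDD⟩ := dec_gain (Λ := Λ') hk2 (by omega) hC hC' hε0.le he.le (heΛ.trans (le_max_left _ _)) hlow (by
        intro B h hB
        refine dec_mono ?_ (hdk B h hB)
        refine mul_le_mul_of_nonneg_left (Real.rpow_le_rpow_of_exponent_le hpR ?_) (by positivity)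
        gcongr
        exact le_max_left _ _) hl hlk hR hKn (by
          refine (hp2 p (by omega)).trans (Real.rpow_le_rpow_of_exponent_le hpR ?_)
          have := le_max_right Λ (1 / (2 * (Kn:ℝ)) + e / 2)
          linarith)
      refine ⟨D, hD, fun B H hB => dec_mono ?_ (hDD B H hB)⟩
      refine mul_le_mul_of_nonneg_left (Real.rpow_le_rpow_of_exponent_le hpR ?_) (by positivity)
      gcongr
      rw [hΛ', sub_le_iff_le_add]
      apply max_le
      · have h1 := le_max_right e (Λ - c)
        have h2 := min_le_left (1 / (2 * (Kn:ℝ))) (e / 2)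
        linarith
      · have h1 := le_max_left e (Λ - c)
        linarith
    have iter : ∀ j : ℕ, ∃ C : ℝ, 1 ≤ C ∧ ∀ B H, k * H ≤ B →
        Dec p B k H (C * (p:ℝ) ^ (max e (2 * tri k - j * c) * H)) := by
      intro j
      induction j with
      | zero =>
        refine ⟨1, le_rfl, fun B H hB => dec_mono ?_ (dec_triv hk H)⟩
        rw [one_mul, ← pow_mul, ← Real.rpow_natCast]
        apply Real.rpow_le_rpow_of_exponent_le hpR
        push_cast
        rw [mul_comm]
        gcongr
        have := le_max_right e (2 * (tri k:ℝ) - 0 * c)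
        linarith
      | succ j ih =>
        have := step _ (le_max_left _ _) ih
        obtain ⟨C, hC, h⟩ := this
        refine ⟨C, hC, fun B H hB => dec_mono ?_ (h B H hB)⟩
        refine mul_le_mul_of_nonneg_left (Real.rpow_le_rpow_of_exponent_le hpR ?_) (by positivity)
        refine mul_le_mul_of_nonneg_right ?_ (Nat.cast_nonneg H)
        apply max_le (le_max_left _ _)
        rw [sub_le_iff_le_add]
        apply max_le
        · have := le_max_left e (2 * (tri k:ℝ) - ((j + 1 : ℕ):ℝ) * c)
          linarith
        · have := le_max_right e (2 * (tri k:ℝ) - ((j + 1 : ℕ):ℝ) * c)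
          push_cast at this
          push_cast
          linarith
    obtain ⟨j, hj⟩ := exists_nat_ge (2 * (tri k:ℝ) / c)
    obtain ⟨C, hC, h⟩ := iter j
    refine ⟨C, hC, fun B H hB => ?_⟩
    have := h B H hB
    rwa [max_eq_left] at this
    rw [div_le_iff₀ hc0] at hj
    linarith

end VM

open Finset Polynomial

namespace VM

lemma char_sum {A ι : Type*} [AddCommMonoid A] (ψ : AddChar A ℂ) (s : Finset ι) (f : ι → A) :
    ψ (∑ i ∈ s, f i) = ∏ i ∈ s, ψ (f i) := by
  classical
  induction s using Finset.induction_on with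
  | empty => simp
  | insert a s ha ih => rw [Finset.sum_insert ha, Finset.prod_insert ha, AddChar.map_add_eq_mul, ih]

lemma moment_id (Q : ℕ) [NeZero Q] {κ ι : Type*} [Fintype κ] [DecidableEq κ] [DecidableEq ι]
    (g : ι → κ → ZMod Q) (S : Finset ι) (s : ℕ) :
    ∑ t : κ → ZMod Q, ‖∑ i ∈ S, (ZMod.stdAddChar (∑ j, t j * g i j) : ℂ)‖ ^ (2 * s) =
      (Q:ℝ) ^ (Fintype.card κ) *
        (∑ x ∈ Fintype.piFinset (fun _ : Fin s => S), ∑ y ∈ Fintype.piFinset (fun _ : Fin s => S),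
          if (∀ j, ∑ a, g (x a) j = ∑ a, g (y a) j) then (1:ℝ) else 0) := by
  classical
  have h0 : ∀ t : κ → ZMod Q, (∑ i ∈ S, (ZMod.stdAddChar (∑ j, t j * g i j) : ℂ)) ^ s =
      ∑ x ∈ Fintype.piFinset (fun _ : Fin s => S),
        (ZMod.stdAddChar (∑ j, t j * ∑ a, g (x a) j) : ℂ) := by
    intro t
    have := Finset.prod_univ_sum (fun _ : Fin s => S)
      (fun _ i => (ZMod.stdAddChar (∑ j, t j * g i j) : ℂ))
    rw [Finset.prod_const, Finset.card_univ, Fintype.card_fin] at this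
    rw [this]
    refine Finset.sum_congr rfl fun x _ => ?_
    rw [← char_sum]
    congr 1
    rw [Finset.sum_comm]
    simp_rw [Finset.mul_sum]
  have h1 : ((∑ t : κ → ZMod Q, ‖∑ i ∈ S, (ZMod.stdAddChar (∑ j, t j * g i j) : ℂ)‖ ^ (2 * s) : ℝ) : ℂ)
      = ∑ x ∈ Fintype.piFinset (fun _ : Fin s => S), ∑ y ∈ Fintype.piFinset (fun _ : Fin s => S),
        ∑ t : κ → ZMod Q, (ZMod.stdAddChar (∑ j, t j * (∑ a, g (x a) j - ∑ a, g (y a) j)) : ℂ) := by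
    push_cast
    have : ∀ t : κ → ZMod Q, ((‖∑ i ∈ S, (ZMod.stdAddChar (∑ j, t j * g i j) : ℂ)‖ : ℝ) : ℂ) ^ (2 * s)
      = ∑ x ∈ Fintype.piFinset (fun _ : Fin s => S), ∑ y ∈ Fintype.piFinset (fun _ : Fin s => S),
         (ZMod.stdAddChar (∑ j, t j * (∑ a, g (x a) j - ∑ a, g (y a) j)) : ℂ) := by
      intro t
      rw [pow_mul, ← Complex.mul_conj', mul_pow, ← map_pow, h0, map_sum, Finset.sum_mul_sum]
      refine Finset.sum_congr rfl fun x _ => Finset.sum_congr rfl fun y _ => ?_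
      rw [← AddChar.map_neg_eq_conj, ← AddChar.map_add_eq_mul]
      congr 1
      simp_rw [mul_sub, Finset.sum_sub_distrib]
      ring
    simp_rw [this]
    rw [Finset.sum_comm]
    refine Finset.sum_congr rfl fun i _ => ?_
    rw [Finset.sum_comm]
  have h2 : ∀ d : κ → ZMod Q, ∑ t : κ → ZMod Q, (ZMod.stdAddChar (∑ j, t j * d j) : ℂ) =
      if (∀ j, d j = 0) then (Q:ℂ) ^ (Fintype.card κ) else 0 := by
    intro d
    have := Finset.prod_univ_sum (fun _ : κ => (Finset.univ : Finset (ZMod Q)))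
      (fun j x => (ZMod.stdAddChar (x * d j) : ℂ))
    rw [Fintype.piFinset_univ] at this
    simp_rw [char_sum]
    rw [← this]
    simp_rw [AddChar.sum_mulShift _ (ZMod.isPrimitive_stdAddChar Q)]
    split_ifs with h
    · simp [h, ZMod.card]
    · push Not at h
      obtain ⟨j, hj⟩ := h
      apply Finset.prod_eq_zero (Finset.mem_univ j)
      simp [hj]
  have : ((∑ t : κ → ZMod Q, ‖∑ i ∈ S, (ZMod.stdAddChar (∑ j, t j * g i j) : ℂ)‖ ^ (2 * s) : ℝ) : ℂ)
     = (((Q:ℝ) ^ (Fintype.card κ) *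
        (∑ x ∈ Fintype.piFinset (fun _ : Fin s => S), ∑ y ∈ Fintype.piFinset (fun _ : Fin s => S),
          if (∀ j, ∑ a, g (x a) j = ∑ a, g (y a) j) then (1:ℝ) else 0) : ℝ) : ℂ) := by
    rw [h1]
    push_cast
    rw [Finset.mul_sum]
    refine Finset.sum_congr rfl fun x _ => ?_
    rw [Finset.mul_sum]
    refine Finset.sum_congr rfl fun y _ => ?_
    rw [h2]
    simp_rw [sub_eq_zero]
    split_ifs <;> simp
  exact_mod_cast this

/-- Vinogradov mean value -/
noncomputable def JJ (s k M : ℕ) : ℝ :=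
  ∑ x ∈ Fintype.piFinset (fun _ : Fin s => Finset.Icc (1:ℤ) M),
    ∑ y ∈ Fintype.piFinset (fun _ : Fin s => Finset.Icc (1:ℤ) M),
      if (∀ j : Fin k, ∑ a, x a ^ ((j:ℕ) + 1) = ∑ a, y a ^ ((j:ℕ) + 1)) then (1:ℝ) else 0

theorem vmvt (k : ℕ) (hk : 1 ≤ k) (e : ℝ) (he : 0 < e) :
    ∃ C : ℝ, 1 ≤ C ∧ ∀ M : ℕ, 1 ≤ M → JJ (tri k) k M ≤ C * (M:ℝ) ^ (tri k + e) := by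
  classical
  obtain ⟨p0, hp0⟩ := dec_all k hk e he
  obtain ⟨p, hpge, hp⟩ := Nat.exists_infinite_primes p0
  have : Fact p.Prime := ⟨hp⟩
  obtain ⟨C, hC, hD⟩ := hp0 p hpge
  have hp1 : (1:ℝ) ≤ p := by exact_mod_cast hp.one_le
  have hp2 : 2 ≤ p := hp.two_le
  have hs : 1 ≤ tri k := tri_pos hk
  refine ⟨C * (p:ℝ) ^ e, ?_, fun M hM => ?_⟩
  · have := Real.one_le_rpow hp1 he.le
    nlinarith
  -- choose H
  obtain ⟨H, hH1, hH2⟩ : ∃ H : ℕ, M < p ^ H ∧ (p:ℝ) ^ H ≤ p * M := by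
    refine ⟨Nat.log p M + 1, Nat.lt_pow_succ_log_self hp2 M, ?_⟩
    have := Nat.pow_log_le_self p (x := M) (by omega)
    rw [pow_succ, mul_comm]
    have h2 : ((p ^ Nat.log p M : ℕ):ℝ) ≤ M := by exact_mod_cast this
    push_cast at h2
    gcongr
  have hdec := hD (k * H) H le_rfl (fun j => X ^ ((j:ℕ) + 1)) (fun j => ⟨0, by simp⟩) id (fun _ => 1)
    (Finset.Icc (1:ℤ) M)
  set F := Fam ((p : ZMod (p ^ (k * H))) ^ (k * H - k * H)) (fun j : Fin k => (X:(ZMod (p ^ (k * H)))[X]) ^ ((j:ℕ) + 1)) id (fun _ => 1) with hF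
  have hFe : ∀ i t, F i t = ZMod.stdAddChar (∑ j, t j * ((i : ZMod (p ^ (k*H)))) ^ ((j:ℕ) + 1)) := by
    intro i t
    simp [hF, Fam, ev]
  set Q : ℝ := ((p ^ (k * H) : ℕ) : ℝ) ^ k with hQ
  have hQ0 : 0 < Q := by
    have : 0 < p ^ (k * H) := by positivity
    rw [hQ]; positivity
  have hL : Q * JJ (tri k) k M ≤ ∑ t, ‖∑ i ∈ Finset.Icc (1:ℤ) M, F i t‖ ^ (2 * tri k) := by
    simp_rw [hFe]
    rw [moment_id (p ^ (k * H)) (fun (i : ℤ) (j : Fin k) => (i : ZMod (p ^ (k*H))) ^ ((j:ℕ) + 1))]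
    rw [Fintype.card_fin, hQ, JJ]
    gcongr with x _ y _
    split_ifs with h1 h2 h2
    · exact le_rfl
    · exact absurd (fun j => by exact_mod_cast congrArg (Int.cast : ℤ → ZMod (p ^ (k*H))) (h1 j)) h2
    · exact zero_le_one
    · exact le_rfl
  have hblk : ∀ J ∈ blocks p id H (Finset.Icc (1:ℤ) M), nn (tri k) F J = Q ^ ((1:ℝ) / tri k) := by
    intro J hJ
    obtain ⟨i, hi⟩ := blocks_nonempty hJ
    have hJi : J = {i} := by
      ext j
      rw [Finset.mem_singleton]
      refine ⟨fun hj => ?_, fun h => h ▸ hi⟩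
      have h1 := blocks_dvd hJ hj hi
      have h2 := Finset.mem_Icc.1 (blocks_subset hJ hi)
      have h3 := Finset.mem_Icc.1 (blocks_subset hJ hj)
      simp only [id] at h1
      have hM' : (M:ℤ) < (p:ℤ) ^ H := by exact_mod_cast hH1
      have := Int.eq_zero_of_abs_lt_dvd h1 (by rw [abs_lt]; constructor <;> linarith)
      linarith
    rw [nn, hJi]
    congr 1
    simp_rw [Finset.sum_singleton, hFe, norm_char, one_pow]
    simp [hQ, ZMod.card]
  have hNN : NN p id H (tri k) F (Finset.Icc (1:ℤ) M) ^ tri k ≤ (M:ℝ) ^ tri k * Q := by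
    rw [NN, Finset.sum_congr rfl hblk, Finset.sum_const, nsmul_eq_mul, mul_pow, rpow_inv_pow hQ0.le hs]
    gcongr
    rw [blocks]
    refine Finset.card_image_le.trans ?_
    simp
  have h3 : Q * JJ (tri k) k M ≤ C * (p:ℝ) ^ (e * H) * ((M:ℝ) ^ tri k * Q) :=
    hL.trans (hdec.trans (by gcongr))
  have h4 : JJ (tri k) k M ≤ C * (p:ℝ) ^ (e * H) * (M:ℝ) ^ tri k := by
    refine le_of_mul_le_mul_left ?_ hQ0
    linarith
  refine h4.trans ?_
  have hM0 : (0:ℝ) < M := by exact_mod_cast hM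
  have h5 : (p:ℝ) ^ (e * H) ≤ (p:ℝ) ^ e * (M:ℝ) ^ e := by
    rw [← Real.mul_rpow (by positivity) hM0.le, mul_comm, Real.rpow_mul (by positivity), Real.rpow_natCast]
    exact Real.rpow_le_rpow (by positivity) hH2 he.le
  rw [Real.rpow_add hM0, Real.rpow_natCast]
  calc C * (p:ℝ) ^ (e * H) * (M:ℝ) ^ tri k ≤ C * ((p:ℝ) ^ e * (M:ℝ) ^ e) * (M:ℝ) ^ tri k := by gcongr
    _ = _ := by ring

end VM

open Finset Polynomial

namespace VM

/-- the additive character -/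
noncomputable def ee (x : ℝ) : ℂ := Complex.exp (2 * Real.pi * Complex.I * x)

lemma ee_add (x y : ℝ) : ee (x + y) = ee x * ee y := by
  rw [ee, ee, ee, ← Complex.exp_add]; congr 1; push_cast; ring

lemma ee_zero : ee 0 = 1 := by simp [ee]

lemma ee_int (n : ℤ) : ee n = 1 := by
  rw [ee, Complex.exp_eq_one_iff]; exact ⟨n, by push_cast; ring⟩

lemma ee_add_int (x : ℝ) (n : ℤ) : ee (x + n) = ee x := by rw [ee_add, ee_int, mul_one]

lemma norm_ee (x : ℝ) : ‖ee x‖ = 1 := by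
  rw [ee]
  have : (2 * Real.pi * Complex.I * x : ℂ) = ((2 * Real.pi * x : ℝ) : ℂ) * Complex.I := by
    push_cast; ring
  rw [this, Complex.norm_exp_ofReal_mul_I]

lemma ee_sum {ι : Type*} (s : Finset ι) (f : ι → ℝ) : ee (∑ i ∈ s, f i) = ∏ i ∈ s, ee (f i) := by
  classical
  induction s using Finset.induction_on with
  | empty => simp [ee_zero]
  | insert a s ha ih => rw [Finset.sum_insert ha, Finset.prod_insert ha, ee_add, ih]

lemma std_eq_ee (L : ℕ) [NeZero L] (u n : ℤ) :
    (ZMod.stdAddChar ((u : ZMod L) * (n : ZMod L)) : ℂ) = ee (u / L * n) := by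
  have := ZMod.stdAddChar_coe (N := L) (u * n)
  push_cast at this
  rw [this, ee]
  congr 1
  push_cast
  ring

lemma ls_orth (L : ℕ) [NeZero L] (b : ℤ → ℂ) :
    ∑ u : ZMod L, ‖∑ n ∈ Finset.Icc (1:ℤ) L, b n * (ZMod.stdAddChar (u * (n : ZMod L)) : ℂ)‖ ^ 2 =
      L * ∑ n ∈ Finset.Icc (1:ℤ) L, ‖b n‖ ^ 2 := by
  classical
  have h := orth_sq (Ω := ZMod L) (fun n u => b n * (ZMod.stdAddChar (u * (n : ZMod L)) : ℂ)) (Finset.Icc (1:ℤ) L)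
  have h2 : ((L * ∑ n ∈ Finset.Icc (1:ℤ) L, ‖b n‖ ^ 2 : ℝ) : ℂ) = ∑ i ∈ Finset.Icc (1:ℤ) L, ∑ j ∈ Finset.Icc (1:ℤ) L,
      ∑ u : ZMod L, b i * (ZMod.stdAddChar (u * (i : ZMod L)) : ℂ) *
        (starRingEnd ℂ) (b j * (ZMod.stdAddChar (u * (j : ZMod L)) : ℂ)) := by
    push_cast
    rw [Finset.mul_sum]
    refine Finset.sum_congr rfl fun i hi => ?_
    have : ∀ j ∈ Finset.Icc (1:ℤ) L, ∑ u : ZMod L, b i * (ZMod.stdAddChar (u * (i : ZMod L)) : ℂ) *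
        (starRingEnd ℂ) (b j * (ZMod.stdAddChar (u * (j : ZMod L)) : ℂ)) =
        if i = j then b i * (starRingEnd ℂ) (b j) * L else 0 := by
      intro j hj
      have e : ∀ u : ZMod L, b i * (ZMod.stdAddChar (u * (i : ZMod L)) : ℂ) *
        (starRingEnd ℂ) (b j * (ZMod.stdAddChar (u * (j : ZMod L)) : ℂ)) =
          b i * (starRingEnd ℂ) (b j) * (ZMod.stdAddChar (u * ((i : ZMod L) - (j : ZMod L))) : ℂ) := by
        intro u
        rw [map_mul (starRingEnd ℂ), ← AddChar.map_neg_eq_conj, mul_mul_mul_comm, ← AddChar.map_add_eq_mul]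
        congr 2; ring
      simp_rw [e]
      rw [← Finset.mul_sum, AddChar.sum_mulShift _ (ZMod.isPrimitive_stdAddChar L)]
      rw [ZMod.card]
      have : ((i : ZMod L) - (j : ZMod L) = 0) ↔ i = j := by
        constructor
        · intro h0
          have h1 : ((i - j : ℤ) : ZMod L) = 0 := by push_cast; exact h0
          rw [ZMod.intCast_zmod_eq_zero_iff_dvd] at h1
          rw [Finset.mem_Icc] at hi hj
          have := Int.eq_zero_of_abs_lt_dvd h1 (by rw [abs_lt]; constructor <;> linarith)
          linarith
        · rintro rfl; simp
      simp only [this]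
      split_ifs <;> simp
    rw [Finset.sum_congr rfl this, Finset.sum_ite_eq, if_pos hi, Complex.mul_conj']
    ring
  rw [← h] at h2
  exact_mod_cast h2.symm

lemma large_sieve {ι : Type*} [DecidableEq ι] (L : ℕ) (hL : 1 ≤ L) (I : Finset ι) (γ : ι → ℝ)
    (hsep : ∀ i ∈ I, ∀ j ∈ I, i ≠ j → ∀ n : ℤ, (1:ℝ) / L ≤ |γ i - γ j - n|) (A : ℤ → ℂ) :
    ∑ i ∈ I, ‖∑ n ∈ Finset.Icc (1:ℤ) L, A n * ee (γ i * n)‖ ^ 2 ≤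
      Real.exp (4 * Real.pi) * (L * ∑ n ∈ Finset.Icc (1:ℤ) L, ‖A n‖ ^ 2) := by
  have : NeZero L := ⟨by omega⟩
  have hL0 : (0:ℝ) < L := by exact_mod_cast hL
  set u : ι → ℤ := fun i => ⌊L * Int.fract (γ i)⌋ with hu
  set δ : ι → ℝ := fun i => L * Int.fract (γ i) - u i with hδ
  have hδ0 : ∀ i, 0 ≤ δ i := fun i => by
    have := Int.floor_le (L * Int.fract (γ i)); simp only [hδ, hu]; linarith
  have hδ1 : ∀ i, δ i < 1 := fun i => by
    have := Int.lt_floor_add_one (L * Int.fract (γ i)); simp only [hδ, hu]; linarith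
  have hu0 : ∀ i, 0 ≤ u i := fun i => Int.floor_nonneg.2 (by have := Int.fract_nonneg (γ i); positivity)
  have hu1 : ∀ i, u i < L := fun i => by
    rw [hu]; simp only
    rw [Int.floor_lt]
    have := Int.fract_lt_one (γ i)
    push_cast
    nlinarith
  have hinj : Set.InjOn (fun i => (u i : ZMod L)) I := by
    intro i hi j hj hij
    by_contra hne
    simp only at hij
    have h1 : ((u i - u j : ℤ) : ZMod L) = 0 := by push_cast; rw [hij]; ring
    rw [ZMod.intCast_zmod_eq_zero_iff_dvd] at h1
    have h2 := Int.eq_zero_of_abs_lt_dvd h1 (by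
      rw [abs_lt]; constructor <;> linarith [hu0 i, hu0 j, hu1 i, hu1 j])
    have h3 := hsep i hi j hj hne (⌊γ i⌋ - ⌊γ j⌋)
    have h4 : γ i - γ j - ((⌊γ i⌋ - ⌊γ j⌋ : ℤ) : ℝ) = (δ i - δ j) / L := by
      have h5 : (u i : ℝ) = u j := by exact_mod_cast (by linarith : u i = u j)
      simp only [hδ, h5]
      have this1 := Int.self_sub_floor (γ i)
      have this2 := Int.self_sub_floor (γ j)
      push_cast
      rw [eq_div_iff hL0.ne']
      linear_combination (L:ℝ) * this1 - (L:ℝ) * this2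
    rw [h4, abs_div, abs_of_pos hL0] at h3
    have h6 : |δ i - δ j| < 1 := by
      rw [abs_lt]; constructor <;> linarith [hδ0 i, hδ0 j, hδ1 i, hδ1 j]
    have : |δ i - δ j| / L < 1 / L := by gcongr
    linarith
  set y : ι → ℕ → ℂ := fun i r => ∑ n ∈ Finset.Icc (1:ℤ) L, (A n * ((n:ℂ) / L) ^ r) * (ZMod.stdAddChar ((u i : ZMod L) * (n : ZMod L)) : ℂ) with hy
  have hysum : ∀ r, ∑ i ∈ I, ‖y i r‖ ^ 2 ≤ L * ∑ n ∈ Finset.Icc (1:ℤ) L, ‖A n‖ ^ 2 := by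
    intro r
    have h1 := ls_orth L (fun n => A n * ((n:ℂ) / L) ^ r)
    have h2 : ∑ i ∈ I, ‖y i r‖ ^ 2 ≤ ∑ u : ZMod L, ‖∑ n ∈ Finset.Icc (1:ℤ) L, (A n * ((n:ℂ) / L) ^ r) * (ZMod.stdAddChar (u * (n : ZMod L)) : ℂ)‖ ^ 2 := by
      have := Finset.sum_image (s := I) (g := fun i => (u i : ZMod L))
        (f := fun u => ‖∑ n ∈ Finset.Icc (1:ℤ) L, (A n * ((n:ℂ) / L) ^ r) * (ZMod.stdAddChar (u * (n : ZMod L)) : ℂ)‖ ^ 2) hinj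
      rw [hy, ← this]
      exact Finset.sum_le_sum_of_subset_of_nonneg (Finset.subset_univ _) (fun _ _ _ => by positivity)
    refine h2.trans (h1.le.trans ?_)
    refine mul_le_mul_of_nonneg_left (Finset.sum_le_sum fun n hn => ?_) hL0.le
    rw [Finset.mem_Icc] at hn
    rw [norm_mul, norm_pow, norm_div]
    have : ‖(n:ℂ)‖ / ‖(L:ℂ)‖ ≤ 1 := by
      rw [div_le_one (by simpa using hL0)]
      rw [Complex.norm_natCast, Complex.norm_intCast, abs_of_nonneg (by exact_mod_cast (by linarith : (0:ℤ) ≤ n))]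
      exact_mod_cast hn.2
    have h3 : (‖(n:ℂ)‖ / ‖(L:ℂ)‖) ^ r ≤ 1 := pow_le_one₀ (by positivity) this
    refine pow_le_pow_left₀ (by positivity) ?_ 2
    exact mul_le_of_le_one_right (norm_nonneg _) h3
  -- Taylor expansion
  have htay : ∀ i, Filter.Tendsto (fun R => ∑ r ∈ Finset.range R, ((2 * Real.pi * Complex.I * δ i) ^ r / (r.factorial : ℂ)) * y i r)
      Filter.atTop (nhds (∑ n ∈ Finset.Icc (1:ℤ) L, A n * ee (γ i * n))) := by
    intro i
    have e1 : ∀ R, ∑ r ∈ Finset.range R, ((2 * Real.pi * Complex.I * δ i) ^ r / (r.factorial : ℂ)) * y i r =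
        ∑ n ∈ Finset.Icc (1:ℤ) L, A n * (ZMod.stdAddChar ((u i : ZMod L) * (n : ZMod L)) : ℂ) * ∑ r ∈ Finset.range R, (2 * Real.pi * Complex.I * δ i * (n / L)) ^ r / (r.factorial : ℂ) := by
      intro R
      simp_rw [hy, Finset.mul_sum]
      rw [Finset.sum_comm]
      refine Finset.sum_congr rfl fun n _ => Finset.sum_congr rfl fun r _ => ?_
      rw [mul_pow (2 * Real.pi * Complex.I * δ i : ℂ)]
      ring
    simp_rw [e1]
    refine tendsto_finsetSum _ fun n _ => ?_
    have e2 : A n * ee (γ i * n) = A n * (ZMod.stdAddChar ((u i : ZMod L) * (n : ZMod L)) : ℂ) * Complex.exp (2 * Real.pi * Complex.I * δ i * (n / L)) := by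
      rw [std_eq_ee, mul_assoc]
      congr 1
      have : Complex.exp (2 * Real.pi * Complex.I * δ i * (n / L)) = ee (δ i * (n / L)) := by
        rw [ee]; congr 1; push_cast; ring
      rw [this, ← ee_add]
      have : γ i * n = (u i / L * n + δ i * (n / L)) + ((⌊γ i⌋ * n : ℤ) : ℝ) := by
        simp only [hδ]
        have := Int.self_sub_floor (γ i)
        push_cast
        rw [← this]
        field_simp
        ring
      rw [this, ee_add_int]
    rw [e2]
    refine Filter.Tendsto.const_mul _ ?_
    have := (NormedSpace.expSeries_div_hasSum_exp (𝔸 := ℂ) (2 * Real.pi * Complex.I * δ i * (n / L))).tendsto_sum_nat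
    rw [← Complex.exp_eq_exp_ℂ] at this
    exact this
  have hlim : Filter.Tendsto (fun R => ∑ i ∈ I, ‖∑ r ∈ Finset.range R, ((2 * Real.pi * Complex.I * δ i) ^ r / (r.factorial : ℂ)) * y i r‖ ^ 2)
      Filter.atTop (nhds (∑ i ∈ I, ‖∑ n ∈ Finset.Icc (1:ℤ) L, A n * ee (γ i * n)‖ ^ 2)) :=
    tendsto_finsetSum _ fun i _ => ((htay i).norm).pow 2
  refine le_of_tendsto' hlim fun R => ?_
  set c : ℕ → ℝ := fun r => (2 * Real.pi) ^ r / (r.factorial : ℝ) with hc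
  have hc0 : ∀ r, 0 ≤ c r := fun r => by have := Real.pi_pos; simp only [hc]; positivity
  have hcs : ∑ r ∈ Finset.range R, c r ≤ Real.exp (2 * Real.pi) :=
    Real.sum_le_exp_of_nonneg (by have := Real.pi_pos; positivity) R
  have hpt : ∀ i ∈ I, ‖∑ r ∈ Finset.range R, ((2 * Real.pi * Complex.I * δ i) ^ r / (r.factorial : ℂ)) * y i r‖ ^ 2 ≤
      (∑ r ∈ Finset.range R, c r) * ∑ r ∈ Finset.range R, c r * ‖y i r‖ ^ 2 := by
    intro i _
    have h1 : ‖∑ r ∈ Finset.range R, ((2 * Real.pi * Complex.I * δ i) ^ r / (r.factorial : ℂ)) * y i r‖ ≤ ∑ r ∈ Finset.range R, c r * ‖y i r‖ := by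
      refine (norm_sum_le _ _).trans (Finset.sum_le_sum fun r _ => ?_)
      rw [norm_mul]
      refine mul_le_mul_of_nonneg_right ?_ (norm_nonneg _)
      rw [norm_div, norm_pow, Complex.norm_natCast]
      simp only [hc]
      have := Real.pi_pos
      refine div_le_div_of_nonneg_right (pow_le_pow_left₀ (norm_nonneg _) ?_ r) (by positivity)
      simp only [norm_mul, Complex.norm_I, Complex.norm_real, Real.norm_eq_abs, Complex.norm_ofNat, abs_of_pos this, abs_of_nonneg (hδ0 i)]
      have := hδ1 i
      nlinarith [Real.pi_pos]
    refine (pow_le_pow_left₀ (norm_nonneg _) h1 2).trans ?_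
    refine Finset.sum_sq_le_sum_mul_sum_of_sq_le_mul _ (fun r _ => hc0 r) (fun r _ => mul_nonneg (hc0 r) (by positivity)) (fun r _ => le_of_eq (by ring))
  refine (Finset.sum_le_sum hpt).trans ?_
  rw [← Finset.mul_sum, Finset.sum_comm]
  simp_rw [← Finset.mul_sum]
  have h7 : ∑ r ∈ Finset.range R, c r * ∑ i ∈ I, ‖y i r‖ ^ 2 ≤ Real.exp (2 * Real.pi) * (L * ∑ n ∈ Finset.Icc (1:ℤ) L, ‖A n‖ ^ 2) := by
    refine (Finset.sum_le_sum fun r _ => mul_le_mul_of_nonneg_left (hysum r) (hc0 r)).trans ?_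
    rw [← Finset.sum_mul]
    gcongr
  have h8 : Real.exp (4 * Real.pi) = Real.exp (2 * Real.pi) * Real.exp (2 * Real.pi) := by
    rw [← Real.exp_add]; congr 1; ring
  rw [h8, mul_assoc]
  refine mul_le_mul hcs h7 ?_ (Real.exp_pos _).le
  exact Finset.sum_nonneg fun r _ => mul_nonneg (hc0 r) (Finset.sum_nonneg fun _ _ => by positivity)

end VM

open Finset Polynomial

namespace VM

/-- moments -/
def mom {s : ℕ} (x : Fin s → ℤ) (j : ℕ) : ℤ := ∑ a, x a ^ (j + 1)

lemma mom_mem {s M : ℕ} (hs : 1 ≤ s) {x : Fin s → ℤ}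
    (hx : x ∈ Fintype.piFinset (fun _ : Fin s => Finset.Icc (1:ℤ) M)) (j : ℕ) :
    mom x j ∈ Finset.Icc (1:ℤ) ((s * M ^ (j + 1) : ℕ) : ℤ) := by
  have h : ∀ a, 1 ≤ x a ∧ x a ≤ M := fun a => by
    simpa using (Fintype.mem_piFinset.1 hx) a
  rw [Finset.mem_Icc, mom]
  constructor
  · calc (1:ℤ) ≤ ∑ a : Fin s, (1:ℤ) := by simp; omega
      _ ≤ _ := Finset.sum_le_sum fun a _ => one_le_pow₀ (h a).1
  · calc ∑ a, x a ^ (j + 1) ≤ ∑ a : Fin s, (M:ℤ) ^ (j + 1) :=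
        Finset.sum_le_sum fun a _ => pow_le_pow_left₀ (by linarith [(h a).1]) (h a).2 _
      _ = _ := by simp

lemma weyl_abs (K s M : ℕ) (hs : 1 ≤ s) (hM : 1 ≤ M) (w : ℤ → ℂ) (hw : ∀ x, ‖w x‖ ≤ 1)
    (v : ℤ → Fin (K + 1) → ℝ)
    (hsep : ∀ m ∈ Finset.Icc (1:ℤ) M, ∀ m' ∈ Finset.Icc (1:ℤ) M, m ≠ m' → ∀ n : ℤ,
      (1:ℝ) / M ^ (K + 1) ≤ |v m (Fin.last K) - v m' (Fin.last K) - n|) :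
    ∑ m ∈ Finset.Icc (1:ℤ) M, ‖∑ x ∈ Finset.Icc (1:ℤ) M, w x * ee (∑ j, v m j * x ^ ((j:ℕ) + 1))‖ ^ (2 * s) ≤
      (∏ j : Fin K, ((s * M ^ ((j:ℕ) + 1) : ℕ) : ℝ)) * (Real.exp (4 * Real.pi) * ((s * M ^ (K + 1) : ℕ) * JJ s (K + 1) M)) := by
  classical
  set P := Fintype.piFinset (fun _ : Fin s => Finset.Icc (1:ℤ) M) with hP
  set Bx := Fintype.piFinset (fun j : Fin K => Finset.Icc (1:ℤ) ((s * M ^ ((j:ℕ) + 1) : ℕ) : ℤ)) with hBx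
  set L := s * M ^ (K + 1) with hL
  set W : (Fin s → ℤ) → ℂ := fun X => ∏ a, w (X a) with hW
  have hWn : ∀ X, ‖W X‖ ≤ 1 := fun X => by
    rw [hW]; simp only [norm_prod]
    exact Finset.prod_le_one (fun _ _ => norm_nonneg _) (fun _ _ => hw _)
  set A : (Fin K → ℤ) → ℤ → ℂ := fun n' n => ∑ X ∈ P,
    if (fun j : Fin K => mom X j) = n' then (if mom X K = n then W X else 0) else 0 with hA
  have hG : ∀ m, (∑ x ∈ Finset.Icc (1:ℤ) M, w x * ee (∑ j, v m j * x ^ ((j:ℕ) + 1))) ^ s =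
      ∑ n' ∈ Bx, ee (∑ j : Fin K, v m j.castSucc * n' j) * ∑ n ∈ Finset.Icc (1:ℤ) L, A n' n * ee (v m (Fin.last K) * n) := by
    intro m
    have h1 := Finset.prod_univ_sum (fun _ : Fin s => Finset.Icc (1:ℤ) M)
      (fun _ (x:ℤ) => w x * ee (∑ j, v m j * x ^ ((j:ℕ) + 1)))
    rw [Finset.prod_const, Finset.card_univ, Fintype.card_fin] at h1
    rw [h1]
    simp only [hA, Finset.sum_mul, Finset.mul_sum]
    have h2 : ∀ n' ∈ Bx, ∑ n ∈ Finset.Icc (1:ℤ) L, ∑ X ∈ P, ee (∑ j : Fin K, v m j.castSucc * n' j) *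
        ((if (fun j : Fin K => mom X j) = n' then (if mom X K = n then W X else 0) else 0) * ee (v m (Fin.last K) * n)) =
        ∑ X ∈ P, ∑ n ∈ Finset.Icc (1:ℤ) L, ee (∑ j : Fin K, v m j.castSucc * n' j) *
        ((if (fun j : Fin K => mom X j) = n' then (if mom X K = n then W X else 0) else 0) * ee (v m (Fin.last K) * n)) :=
      fun n' _ => Finset.sum_comm
    rw [Finset.sum_congr rfl h2, Finset.sum_comm]
    refine Finset.sum_congr rfl fun X hX => ?_
    have hm1 : (fun j : Fin K => mom X j) ∈ Bx := by
      rw [hBx, Fintype.mem_piFinset]; exact fun j => mom_mem hs hX j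
    have hm2 : mom X K ∈ Finset.Icc (1:ℤ) L := mom_mem hs hX K
    rw [Finset.sum_eq_single_of_mem _ hm1 (fun n' _ hne => by
        refine Finset.sum_eq_zero fun n _ => ?_
        rw [if_neg (Ne.symm hne)]; simp)]
    rw [Finset.sum_eq_single_of_mem _ hm2 (fun n _ hne => by
        rw [if_pos rfl, if_neg (Ne.symm hne)]; simp)]
    rw [if_pos rfl, if_pos rfl, Finset.prod_mul_distrib, ← ee_sum]
    have : ∑ a, ∑ j, v m j * (X a:ℝ) ^ ((j:ℕ) + 1) = ∑ j : Fin K, v m j.castSucc * (mom X j : ℝ) + v m (Fin.last K) * (mom X K : ℝ) := by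
      rw [Finset.sum_comm, Fin.sum_univ_castSucc]
      simp only [mom, Int.cast_sum, Int.cast_pow, Finset.mul_sum, Fin.val_castSucc, Fin.val_last]
    rw [this, ee_add]
    simp only [hW]
    ring
  have hcs : ∀ m, ‖∑ x ∈ Finset.Icc (1:ℤ) M, w x * ee (∑ j, v m j * x ^ ((j:ℕ) + 1))‖ ^ (2 * s) ≤
      (Bx.card : ℝ) * ∑ n' ∈ Bx, ‖∑ n ∈ Finset.Icc (1:ℤ) L, A n' n * ee (v m (Fin.last K) * n)‖ ^ 2 := by
    intro m
    rw [mul_comm 2 s, pow_mul, ← norm_pow, hG]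
    refine (pow_le_pow_left₀ (norm_nonneg _) (norm_sum_le _ _) 2).trans ?_
    simp only [norm_mul, norm_ee, one_mul]
    exact sq_sum_le_card_mul_sum_sq
  refine (Finset.sum_le_sum fun m _ => hcs m).trans ?_
  rw [← Finset.mul_sum, Finset.sum_comm]
  have hcard : (Bx.card : ℝ) = ∏ j : Fin K, ((s * M ^ ((j:ℕ) + 1) : ℕ) : ℝ) := by
    rw [hBx, Fintype.card_piFinset, Nat.cast_prod]
    refine Finset.prod_congr rfl fun j _ => ?_
    rw [Int.card_Icc, add_sub_cancel_right, Int.toNat_natCast]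
  rw [hcard]
  refine mul_le_mul_of_nonneg_left ?_ (Finset.prod_nonneg fun _ _ => Nat.cast_nonneg _)
  have hL1 : 1 ≤ L := by rw [hL]; exact Nat.one_le_iff_ne_zero.2 (by positivity)
  have hLS : ∀ n' ∈ Bx, ∑ m ∈ Finset.Icc (1:ℤ) M, ‖∑ n ∈ Finset.Icc (1:ℤ) L, A n' n * ee (v m (Fin.last K) * n)‖ ^ 2 ≤
      Real.exp (4 * Real.pi) * (L * ∑ n ∈ Finset.Icc (1:ℤ) L, ‖A n' n‖ ^ 2) := by
    intro n' _
    refine large_sieve L hL1 _ (fun m => v m (Fin.last K)) (fun m hm m' hm' hne n => ?_) (A n')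
    refine le_trans ?_ (hsep m hm m' hm' hne n)
    have hM0 : (0:ℝ) < M := by exact_mod_cast hM
    apply one_div_le_one_div_of_le (by positivity)
    rw [hL]; push_cast
    exact le_mul_of_one_le_left (by positivity) (by exact_mod_cast hs)
  refine (Finset.sum_le_sum hLS).trans ?_
  rw [← Finset.mul_sum, ← Finset.mul_sum]
  refine mul_le_mul_of_nonneg_left (mul_le_mul_of_nonneg_left ?_ (Nat.cast_nonneg _)) (Real.exp_pos _).le
  -- count
  set R : (Fin K → ℤ) → ℤ → ℝ := fun n' n => ∑ X ∈ P,
    if (fun j : Fin K => mom X j) = n' then (if mom X K = n then (1:ℝ) else 0) else 0 with hR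
  have hAR : ∀ n' n, ‖A n' n‖ ≤ R n' n := by
    intro n' n
    refine (norm_sum_le _ _).trans (Finset.sum_le_sum fun X _ => ?_)
    split_ifs
    · exact hWn X
    · simp
    · simp
  calc ∑ n' ∈ Bx, ∑ n ∈ Finset.Icc (1:ℤ) L, ‖A n' n‖ ^ 2 ≤ ∑ n' ∈ Bx, ∑ n ∈ Finset.Icc (1:ℤ) L, R n' n * R n' n := by
        refine Finset.sum_le_sum fun n' _ => Finset.sum_le_sum fun n _ => ?_
        rw [sq]
        exact mul_le_mul (hAR _ _) (hAR _ _) (norm_nonneg _) ((norm_nonneg _).trans (hAR _ _))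
    _ = ∑ X ∈ P, ∑ n' ∈ Bx, ∑ n ∈ Finset.Icc (1:ℤ) L,
          (if (fun j : Fin K => mom X j) = n' then (if mom X K = n then (1:ℝ) else 0) else 0) * R n' n := by
        have h1 : ∀ n' ∈ Bx, ∑ n ∈ Finset.Icc (1:ℤ) L, R n' n * R n' n = ∑ X ∈ P, ∑ n ∈ Finset.Icc (1:ℤ) L,
          (if (fun j : Fin K => mom X j) = n' then (if mom X K = n then (1:ℝ) else 0) else 0) * R n' n := by
          intro n' _
          rw [Finset.sum_comm]
          refine Finset.sum_congr rfl fun n _ => ?_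
          rw [← Finset.sum_mul]
        rw [Finset.sum_congr rfl h1, Finset.sum_comm]
    _ = ∑ X ∈ P, R (fun j : Fin K => mom X j) (mom X K) := by
        refine Finset.sum_congr rfl fun X hX => ?_
        have hm1 : (fun j : Fin K => mom X j) ∈ Bx := by
          rw [hBx, Fintype.mem_piFinset]; exact fun j => mom_mem hs hX j
        have hm2 : mom X K ∈ Finset.Icc (1:ℤ) L := mom_mem hs hX K
        rw [Finset.sum_eq_single_of_mem _ hm1 (fun n' _ hne => by
            refine Finset.sum_eq_zero fun n _ => ?_
            rw [if_neg (Ne.symm hne)]; simp)]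
        rw [Finset.sum_eq_single_of_mem _ hm2 (fun n _ hne => by
            rw [if_pos rfl, if_neg (Ne.symm hne)]; simp)]
        rw [if_pos rfl, if_pos rfl, one_mul]
    _ ≤ JJ s (K + 1) M := by
        rw [JJ]
        refine Finset.sum_le_sum fun X _ => Finset.sum_le_sum fun Y _ => ?_
        by_cases h1 : (fun j : Fin K => mom Y j) = (fun j : Fin K => mom X j)
        · by_cases h2 : mom Y K = mom X K
          · rw [if_pos h1, if_pos h2, if_pos]
            intro j
            refine Fin.lastCases ?_ (fun i => ?_) j
            · exact h2.symm
            · exact (congrFun h1 i).symm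
          · rw [if_pos h1, if_neg h2]; split_ifs <;> norm_num
        · rw [if_neg h1]; split_ifs <;> norm_num

lemma tri_succ (K : ℕ) : tri (K + 1) = tri K + (K + 1) := by
  have e : (K + 1) * (K + 1 + 1) = K * (K + 1) + 2 * (K + 1) := by ring
  rw [tri, tri, e, Nat.add_mul_div_left _ _ (by norm_num)]

lemma prod_tri (K s M : ℕ) : (∏ j : Fin K, ((s * M ^ ((j:ℕ) + 1) : ℕ) : ℝ)) = (s:ℝ) ^ K * (M:ℝ) ^ tri K := by
  induction K with
  | zero => simp [tri]
  | succ K ih =>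
    rw [Fin.prod_univ_castSucc]
    simp only [Fin.val_castSucc, Fin.val_last]
    rw [ih, tri_succ]; push_cast; ring

lemma hold_aux2 (r M : ℕ) (g : ℤ → ℝ) (hg : ∀ m, 0 ≤ g m) :
    (∑ m ∈ Finset.Icc (1:ℤ) M, g m) ^ (r + 1) ≤
      (M:ℝ) ^ r * ∑ m ∈ Finset.Icc (1:ℤ) M, g m ^ (r + 1) := by
  rcases Nat.eq_zero_or_pos M with rfl | hM
  · simp
  have h := pow_sum_div_card_le_sum_pow (s := Finset.Icc (1:ℤ) M) (f := g) (fun i _ => hg i) r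
  have hc : (Finset.Icc (1:ℤ) M).card = M := by simp
  have hM0 : (0:ℝ) < M := by exact_mod_cast hM
  rw [hc, div_le_iff₀ (by positivity)] at h
  linarith

lemma hold_aux {r : ℕ} (M : ℕ) (g : ℤ → ℝ) (hg : ∀ m, 0 ≤ g m) :
    M * (∑ m ∈ Finset.Icc (1:ℤ) M, g m) ^ (r + 1) ≤
      (M:ℝ) ^ (r + 1) * ∑ m ∈ Finset.Icc (1:ℤ) M, g m ^ (r + 1) := by
  have h := hold_aux2 r M g hg
  rw [pow_succ (M:ℝ), mul_comm ((M:ℝ) ^ r), mul_assoc]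
  exact mul_le_mul_of_nonneg_left h (Nat.cast_nonneg _)

/-- the Weyl type estimate -/
theorem weyl (k : ℕ) (hk : 2 ≤ k) (e : ℝ) (he : 0 < e) : ∃ C : ℝ, 1 ≤ C ∧ ∀ (M : ℕ), 1 ≤ M → ∀ a b : ℝ,
    (∀ d : ℕ, 1 ≤ d → d < M → ∀ n : ℤ, (1:ℝ) / M ^ (k - 1) ≤ |k * a * d - n|) →
    M * ‖∑ m ∈ Finset.Icc (1:ℤ) M, ∑ x ∈ Finset.Icc (1:ℤ) M, ee (a * (m + x) ^ k + b * (m + x))‖ ^ (2 * tri (k - 1)) ≤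
      C * (M:ℝ) ^ (4 * (tri (k - 1) : ℝ) + e) := by
  obtain ⟨K, rfl⟩ : ∃ K, k = K + 2 := ⟨k - 2, by omega⟩
  have hk1 : K + 2 - 1 = K + 1 := by omega
  rw [hk1]
  obtain ⟨C, hC, hV⟩ := vmvt (K + 1) (by omega) e he
  set s := tri (K + 1) with hs
  have hs1 : 1 ≤ s := tri_pos (by omega)
  have hsR : (1:ℝ) ≤ s := by exact_mod_cast hs1
  refine ⟨(s:ℝ) ^ (K + 1) * Real.exp (4 * Real.pi) * C, ?_, fun M hM a b hd => ?_⟩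
  · have h1 := one_le_pow₀ hsR (n := K + 1)
    have h2 : 1 ≤ Real.exp (4 * Real.pi) := Real.one_le_exp (by have := Real.pi_pos; positivity)
    exact one_le_mul_of_one_le_of_one_le (one_le_mul_of_one_le_of_one_le h1 h2) hC
  have hM0 : (0:ℝ) < M := by exact_mod_cast hM
  set v : ℤ → Fin (K + 1) → ℝ := fun m j => a * ((K + 2).choose ((j:ℕ) + 1)) * (m:ℝ) ^ (K + 1 - j) + (if (j:ℕ) = 0 then b else 0) with hv
  set w : ℤ → ℂ := fun x => ee (a * x ^ (K + 2)) with hw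
  have hexp : ∀ m x : ℤ, ee (a * ((m:ℝ) + x) ^ (K + 2) + b * (m + x)) = ee (a * m ^ (K + 2) + b * m) * (w x * ee (∑ j, v m j * x ^ ((j:ℕ) + 1))) := by
    intro m x
    rw [hw]
    simp only
    rw [← ee_add, ← ee_add]
    congr 1
    rw [add_comm (m:ℝ) x, add_pow, Finset.sum_range_succ, Finset.sum_range_succ']
    have : ∑ j, v m j * (x:ℝ) ^ ((j:ℕ) + 1) = a * ∑ j ∈ Finset.range (K + 1), (x:ℝ) ^ (j + 1) * (m:ℝ) ^ (K + 2 - (j + 1)) * ((K + 2).choose (j + 1)) + b * x := by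
      simp only [hv, add_mul, Finset.sum_add_distrib]
      congr 1
      · rw [Finset.mul_sum, Finset.sum_range]
        refine Finset.sum_congr rfl fun j _ => ?_
        have : K + 2 - ((j:ℕ) + 1) = K + 1 - j := by omega
        rw [this]; ring
      · rw [Finset.sum_eq_single_of_mem (0 : Fin (K + 1)) (Finset.mem_univ _)]
        · simp
        · intro j _ hj
          rw [if_neg (fun h => hj (Fin.ext (by simpa using h)))]; simp
    rw [this]
    simp
    ring
  have hsep : ∀ m ∈ Finset.Icc (1:ℤ) M, ∀ m' ∈ Finset.Icc (1:ℤ) M, m ≠ m' → ∀ n : ℤ,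
      (1:ℝ) / M ^ (K + 1) ≤ |v m (Fin.last K) - v m' (Fin.last K) - n| := by
    have hvl : ∀ m m' : ℤ, v m (Fin.last K) - v m' (Fin.last K) = ((K + 2 : ℕ):ℝ) * a * (m - m') := by
      intro m m'
      simp only [hv, Fin.val_last]
      have : (K + 2).choose (K + 1) = K + 2 := by
        rw [Nat.choose_symm_of_eq_add (b := 1) (by omega)]; simp
      rw [this]
      have : K + 1 - K = 1 := by omega
      rw [this]; ring
    intro m hm m' hm' hne n
    rw [Finset.mem_Icc] at hm hm'
    rw [hvl]
    rcases lt_or_gt_of_ne hne with h | h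
    · have h1 := hd (m' - m).toNat (by omega) (by omega) (-n)
      have h2 : (((m' - m).toNat : ℕ) : ℝ) = (m':ℝ) - m := by
        have : (((m' - m).toNat : ℕ) : ℤ) = m' - m := Int.toNat_of_nonneg (by omega)
        exact_mod_cast this
      rw [h2] at h1
      refine h1.trans (le_of_eq ?_)
      rw [← abs_neg]; congr 1; push_cast; ring
    · have h1 := hd (m - m').toNat (by omega) (by omega) n
      have h2 : (((m - m').toNat : ℕ) : ℝ) = (m:ℝ) - m' := by
        have : (((m - m').toNat : ℕ) : ℤ) = m - m' := Int.toNat_of_nonneg (by omega)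
        exact_mod_cast this
      rw [h2] at h1
      exact h1
  have hW := weyl_abs K s M hs1 hM w (fun x => by rw [hw]; simp only [norm_ee]; exact le_rfl) v hsep
  rw [prod_tri] at hW
  have hJ := hV M hM
  have hT : ‖∑ m ∈ Finset.Icc (1:ℤ) M, ∑ x ∈ Finset.Icc (1:ℤ) M, ee (a * ((m:ℝ) + x) ^ (K + 2) + b * (m + x))‖ ≤
      ∑ m ∈ Finset.Icc (1:ℤ) M, ‖∑ x ∈ Finset.Icc (1:ℤ) M, w x * ee (∑ j, v m j * x ^ ((j:ℕ) + 1))‖ := by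
    refine (norm_sum_le _ _).trans (le_of_eq ?_)
    refine Finset.sum_congr rfl fun m _ => ?_
    simp_rw [hexp, ← Finset.mul_sum]
    rw [norm_mul, norm_ee, one_mul]
  set g : ℤ → ℝ := fun m => ‖∑ x ∈ Finset.Icc (1:ℤ) M, w x * ee (∑ j, v m j * x ^ ((j:ℕ) + 1))‖ with hg
  have hpow : M * (∑ m ∈ Finset.Icc (1:ℤ) M, g m) ^ (2 * s) ≤ (M:ℝ) ^ (2 * s) * ∑ m ∈ Finset.Icc (1:ℤ) M, g m ^ (2 * s) := by
    obtain ⟨r, hr⟩ : ∃ r, 2 * s = r + 1 := ⟨2 * s - 1, by omega⟩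
    have := hold_aux (r := r) M g (fun m => norm_nonneg _)
    rw [hr]; exact this
  have hps : (M:ℝ) ^ (4 * (s:ℝ) + e) = (M:ℝ) ^ (2 * s) * ((M:ℝ) ^ s) * ((M:ℝ) ^ ((s:ℝ) + e)) := by
    rw [← Real.rpow_natCast, ← Real.rpow_natCast, ← Real.rpow_add hM0, ← Real.rpow_add hM0]
    congr 1; push_cast; ring
  have hMs : (M:ℝ) ^ s = (M:ℝ) ^ tri K * (M:ℝ) ^ (K + 1) := by rw [← pow_add, ← tri_succ]
  calc _ ≤ (M:ℝ) * (∑ m ∈ Finset.Icc (1:ℤ) M, g m) ^ (2 * s) := by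
        refine mul_le_mul_of_nonneg_left (pow_le_pow_left₀ (norm_nonneg _) hT _) hM0.le
    _ ≤ (M:ℝ) ^ (2 * s) * ∑ m ∈ Finset.Icc (1:ℤ) M, g m ^ (2 * s) := hpow
    _ ≤ (M:ℝ) ^ (2 * s) * (((s:ℝ) ^ K * (M:ℝ) ^ tri K) * (Real.exp (4 * Real.pi) * ((s * M ^ (K + 1) : ℕ) * (C * (M:ℝ) ^ ((s:ℝ) + e))))) := by
        refine mul_le_mul_of_nonneg_left (hW.trans ?_) (by positivity)
        gcongr
    _ = _ := by rw [hps, hMs]; push_cast; ring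

end VM

open Finset Polynomial

namespace VM

lemma ee_neg (x : ℝ) : ee (-x) = (starRingEnd ℂ) (ee x) := by
  rw [ee, ee, ← Complex.exp_conj]
  congr 1
  simp only [map_mul, Complex.conj_ofReal, Complex.conj_I, map_ofNat]
  push_cast; ring

lemma norm_ee_sub_one (θ : ℝ) : 4 * |θ - round θ| ≤ ‖ee θ - 1‖ := by
  have h0 : ee θ = ee (θ - round θ) := by
    have := ee_add_int (θ - round θ) (round θ)
    rw [← this]; congr 1; ring
  rw [h0]
  set x := θ - round θ with hx
  have hx1 : |x| ≤ 1 / 2 := abs_sub_round θ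
  have h1 : ee x = Complex.exp (Complex.I * ((2 * Real.pi * x : ℝ) : ℂ)) := by
    rw [ee]; congr 1; push_cast; ring
  rw [h1, Complex.norm_exp_I_mul_ofReal_sub_one]
  have hpi := Real.pi_pos
  have h2 : 2 * Real.pi * x / 2 = Real.pi * x := by ring
  rw [h2, norm_mul, Real.norm_eq_abs, Real.norm_eq_abs]
  have h3 := Real.mul_le_sin (x := Real.pi * |x|) (by positivity) (by nlinarith)
  have h4 : 2 / Real.pi * (Real.pi * |x|) = 2 * |x| := by field_simp
  rw [h4] at h3
  have h5 : |Real.sin (Real.pi * x)| = |Real.sin (Real.pi * |x|)| := by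
    rcases abs_cases x with ⟨h, _⟩ | ⟨h, _⟩
    · rw [h]
    · rw [h, mul_neg, Real.sin_neg, abs_neg]
  rw [h5, abs_of_nonneg (le_trans (by positivity) h3)]
  norm_num
  linarith

lemma ee_nat_mul (θ : ℝ) (l : ℕ) : ee (l * θ) = ee θ ^ l := by
  induction l with
  | zero => simp [ee_zero]
  | succ l ih => rw [pow_succ, ← ih, ← ee_add]; congr 1; push_cast; ring

lemma dirichlet_bound (L : ℕ) (θ Δ : ℝ) (hΔ : 0 < Δ) (h : Δ ≤ |θ - round θ|) :
    ‖∑ l ∈ Finset.range L, ee (l * θ)‖ ≤ 1 / (2 * Δ) := by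
  simp_rw [ee_nat_mul]
  have h1 := geom_sum_mul (ee θ) L
  have h2 : ‖∑ l ∈ Finset.range L, ee θ ^ l‖ * ‖ee θ - 1‖ ≤ 2 := by
    rw [← norm_mul, h1]
    refine (norm_sub_le _ _).trans ?_
    rw [norm_pow, norm_ee]; norm_num
  have h3 := norm_ee_sub_one θ
  rw [le_div_iff₀ (by positivity)]
  have h4 : ‖∑ l ∈ Finset.range L, ee θ ^ l‖ * (4 * Δ) ≤ 2 := by
    refine le_trans (mul_le_mul_of_nonneg_left ?_ (norm_nonneg _)) h2
    linarith
  linarith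

lemma kernel_exp (L m : ℕ) (θ : ℝ) : (((‖∑ l ∈ Finset.range L, ee (l * θ)‖ ^ (2 * m) : ℝ)) : ℂ) =
    ∑ x ∈ Fintype.piFinset (fun _ : Fin m => Finset.range L), ∑ y ∈ Fintype.piFinset (fun _ : Fin m => Finset.range L),
      ee ((((∑ a, x a : ℕ) : ℝ) - ((∑ a, y a : ℕ) : ℝ)) * θ) := by
  have h0 : (∑ l ∈ Finset.range L, ee (l * θ)) ^ m =
      ∑ x ∈ Fintype.piFinset (fun _ : Fin m => Finset.range L), ee (((∑ a, x a : ℕ) : ℝ) * θ) := by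
    have := Finset.prod_univ_sum (fun _ : Fin m => Finset.range L) (fun _ (l:ℕ) => ee (l * θ))
    rw [Finset.prod_const, Finset.card_univ, Fintype.card_fin] at this
    rw [this]
    refine Finset.sum_congr rfl fun x _ => ?_
    rw [← ee_sum]
    congr 1
    push_cast
    rw [Finset.sum_mul]
  rw [pow_mul]
  push_cast
  rw [← Complex.mul_conj', mul_pow, ← map_pow, h0, map_sum, Finset.sum_mul_sum]
  refine Finset.sum_congr rfl fun x _ => Finset.sum_congr rfl fun y _ => ?_
  rw [← ee_neg, ← ee_add]
  congr 1; push_cast; ring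

lemma diag_count (L m : ℕ) (hL : 1 ≤ L) (hm : 1 ≤ m) : (L:ℝ) ^ (2 * m) ≤ (m * L) *
    ∑ x ∈ Fintype.piFinset (fun _ : Fin m => Finset.range L), ∑ y ∈ Fintype.piFinset (fun _ : Fin m => Finset.range L),
      if (∑ a, x a = ∑ a, y a) then (1:ℝ) else 0 := by
  classical
  set P := Fintype.piFinset (fun _ : Fin m => Finset.range L) with hP
  set r : ℕ → ℝ := fun n => ∑ x ∈ P, if (∑ a, x a = n) then (1:ℝ) else 0 with hr
  have hmem : ∀ x ∈ P, ∑ a, x a ∈ Finset.range (m * L) := by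
    intro x hx
    have h : ∀ a, x a < L := fun a => by simpa using (Fintype.mem_piFinset.1 hx) a
    rw [Finset.mem_range]
    have h1 : ∑ a, x a < ∑ a : Fin m, L := by
      apply Finset.sum_lt_sum_of_nonempty
      · exact ⟨⟨0, hm⟩, Finset.mem_univ _⟩
      · exact fun a _ => h a
    simpa using h1
  have h1 : ∑ n ∈ Finset.range (m * L), r n = (L:ℝ) ^ m := by
    rw [hr]; simp only
    rw [Finset.sum_comm]
    have : ∀ x ∈ P, ∑ n ∈ Finset.range (m * L), (if (∑ a, x a = n) then (1:ℝ) else 0) = 1 := by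
      intro x hx
      rw [Finset.sum_ite_eq, if_pos (hmem x hx)]
    rw [Finset.sum_congr rfl this]
    simp [hP, Fintype.card_piFinset]
  have h2 : ∑ n ∈ Finset.range (m * L), r n ^ 2 = ∑ x ∈ P, ∑ y ∈ P, if (∑ a, x a = ∑ a, y a) then (1:ℝ) else 0 := by
    have : ∀ n ∈ Finset.range (m * L), r n ^ 2 = ∑ x ∈ P, (if (∑ a, x a = n) then r n else 0) := by
      intro n _
      rw [sq, hr]; simp only
      rw [Finset.sum_mul]
      refine Finset.sum_congr rfl fun x _ => ?_
      split_ifs <;> simp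
    rw [Finset.sum_congr rfl this, Finset.sum_comm]
    refine Finset.sum_congr rfl fun x hx => ?_
    rw [Finset.sum_ite_eq, if_pos (hmem x hx), hr]
    simp only
    refine Finset.sum_congr rfl fun y _ => ?_
    simp only [eq_comm]
  rw [← h2, mul_comm 2 m, pow_mul, ← h1]
  have := sq_sum_le_card_mul_sum_sq (s := Finset.range (m * L)) (f := r)
  simpa using this

lemma fejer {ι : Type*} (I : Finset ι) (hI : I.Nonempty) (θ : ι → ℝ) (L m : ℕ) (hL : 1 ≤ L) (hm : 1 ≤ m)
    (Δ : ℝ) (hΔ : 0 < Δ) (h1 : 2 * m * L < (2 * L * Δ) ^ (2 * m))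
    (hS : ∀ h : ℕ, 1 ≤ h → h ≤ m * L → ‖∑ i ∈ I, ee (h * θ i)‖ ≤ I.card / (2 * m * L)) :
    ∃ i ∈ I, |θ i - round (θ i)| ≤ Δ := by
  classical
  by_contra hcon
  push Not at hcon
  set P := Fintype.piFinset (fun _ : Fin m => Finset.range L) with hP
  have hmR : (0:ℝ) < m := by exact_mod_cast hm
  have hLR : (0:ℝ) < L := by exact_mod_cast hL
  have hZ : (0:ℝ) < I.card := by exact_mod_cast hI.card_pos
  have hmem : ∀ x ∈ P, ∑ a, x a ≤ m * L := by
    intro x hx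
    have h : ∀ a, x a < L := fun a => by simpa using (Fintype.mem_piFinset.1 hx) a
    calc ∑ a, x a ≤ ∑ a : Fin m, L := Finset.sum_le_sum fun a _ => (h a).le
      _ = _ := by simp
  have hup : ∑ i ∈ I, ‖∑ l ∈ Finset.range L, ee (l * θ i)‖ ^ (2 * m) ≤ I.card * (1 / (2 * Δ)) ^ (2 * m) := by
    rw [← nsmul_eq_mul]
    refine Finset.sum_le_card_nsmul _ _ _ fun i hi => ?_
    exact pow_le_pow_left₀ (norm_nonneg _) (dirichlet_bound L _ Δ hΔ (hcon i hi).le) _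
  have hex : ∑ i ∈ I, ‖∑ l ∈ Finset.range L, ee (l * θ i)‖ ^ (2 * m) =
      ∑ x ∈ P, ∑ y ∈ P, (∑ i ∈ I, ee ((((∑ a, x a : ℕ) : ℝ) - ((∑ a, y a : ℕ) : ℝ)) * θ i)).re := by
    have e1 : ∀ i ∈ I, ‖∑ l ∈ Finset.range L, ee (l * θ i)‖ ^ (2 * m) =
        ∑ x ∈ P, ∑ y ∈ P, (ee ((((∑ a, x a : ℕ) : ℝ) - ((∑ a, y a : ℕ) : ℝ)) * θ i)).re := by
      intro i _
      have := congrArg Complex.re (kernel_exp L m (θ i))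
      rw [Complex.ofReal_re] at this
      rw [this]
      simp only [Complex.re_sum]
      rfl
    rw [Finset.sum_congr rfl e1, Finset.sum_comm]
    refine Finset.sum_congr rfl fun x _ => ?_
    rw [Finset.sum_comm]
    refine Finset.sum_congr rfl fun y _ => ?_
    rw [Complex.re_sum]
  have hlow : ∀ x ∈ P, ∀ y ∈ P, (I.card : ℝ) * (if (∑ a, x a = ∑ a, y a) then (1:ℝ) else 0) - I.card / (2 * m * L) ≤
      (∑ i ∈ I, ee ((((∑ a, x a : ℕ) : ℝ) - ((∑ a, y a : ℕ) : ℝ)) * θ i)).re := by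
    intro x hx y hy
    have hx' := hmem x hx
    have hy' := hmem y hy
    have hpos : 0 ≤ (I.card:ℝ) / (2 * m * L) := by positivity
    rcases lt_trichotomy (∑ a, x a) (∑ a, y a) with h | h | h
    · rw [if_neg h.ne, mul_zero, zero_sub]
      have e1 : ∑ i ∈ I, ee ((((∑ a, x a : ℕ) : ℝ) - ((∑ a, y a : ℕ) : ℝ)) * θ i) =
          (starRingEnd ℂ) (∑ i ∈ I, ee (((∑ a, y a - ∑ a, x a : ℕ) : ℝ) * θ i)) := by
        rw [map_sum]
        refine Finset.sum_congr rfl fun i _ => ?_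
        rw [← ee_neg, Nat.cast_sub h.le]; congr 1; ring
      rw [e1, Complex.conj_re]
      have h2 := hS (∑ a, y a - ∑ a, x a) (by omega) (by omega)
      have h3 := Complex.abs_re_le_norm (∑ i ∈ I, ee (((∑ a, y a - ∑ a, x a : ℕ) : ℝ) * θ i))
      rw [abs_le] at h3
      linarith
    · rw [if_pos h, h]
      simp [ee_zero]
      positivity
    · rw [if_neg h.ne', mul_zero, zero_sub]
      have h2 := hS (∑ a, x a - ∑ a, y a) (by omega) (by omega)
      rw [Nat.cast_sub h.le] at h2
      have h3 := Complex.abs_re_le_norm (∑ i ∈ I, ee ((((∑ a, x a : ℕ) : ℝ) - ((∑ a, y a : ℕ) : ℝ)) * θ i))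
      rw [abs_le] at h3
      linarith
  have hlow2 := Finset.sum_le_sum fun x hx => Finset.sum_le_sum fun y hy => hlow x hx y hy
  rw [← hex] at hlow2
  simp only [Finset.sum_sub_distrib, ← Finset.mul_sum, Finset.sum_const, nsmul_eq_mul] at hlow2
  have hcard : (P.card : ℝ) = (L:ℝ) ^ m := by simp [hP, Fintype.card_piFinset]
  rw [hcard] at hlow2
  have hd := diag_count L m hL hm
  rw [← hP] at hd
  set D := ∑ x ∈ P, ∑ y ∈ P, (if (∑ a, x a = ∑ a, y a) then (1:ℝ) else 0) with hD
  have h5 := hlow2.trans hup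
  have hp2 : (L:ℝ) ^ (2 * m) = (L:ℝ) ^ m * (L:ℝ) ^ m := by rw [two_mul, pow_add]
  have h6 : (I.card:ℝ) * D ≥ I.card * ((L:ℝ) ^ (2 * m) / (m * L)) := by
    refine mul_le_mul_of_nonneg_left ?_ hZ.le
    rw [div_le_iff₀ (by positivity)]; linarith
  have h7 : (I.card:ℝ) * ((L:ℝ) ^ (2 * m) / (2 * m * L)) ≤ I.card * (1 / (2 * Δ)) ^ (2 * m) := by
    have e1 : (I.card:ℝ) * ((L:ℝ) ^ (2 * m) / (m * L)) - (L:ℝ) ^ m * ((L:ℝ) ^ m * (I.card / (2 * m * L))) =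
       (I.card:ℝ) * ((L:ℝ) ^ (2 * m) / (2 * m * L)) := by
      rw [hp2]; field_simp; ring
    linarith
  have h8 := le_of_mul_le_mul_left h7 hZ
  rw [div_pow, one_pow, div_le_div_iff₀ (by positivity) (by positivity)] at h8
  have h9 : (2 * L * Δ) ^ (2 * m) = (L:ℝ) ^ (2 * m) * (2 * Δ) ^ (2 * m) := by rw [← mul_pow]; congr 1; ring
  rw [h9] at h1
  linarith

end VM

open Finset Polynomial

namespace VM

/-- complete exponential sum -/
noncomputable def Sq (k q : ℕ) (A b : ℤ) : ℂ := ∑ y ∈ Finset.range q, ee ((A * y ^ k + b * y) / q)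

lemma sum_range_zmod (p : ℕ) [NeZero p] (F : ZMod p → ℂ) :
    ∑ y ∈ Finset.range p, F (y : ZMod p) = ∑ y : ZMod p, F y := by
  refine Finset.sum_nbij' (fun y => (y : ZMod p)) ZMod.val ?_ ?_ ?_ ?_ ?_
  · simp
  · intro a _; rw [Finset.mem_range]; exact ZMod.val_lt a
  · intro a ha; exact ZMod.val_cast_of_lt (Finset.mem_range.1 ha)
  · intro a _; simp
  · simp

lemma std_int (p : ℕ) [NeZero p] (n : ℤ) : (ZMod.stdAddChar (n : ZMod p) : ℂ) = ee (n / p) := by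
  rw [ZMod.stdAddChar_coe, ee]
  congr 1; push_cast; ring

lemma Sq_zmod (k p : ℕ) [NeZero p] (A b : ℤ) :
    Sq k p A b = ∑ y : ZMod p, (ZMod.stdAddChar ((A : ZMod p) * y ^ k + (b : ZMod p) * y) : ℂ) := by
  rw [← sum_range_zmod, Sq]
  refine Finset.sum_congr rfl fun y _ => ?_
  have := std_int p (A * y ^ k + b * y)
  push_cast at this
  rw [this]

lemma count_fix (k p : ℕ) [Fact p.Prime] (hk : 2 ≤ k) (hp : k < p) (u w : ZMod p) (hu : u ≠ 0) :
    ((Finset.univ : Finset (Fin 2 → ZMod p)).filter (fun x => x 0 + x 1 = u ∧ x 0 ^ k + x 1 ^ k = w)).card ≤ k := by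
  classical
  set P : (ZMod p)[X] := X ^ k + (C u - X) ^ k - C w with hP
  have hP0 : P ≠ 0 := by
    intro h0
    have h1 := congrArg (fun Q => (derivative Q).eval 0) h0
    simp only [hP, derivative_sub, derivative_add, derivative_pow, derivative_X, derivative_C, eval_sub, eval_add, eval_mul, eval_pow, eval_X, eval_C, derivative_zero, eval_zero, mul_one, sub_zero, zero_sub, mul_neg, eval_neg] at h1
    rw [zero_pow (by omega), mul_zero, zero_add, neg_eq_zero, mul_eq_zero] at h1
    rcases h1 with h1 | h1
    · rw [ZMod.natCast_eq_zero_iff] at h1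
      exact absurd (Nat.le_of_dvd (by omega) h1) (by omega)
    · exact hu (pow_eq_zero_iff (by omega) |>.1 h1)
  have hdeg : P.natDegree ≤ k := by
    rw [hP]
    refine (natDegree_sub_le _ _).trans (max_le ((natDegree_add_le _ _).trans (max_le ?_ ?_)) ?_)
    · simp
    · refine natDegree_pow_le.trans ?_
      have : (C u - X : (ZMod p)[X]).natDegree ≤ 1 := (natDegree_sub_le _ _).trans (by simp)
      nlinarith
    · simp
  refine le_trans ?_ ((Multiset.toFinset_card_le _).trans ((card_roots' P).trans hdeg))
  refine Finset.card_le_card_of_injOn (fun x => x 0) ?_ ?_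
  · intro x hx
    simp only [Finset.coe_filter, Finset.mem_univ, true_and, Set.mem_ofPred_eq] at hx
    simp only [Finset.mem_coe, Multiset.mem_toFinset]
    rw [mem_roots hP0, IsRoot.def, hP]
    simp only [eval_sub, eval_add, eval_pow, eval_X, eval_C]
    have : u - x 0 = x 1 := by rw [← hx.1]; ring
    rw [this, hx.2, sub_self]
  · intro x hx y hy hxy
    simp only [Finset.coe_filter, Finset.mem_univ, true_and, Set.mem_ofPred_eq] at hx hy
    simp only at hxy
    ext j
    fin_cases j
    · exact hxy
    · have : x 1 = y 1 := by
        have := hx.1.trans hy.1.symm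
        rw [hxy] at this
        exact add_left_cancel this
      exact this

lemma count_zero (p : ℕ) [Fact p.Prime] :
    ((Finset.univ : Finset (Fin 2 → ZMod p)).filter (fun x => x 0 + x 1 = 0)).card ≤ p := by
  classical
  calc _ ≤ (Finset.univ : Finset (ZMod p)).card := by
        refine Finset.card_le_card_of_injOn (fun x => x 0) (fun _ _ => by simp) ?_
        intro x hx y hy hxy
        simp only [Finset.coe_filter, Finset.mem_univ, true_and, Set.mem_ofPred_eq] at hx hy
        simp only at hxy
        ext j
        fin_cases j
        · exact hxy
        · have : x 1 = y 1 := by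
            have := hx.trans hy.symm
            rw [hxy] at this
            exact add_left_cancel this
          exact this
    _ = p := by rw [Finset.card_univ, ZMod.card]

lemma count_J (k p : ℕ) [Fact p.Prime] (hk : 2 ≤ k) (hp : k < p) :
    ∑ y : Fin 2 → ZMod p, ∑ x : Fin 2 → ZMod p,
      (if (x 0 + x 1 = y 0 + y 1 ∧ x 0 ^ k + x 1 ^ k = y 0 ^ k + y 1 ^ k) then (1:ℝ) else 0) ≤ (k + 1) * p ^ 2 := by
  classical
  have h1 : ∀ y : Fin 2 → ZMod p, ∑ x : Fin 2 → ZMod p,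
      (if (x 0 + x 1 = y 0 + y 1 ∧ x 0 ^ k + x 1 ^ k = y 0 ^ k + y 1 ^ k) then (1:ℝ) else 0) ≤
      k + if y 0 + y 1 = 0 then (p:ℝ) else 0 := by
    intro y
    rw [Finset.sum_boole]
    split_ifs with h
    · have := count_zero p
      have h2 : ((Finset.univ : Finset (Fin 2 → ZMod p)).filter (fun x => x 0 + x 1 = y 0 + y 1 ∧ x 0 ^ k + x 1 ^ k = y 0 ^ k + y 1 ^ k)).card ≤ p := by
        refine (Finset.card_le_card ?_).trans this
        intro x hx
        simp only [Finset.mem_filter, Finset.mem_univ, true_and] at hx ⊢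
        rw [hx.1, h]
      have h3 : (((Finset.univ : Finset (Fin 2 → ZMod p)).filter (fun x => x 0 + x 1 = y 0 + y 1 ∧ x 0 ^ k + x 1 ^ k = y 0 ^ k + y 1 ^ k)).card : ℝ) ≤ p := by exact_mod_cast h2
      have : (0:ℝ) ≤ k := Nat.cast_nonneg _
      linarith
    · rw [add_zero]
      exact_mod_cast count_fix k p hk hp (y 0 + y 1) _ h
  refine (Finset.sum_le_sum fun y _ => h1 y).trans ?_
  rw [Finset.sum_add_distrib, Finset.sum_const, nsmul_eq_mul, ← Finset.sum_filter, Finset.sum_const, nsmul_eq_mul]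
  have h2 : (((Finset.univ : Finset (Fin 2 → ZMod p)).filter (fun x => x 0 + x 1 = 0)).card : ℝ) ≤ p := by exact_mod_cast count_zero p
  have h3 : ((Finset.univ : Finset (Fin 2 → ZMod p)).card : ℝ) = (p:ℝ) ^ 2 := by
    simp [ZMod.card]
  rw [h3]
  have : (0:ℝ) ≤ p := Nat.cast_nonneg _
  nlinarith

lemma fourth (k p : ℕ) [Fact p.Prime] (hk : 2 ≤ k) (hp : k < p) :
    ∑ t : Fin 2 → ZMod p, ‖∑ i : ZMod p, (ZMod.stdAddChar (t 1 * i ^ k + t 0 * i) : ℂ)‖ ^ 4 ≤ (k + 1) * (p:ℝ) ^ 4 := by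
  classical
  have h := moment_id p (fun (i : ZMod p) (j : Fin 2) => if j = 0 then i else i ^ k) Finset.univ 2
  have e1 : ∀ (t : Fin 2 → ZMod p) (i : ZMod p), ∑ j, t j * (if j = 0 then i else i ^ k) = t 1 * i ^ k + t 0 * i := by
    intro t i; rw [Fin.sum_univ_two]; simp; ring
  simp_rw [e1] at h
  norm_num at h
  rw [h]
  have h2 := count_J k p hk hp
  rw [Finset.sum_comm] at h2
  simp_rw [Finset.sum_boole] at h2
  calc _ ≤ (p:ℝ) ^ 2 * ((k + 1) * (p:ℝ) ^ 2) := by gcongr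
    _ = _ := by ring

lemma prime_bound0 (k p : ℕ) [Fact p.Prime] (hk : 2 ≤ k) (hp : k < p) (A b : ZMod p) (hA : A ≠ 0) :
    ((p:ℝ) - 1) * ‖∑ i : ZMod p, (ZMod.stdAddChar (A * i ^ k + b * i) : ℂ)‖ ^ 4 ≤ k * (k + 1) * (p:ℝ) ^ 4 := by
  classical
  set F : (Fin 2 → ZMod p) → ℝ := fun t => ‖∑ i : ZMod p, (ZMod.stdAddChar (t 1 * i ^ k + t 0 * i) : ℂ)‖ ^ 4 with hF
  have h4 : ∑ t, F t ≤ _ := fourth k p hk hp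
  set g : ZMod p → (Fin 2 → ZMod p) := fun c => ![b * c, A * c ^ k] with hg
  have hinv : ∀ c ∈ (Finset.univ.erase (0 : ZMod p)), F (g c) = ‖∑ i : ZMod p, (ZMod.stdAddChar (A * i ^ k + b * i) : ℂ)‖ ^ 4 := by
    intro c hc
    have hc0 : c ≠ 0 := Finset.ne_of_mem_erase hc
    simp only [hF, hg]
    congr 2
    refine Fintype.sum_bijective (fun i => c * i) (mulLeft_bijective₀ c hc0) _ _ ?_
    intro i
    congr 1
    simp
    ring
  have hcard : ((Finset.univ.erase (0 : ZMod p)).card : ℝ) = p - 1 := by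
    rw [Finset.card_erase_of_mem (Finset.mem_univ _), Finset.card_univ, ZMod.card, Nat.cast_sub (by omega)]
    simp
  have hs := Finset.sum_congr rfl hinv
  rw [Finset.sum_const, nsmul_eq_mul, hcard] at hs
  rw [← hs, Finset.sum_comp]
  have hfib : ∀ t : Fin 2 → ZMod p, ((Finset.univ.erase (0 : ZMod p)).filter (fun c => g c = t)).card ≤ k := by
    intro t
    refine le_trans (Finset.card_le_card ?_) ((Multiset.toFinset_card_le (nthRoots k (t 1 / A))).trans (card_nthRoots _ _))
    intro c hc
    have hc1 := congrFun (Finset.mem_filter.1 hc).2 1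
    simp only [hg, Matrix.cons_val_one, Matrix.cons_val_fin_one] at hc1
    rw [Multiset.mem_toFinset, mem_nthRoots (by omega), ← hc1]
    field_simp
  calc _ ≤ ∑ t ∈ (Finset.univ.erase (0 : ZMod p)).image g, (k:ℝ) * F t := by
        refine Finset.sum_le_sum fun t _ => ?_
        rw [nsmul_eq_mul]
        have : (0:ℝ) ≤ F t := by simp only [hF]; positivity
        exact mul_le_mul_of_nonneg_right (by exact_mod_cast hfib t) this
    _ ≤ ∑ t, (k:ℝ) * F t := Finset.sum_le_sum_of_subset_of_nonneg (Finset.subset_univ _) (fun t _ _ => by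
        have : (0:ℝ) ≤ F t := by simp only [hF]; positivity
        positivity)
    _ = k * ∑ t, F t := by rw [Finset.mul_sum]
    _ ≤ k * ((k + 1) * (p:ℝ) ^ 4) := by gcongr
    _ = _ := by ring

lemma norm_Sq_le (k q : ℕ) (A b : ℤ) : ‖Sq k q A b‖ ≤ q := by
  rw [Sq]
  refine (norm_sum_le _ _).trans ?_
  simp [norm_ee]

/-- threshold for primes -/
def pp0 (k : ℕ) : ℕ := (2 * k * (k + 1)) ^ 5

lemma prime_bound (k p : ℕ) (hpr : p.Prime) (hk : 2 ≤ k) (hp : pp0 k ≤ p) (A b : ℤ) :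
    ‖Sq k p A b‖ ^ 5 ≤ (p:ℝ) ^ 4 * ((A.gcd p : ℕ) : ℝ) ^ 5 := by
  have : Fact p.Prime := ⟨hpr⟩
  have hp1 : (1:ℝ) ≤ p := by exact_mod_cast hpr.one_lt.le
  by_cases hA : (A : ZMod p) = 0
  · have h1 : (p:ℤ) ∣ A := (ZMod.intCast_zmod_eq_zero_iff_dvd A p).1 hA
    have h2 : A.gcd p = p := by
      rw [Int.gcd_eq_natAbs]; exact Nat.gcd_eq_right (Int.natAbs_dvd_natAbs.2 h1)
    rw [h2]
    calc ‖Sq k p A b‖ ^ 5 ≤ (p:ℝ) ^ 5 := by gcongr; exact norm_Sq_le _ _ _ _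
      _ ≤ (p:ℝ) ^ 4 * (p:ℝ) ^ 5 := le_mul_of_one_le_left (by positivity) (one_le_pow₀ hp1)
  · have hkp : k < p := by
      refine lt_of_lt_of_le ?_ hp
      rw [pp0]
      calc k < 2 * k * (k + 1) := by nlinarith
        _ ≤ _ := Nat.le_self_pow (by norm_num) _
    have h := prime_bound0 k p hk hkp A b hA
    rw [← Sq_zmod] at h
    set S := ‖Sq k p A b‖ with hS
    have hS0 : 0 ≤ S := norm_nonneg _
    have hg : (1:ℝ) ≤ ((A.gcd p : ℕ) : ℝ) := by
      have : 0 < A.gcd p := Int.gcd_pos_of_ne_zero_right _ (by exact_mod_cast hpr.ne_zero)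
      exact_mod_cast this
    have hp2 : (2:ℝ) ≤ p := by exact_mod_cast hpr.two_le
    have h1 : S ^ 4 ≤ (2 * k * (k + 1)) * (p:ℝ) ^ 3 := by
      have : (p:ℝ) * S ^ 4 ≤ p * ((2 * k * (k + 1)) * (p:ℝ) ^ 3) := by
        have : 0 ≤ S ^ 4 := by positivity
        nlinarith
      exact le_of_mul_le_mul_left this (by linarith)
    have hp' : ((2 * k * (k + 1) : ℝ)) ^ 5 ≤ p := by exact_mod_cast hp
    have h2 : S ^ 5 ≤ (p:ℝ) ^ 4 := by
      refine le_of_pow_le_pow_left₀ (n := 4) (by norm_num) (by positivity) ?_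
      calc (S ^ 5) ^ 4 = (S ^ 4) ^ 5 := by ring
        _ ≤ ((2 * k * (k + 1)) * (p:ℝ) ^ 3) ^ 5 := by gcongr
        _ = (2 * k * (k + 1) : ℝ) ^ 5 * (p:ℝ) ^ 15 := by ring
        _ ≤ p * (p:ℝ) ^ 15 := by gcongr
        _ = ((p:ℝ) ^ 4) ^ 4 := by ring
    exact h2.trans (le_mul_of_one_le_right (by positivity) (one_le_pow₀ hg))

end VM

open Finset Polynomial

namespace VM

lemma add_pow_exists (k : ℕ) (hk : 1 ≤ k) (a b : ℤ) : ∃ Z : ℤ, (a + b) ^ k = a ^ k + b ^ k + a * b * Z := by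
  induction k, hk using Nat.le_induction with
  | base => exact ⟨0, by ring⟩
  | succ k hk ih =>
    obtain ⟨Z, hZ⟩ := ih
    obtain ⟨j, rfl⟩ : ∃ j, k = j + 1 := ⟨k - 1, by omega⟩
    refine ⟨b ^ j + a ^ j + (a + b) * Z, ?_⟩
    rw [pow_succ, hZ]; ring

lemma Sq_crt (k m n : ℕ) (hk : 1 ≤ k) (hm : 0 < m) (hn : 0 < n) (hmn : m.Coprime n) (A b : ℤ) :
    Sq k (m * n) A b = Sq k m (A * n ^ (k - 1)) b * Sq k n (A * m ^ (k - 1)) b := by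
  classical
  have : NeZero (m * n) := ⟨by positivity⟩
  rw [Sq_zmod, Sq, Sq, Finset.sum_mul_sum, ← Finset.sum_product']
  set g : ℕ × ℕ → ZMod (m * n) := fun y => ((n * y.1 + m * y.2 : ℕ) : ZMod (m * n)) with hg
  have hinj : Set.InjOn g (Finset.range m ×ˢ Finset.range n : Finset (ℕ × ℕ)) := by
    intro x hx y hy hxy
    simp only [Finset.coe_product, Finset.coe_range, Set.mem_prod, Set.mem_Iio] at hx hy
    simp only [hg] at hxy
    rw [ZMod.natCast_eq_natCast_iff] at hxy
    have h1 : n * x.1 ≡ n * y.1 [MOD m] := by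
      have := hxy.of_mul_right n
      have h := Nat.ModEq.of_mul_right n hxy
      have e1 : n * x.1 + m * x.2 ≡ n * x.1 [MOD m] := by simp [Nat.ModEq]
      have e2 : n * y.1 + m * y.2 ≡ n * y.1 [MOD m] := by simp [Nat.ModEq]
      exact (e1.symm.trans h).trans e2
    have h2 : m * x.2 ≡ m * y.2 [MOD n] := by
      have h := Nat.ModEq.of_mul_left m hxy
      have e1 : n * x.1 + m * x.2 ≡ m * x.2 [MOD n] := by simp [Nat.ModEq]
      have e2 : n * y.1 + m * y.2 ≡ m * y.2 [MOD n] := by simp [Nat.ModEq]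
      exact (e1.symm.trans h).trans e2
    have h3 := Nat.ModEq.cancel_left_of_coprime hmn h1
    have h4 := Nat.ModEq.cancel_left_of_coprime hmn.symm h2
    exact Prod.ext (Nat.ModEq.eq_of_lt_of_lt h3 hx.1 hy.1) (Nat.ModEq.eq_of_lt_of_lt h4 hx.2 hy.2)
  have himg : (Finset.range m ×ˢ Finset.range n).image g = Finset.univ := by
    apply Finset.eq_univ_of_card
    rw [Finset.card_image_of_injOn hinj, ZMod.card]
    simp
  rw [← himg, Finset.sum_image hinj]
  refine Finset.sum_congr rfl fun y _ => ?_
  obtain ⟨y1, y2⟩ := y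
  simp only [hg]
  obtain ⟨Z, hZ⟩ := add_pow_exists k hk ((n:ℤ) * y1) (m * y2)
  have hs := std_int (m * n) (A * ((n:ℤ) * y1 + m * y2) ^ k + b * (n * y1 + m * y2))
  have e0 : (((A * ((n:ℤ) * y1 + m * y2) ^ k + b * (n * y1 + m * y2) : ℤ)) : ZMod (m * n)) =
      (A : ZMod (m * n)) * ((n * y1 + m * y2 : ℕ) : ZMod (m * n)) ^ k + (b : ZMod (m * n)) * ((n * y1 + m * y2 : ℕ) : ZMod (m * n)) := by
    push_cast; ring
  rw [← e0, hs, hZ, ← ee_add]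
  have hm' : (m:ℝ) ≠ 0 := by positivity
  have hn' : (n:ℝ) ≠ 0 := by positivity
  obtain ⟨j, rfl⟩ : ∃ j, k = j + 1 := ⟨k - 1, by omega⟩
  refine Eq.trans ?_ (ee_add_int _ (A * y1 * y2 * Z))
  congr 1
  push_cast
  field_simp
  ring

lemma Sq_sqfree (k : ℕ) (hk : 2 ≤ k) (q : ℕ) : q ≠ 0 → Squarefree q → (∀ p, p.Prime → p ∣ q → pp0 k ≤ p) →
    ∀ A b : ℤ, ‖Sq k q A b‖ ^ 5 ≤ (q:ℝ) ^ 4 * ((A.gcd q : ℕ) : ℝ) ^ 5 := by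
  induction q using induction_on_primes with
  | zero => intro h; exact absurd rfl h
  | one =>
    intro _ _ _ A b
    have := norm_Sq_le k 1 A b
    simp only [Nat.cast_one, one_pow, one_mul, Int.gcd_one] at this ⊢
    exact pow_le_one₀ (norm_nonneg _) this
  | prime_mul p a hp ih =>
    intro h0 hsq hpr A b
    have ha : a ≠ 0 := by rintro rfl; simp at h0
    obtain ⟨hc, _, hsa⟩ := Nat.squarefree_mul_iff.1 hsq
    have h1 := prime_bound k p hp hk (hpr p hp (Dvd.intro _ rfl)) (A * a ^ (k - 1)) b
    have h2 := ih ha hsa (fun r hr hra => hpr r hr (Dvd.dvd.mul_left hra p)) (A * p ^ (k - 1)) b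
    have g1 : (A * (a:ℤ) ^ (k - 1)).gcd p = A.natAbs.gcd p := by
      rw [Int.gcd_eq_natAbs, Int.natAbs_mul, Int.natAbs_pow, Int.natAbs_natCast, Int.natAbs_natCast]
      exact Nat.Coprime.gcd_mul_right_cancel _ (Nat.Coprime.pow_left _ hc.symm)
    have g2 : (A * (p:ℤ) ^ (k - 1)).gcd a = A.natAbs.gcd a := by
      rw [Int.gcd_eq_natAbs, Int.natAbs_mul, Int.natAbs_pow, Int.natAbs_natCast, Int.natAbs_natCast]
      exact Nat.Coprime.gcd_mul_right_cancel _ (Nat.Coprime.pow_left _ hc)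
    have g3 : A.gcd ((p * a : ℕ) : ℤ) = A.natAbs.gcd p * A.natAbs.gcd a := by
      rw [Int.gcd_eq_natAbs, Int.natAbs_natCast]
      exact Nat.Coprime.gcd_mul _ hc
    rw [g1] at h1
    rw [g2] at h2
    rw [g3, Sq_crt k p a (by omega) hp.pos (by omega) hc, norm_mul, mul_pow]
    calc _ ≤ _ := mul_le_mul h1 h2 (by positivity) (by positivity)
      _ = _ := by push_cast; ring

end VM

open Finset Polynomial

namespace VM

lemma cong_count (q Y : ℕ) (hq : 0 < q) (i : ℤ) :
    (((Finset.Icc (1:ℤ) Y).filter (fun j => j ≡ i [ZMOD q])).card : ℝ) ≤ (Y:ℝ) / q + 1 := by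
  have h := Int.Ioc_filter_modEq_card (a := 0) (b := (Y:ℤ)) (r := (q:ℤ)) (by exact_mod_cast hq) i
  have e : Finset.Icc (1:ℤ) Y = Finset.Ioc (0:ℤ) Y := by ext x; simp; omega
  rw [e]
  have h2 : (((Finset.Ioc (0:ℤ) Y).filter (fun j => j ≡ i [ZMOD q])).card : ℝ) =
    (((((Finset.Ioc (0:ℤ) Y).filter (fun j => j ≡ i [ZMOD q])).card : ℤ) : ℚ) : ℝ) := by push_cast; rfl
  rw [h2, h]
  have h3 : ((max (⌊(((Y:ℤ) : ℚ) - i) / ((q:ℤ) : ℚ)⌋ - ⌊(((0:ℤ) : ℚ) - i) / ((q:ℤ) : ℚ)⌋) 0 : ℤ) : ℚ) ≤ (Y:ℚ) / q + 1 := by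
    have h4 := Int.floor_le ((((Y:ℤ) : ℚ) - i) / ((q:ℤ) : ℚ))
    have h5 := Int.lt_floor_add_one ((((0:ℤ) : ℚ) - i) / ((q:ℤ) : ℚ))
    have h6 : (((Y:ℤ) : ℚ) - i) / ((q:ℤ) : ℚ) - (((0:ℤ) : ℚ) - i) / ((q:ℤ) : ℚ) = (Y:ℚ) / q := by
      push_cast; ring
    push_cast at *
    refine max_le ?_ (by positivity)
    linarith
  have := (Rat.cast_le (K := ℝ)).2 h3
  push_cast at this ⊢
  exact this

lemma dual_l2 (q : ℕ) [NeZero q] (Y : ℕ) (c : ℤ → ℂ) (hc : ∀ n, ‖c n‖ = 1) :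
    ∑ b : ZMod q, ‖∑ n ∈ Finset.Icc (1:ℤ) Y, c n * (ZMod.stdAddChar (b * (-(n : ZMod q))) : ℂ)‖ ^ 2 ≤
      q * (Y * ((Y:ℝ) / q + 1)) := by
  classical
  have h := orth_sq (Ω := ZMod q) (fun n b => c n * (ZMod.stdAddChar (b * (-(n : ZMod q))) : ℂ)) (Finset.Icc (1:ℤ) Y)
  have hin : ∀ i j : ℤ, ‖∑ b : ZMod q, c i * (ZMod.stdAddChar (b * (-(i : ZMod q))) : ℂ) *
      (starRingEnd ℂ) (c j * (ZMod.stdAddChar (b * (-(j : ZMod q))) : ℂ))‖ = if j ≡ i [ZMOD q] then (q:ℝ) else 0 := by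
    intro i j
    have e : ∀ u : ZMod q, c i * (ZMod.stdAddChar (u * (-(i : ZMod q))) : ℂ) *
        (starRingEnd ℂ) (c j * (ZMod.stdAddChar (u * (-(j : ZMod q))) : ℂ)) =
          c i * (starRingEnd ℂ) (c j) * (ZMod.stdAddChar (u * ((j : ZMod q) - (i : ZMod q))) : ℂ) := by
      intro u
      rw [map_mul (starRingEnd ℂ), ← AddChar.map_neg_eq_conj, mul_mul_mul_comm, ← AddChar.map_add_eq_mul]
      congr 2; ring
    simp_rw [e]
    rw [← Finset.mul_sum, AddChar.sum_mulShift _ (ZMod.isPrimitive_stdAddChar q), ZMod.card]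
    rw [norm_mul, norm_mul, RCLike.norm_conj, hc, hc, one_mul, one_mul]
    have : ((j : ZMod q) - (i : ZMod q) = 0) ↔ j ≡ i [ZMOD q] := by
      rw [sub_eq_zero, ZMod.intCast_eq_intCast_iff]
    simp only [this]
    split_ifs <;> simp
  have h0 : (0:ℝ) ≤ ∑ b : ZMod q, ‖∑ n ∈ Finset.Icc (1:ℤ) Y, c n * (ZMod.stdAddChar (b * (-(n : ZMod q))) : ℂ)‖ ^ 2 := by positivity
  rw [← abs_of_nonneg h0, ← Real.norm_eq_abs, ← Complex.norm_real, h]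
  refine (norm_sum_le _ _).trans ?_
  have hq : (0:ℝ) < q := by exact_mod_cast Nat.pos_of_ne_zero (NeZero.ne q)
  calc _ ≤ ∑ i ∈ Finset.Icc (1:ℤ) Y, q * ((Y:ℝ) / q + 1) := by
        refine Finset.sum_le_sum fun i _ => (norm_sum_le _ _).trans ?_
        simp_rw [hin]
        rw [← Finset.sum_filter, Finset.sum_const, nsmul_eq_mul, mul_comm]
        exact mul_le_mul_of_nonneg_left (cong_count q Y (Nat.pos_of_ne_zero (NeZero.ne q)) i) hq.le
    _ = _ := by rw [Finset.sum_const, nsmul_eq_mul]; simp; ring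

lemma completion (k q Y : ℕ) (hq : 0 < q) (A : ℤ) (γ K : ℝ) (hK : ∀ b : ℤ, ‖Sq k q A b‖ ≤ K) :
    ‖∑ m ∈ Finset.Icc (1:ℤ) Y, ∑ x ∈ Finset.Icc (1:ℤ) Y, ee (A * (m + x) ^ k / q + γ * (m + x))‖ ≤
      K * (Y * ((Y:ℝ) / q + 1)) := by
  classical
  have : NeZero q := ⟨hq.ne'⟩
  have hq0 : (0:ℝ) < q := by exact_mod_cast hq
  set S : ZMod q → ℂ := fun b => ∑ y : ZMod q, (ZMod.stdAddChar ((A : ZMod q) * y ^ k + b * y) : ℂ) with hS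
  have hSK : ∀ b, ‖S b‖ ≤ K := by
    intro b
    have := hK (b.val : ℤ)
    rw [Sq_zmod] at this
    simpa [hS] using this
  have hinv : ∀ n : ℤ, ∑ b : ZMod q, S b * (ZMod.stdAddChar (b * (-(n : ZMod q))) : ℂ) = q * ee (A * n ^ k / q) := by
    intro n
    simp only [hS, Finset.sum_mul]
    rw [Finset.sum_comm]
    have e : ∀ y b : ZMod q, (ZMod.stdAddChar ((A : ZMod q) * y ^ k + b * y) : ℂ) * (ZMod.stdAddChar (b * (-(n : ZMod q))) : ℂ) =
        (ZMod.stdAddChar ((A : ZMod q) * y ^ k) : ℂ) * (ZMod.stdAddChar (b * (y - (n : ZMod q))) : ℂ) := by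
      intro y b
      rw [← AddChar.map_add_eq_mul, ← AddChar.map_add_eq_mul]
      congr 1; ring
    simp_rw [e, ← Finset.mul_sum, AddChar.sum_mulShift _ (ZMod.isPrimitive_stdAddChar q), ZMod.card, sub_eq_zero]
    simp only [Nat.cast_ite, Nat.cast_zero, mul_ite, mul_zero, Finset.sum_ite_eq', Finset.mem_univ, if_true]
    rw [mul_comm]
    congr 1
    have := std_int q (A * n ^ k)
    push_cast at this
    exact this
  set D : ZMod q → ℂ := fun b => ∑ n ∈ Finset.Icc (1:ℤ) Y, ee (γ * n) * (ZMod.stdAddChar (b * (-(n : ZMod q))) : ℂ) with hD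
  have hmain : (q:ℂ) * ∑ m ∈ Finset.Icc (1:ℤ) Y, ∑ x ∈ Finset.Icc (1:ℤ) Y, ee (A * (m + x) ^ k / q + γ * (m + x)) =
      ∑ b, S b * D b ^ 2 := by
    have e1 : ∀ m x : ℤ, (q:ℂ) * ee (A * (m + x) ^ k / q + γ * (m + x)) =
        ∑ b : ZMod q, S b * ((ee (γ * m) * (ZMod.stdAddChar (b * (-(m : ZMod q))) : ℂ)) * (ee (γ * x) * (ZMod.stdAddChar (b * (-(x : ZMod q))) : ℂ))) := by
      intro m x
      have := hinv (m + x)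
      push_cast at this
      rw [ee_add, ← mul_assoc, ← this, Finset.sum_mul]
      refine Finset.sum_congr rfl fun b _ => ?_
      rw [neg_add, mul_add, AddChar.map_add_eq_mul, mul_add γ, ee_add]
      ring
    simp_rw [Finset.mul_sum, e1]
    have e2 : ∀ b, S b * D b ^ 2 = ∑ m ∈ Finset.Icc (1:ℤ) Y, ∑ x ∈ Finset.Icc (1:ℤ) Y, S b * ((ee (γ * m) * (ZMod.stdAddChar (b * (-(m : ZMod q))) : ℂ)) * (ee (γ * x) * (ZMod.stdAddChar (b * (-(x : ZMod q))) : ℂ))) := by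
      intro b
      rw [sq, hD, Finset.sum_mul_sum, Finset.mul_sum]
      simp_rw [Finset.mul_sum]
    simp_rw [e2]
    rw [Finset.sum_comm]
    rw [Finset.sum_comm (s := Finset.univ)]
    rw [Finset.sum_comm]
    refine Finset.sum_congr rfl fun m _ => ?_
    rw [Finset.sum_comm]
  have h1 := congrArg norm hmain
  rw [norm_mul, Complex.norm_natCast] at h1
  have h2 : ‖∑ b, S b * D b ^ 2‖ ≤ K * (q * (Y * ((Y:ℝ) / q + 1))) := by
    refine (norm_sum_le _ _).trans ?_
    have hK0 : 0 ≤ K := (norm_nonneg _).trans (hSK 0)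
    calc _ ≤ ∑ b, K * ‖D b‖ ^ 2 := by
          refine Finset.sum_le_sum fun b _ => ?_
          rw [norm_mul, norm_pow]
          exact mul_le_mul_of_nonneg_right (hSK b) (by positivity)
      _ = K * ∑ b, ‖D b‖ ^ 2 := by rw [Finset.mul_sum]
      _ ≤ _ := mul_le_mul_of_nonneg_left (dual_l2 q Y (fun n => ee (γ * n)) (fun n => norm_ee _)) hK0
  rw [← h1] at h2
  refine le_of_mul_le_mul_left (h2.trans (le_of_eq ?_)) hq0
  ring

/-- decomposition of the denominator -/
lemma decomp (k p0 : ℕ) (hk : 3 ≤ k) (q : ℕ) : 0 < q → ∃ q1 q2 d : ℕ, q = q1 * q2 ∧ 0 < q1 ∧ 0 < q2 ∧ 0 < d ∧ Squarefree q1 ∧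
    (∀ p, p.Prime → p ∣ q1 → p0 ≤ p) ∧ q1.Coprime q2 ∧ d ∣ q2 ∧ q2 ∣ d ^ k ∧
    d ^ 2 ≤ q2 * ∏ p ∈ q.primeFactors.filter (· < p0), p := by
  induction q using Nat.recOnPosPrimePosCoprime with
  | zero => intro h; exact absurd h (lt_irrefl _)
  | one => intro _; refine ⟨1, 1, 1, by simp, one_pos, one_pos, one_pos, squarefree_one, fun p hp h => absurd (Nat.dvd_one.1 h) hp.one_lt.ne', by simp, by simp, by simp, by simp⟩
  | prime_pow p n hp hn =>
    intro _
    by_cases h : n = 1 ∧ p0 ≤ p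
    · obtain ⟨rfl, h⟩ := h
      refine ⟨p, 1, 1, by simp, hp.pos, one_pos, one_pos, hp.squarefree, ?_, by simp, by simp, by simp, ?_⟩
      · intro r hr hrp; rwa [(Nat.prime_dvd_prime_iff_eq hr hp).1 hrp]
      · have : (p ^ 1).primeFactors.filter (· < p0) = ∅ := by
          rw [pow_one, hp.primeFactors]; ext x; simp; rintro rfl; exact h
        rw [this]; simp
    · obtain ⟨c, hc1, hc2⟩ : ∃ c, c * k + 1 ≤ n + k ∧ n ≤ c * k := by
        refine ⟨(n + k - 1) / k, ?_, ?_⟩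
        · have := Nat.div_mul_le_self (n + k - 1) k
          omega
        · have := Nat.lt_div_mul_add (a := n + k - 1) (b := k) (by omega)
          omega
      have hc0 : 1 ≤ c := by
        rcases Nat.eq_zero_or_pos c with h0 | h0
        · rw [h0] at hc2; omega
        · exact h0
      obtain ⟨e, rfl⟩ : ∃ e, c = e + 1 := ⟨c - 1, by omega⟩
      have hek : e * 3 + 1 ≤ n := by
        have : e * 3 ≤ e * k := Nat.mul_le_mul_left _ hk
        rw [add_mul, one_mul] at hc1
        omega
      have hcn : e + 1 ≤ n := by omega
      refine ⟨1, p ^ n, p ^ (e + 1), by simp, one_pos, pow_pos hp.pos _, pow_pos hp.pos _, squarefree_one, ?_, by simp, pow_dvd_pow _ hcn, ?_, ?_⟩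
      · intro r hr hr1; exact absurd (Nat.dvd_one.1 hr1) hr.one_lt.ne'
      · rw [← pow_mul]; exact pow_dvd_pow _ hc2
      · rw [← pow_mul]
        by_cases hn1 : n = 1
        · have hlt : p < p0 := by
            by_contra hh; exact h ⟨hn1, by omega⟩
          subst hn1
          have hc3 : e = 0 := by omega
          have : (p ^ 1).primeFactors.filter (· < p0) = {p} := by
            rw [pow_one, hp.primeFactors]; ext x; simp; rintro rfl; exact hlt
          rw [this, hc3]; simp [sq]
        · have h2c : (e + 1) * 2 ≤ n := by omega
          refine (Nat.pow_le_pow_right hp.pos h2c).trans (Nat.le_mul_of_pos_right _ ?_)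
          exact Finset.prod_pos fun r hr => (Nat.prime_of_mem_primeFactors (Finset.mem_filter.1 hr).1).pos
  | coprime a b ha hb hab iha ihb =>
    intro _
    obtain ⟨q1, q2, d, hq, h1, h2, h3, hs, hpr, hc, hd1, hd2, hd3⟩ := iha (by omega)
    obtain ⟨q1', q2', d', hq', h1', h2', h3', hs', hpr', hc', hd1', hd2', hd3'⟩ := ihb (by omega)
    have c11 : q1.Coprime q1' := Nat.Coprime.coprime_dvd_left (Dvd.intro _ hq.symm) (Nat.Coprime.coprime_dvd_right (Dvd.intro _ hq'.symm) hab)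
    have c12 : q1.Coprime q2' := Nat.Coprime.coprime_dvd_left (Dvd.intro _ hq.symm) (Nat.Coprime.coprime_dvd_right (Dvd.intro_left _ hq'.symm) hab)
    have c21 : q2.Coprime q1' := Nat.Coprime.coprime_dvd_left (Dvd.intro_left _ hq.symm) (Nat.Coprime.coprime_dvd_right (Dvd.intro _ hq'.symm) hab)
    refine ⟨q1 * q1', q2 * q2', d * d', by rw [hq, hq']; ring, by positivity, by positivity, by positivity, (Nat.squarefree_mul c11).2 ⟨hs, hs'⟩, ?_, ?_, mul_dvd_mul hd1 hd1', ?_, ?_⟩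
    · intro p hp hpd
      rcases (Nat.Prime.dvd_mul hp).1 hpd with h | h
      · exact hpr p hp h
      · exact hpr' p hp h
    · exact Nat.Coprime.mul_left (Nat.Coprime.mul_right hc c12) (Nat.Coprime.mul_right c21.symm hc')
    · rw [mul_pow]; exact mul_dvd_mul hd2 hd2'
    · rw [Nat.Coprime.primeFactors_mul hab, Finset.filter_union, Finset.prod_union, mul_pow]
      · calc _ ≤ _ := Nat.mul_le_mul hd3 hd3'
          _ = _ := by ring
      · exact Finset.disjoint_filter_filter hab.disjoint_primeFactors

lemma decomp' (k p0 : ℕ) (hk : 3 ≤ k) : ∃ C0 : ℕ, 0 < C0 ∧ ∀ q : ℕ, 0 < q → ∃ q1 q2 d : ℕ, q = q1 * q2 ∧ 0 < q1 ∧ 0 < q2 ∧ 0 < d ∧ Squarefree q1 ∧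
    (∀ p, p.Prime → p ∣ q1 → p0 ≤ p) ∧ q1.Coprime q2 ∧ d ∣ q2 ∧ q2 ∣ d ^ k ∧
    d ^ 2 ≤ q2 * C0 := by
  refine ⟨∏ p ∈ (Finset.range p0).filter Nat.Prime, p, Finset.prod_pos fun r hr => (Finset.mem_filter.1 hr).2.pos, fun q hq => ?_⟩
  obtain ⟨q1, q2, d, h1, h2, h3, h4, h5, h6, h7, h8, h9, h10⟩ := decomp k p0 hk q hq
  refine ⟨q1, q2, d, h1, h2, h3, h4, h5, h6, h7, h8, h9, h10.trans (Nat.mul_le_mul_left _ ?_)⟩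
  refine Finset.prod_le_prod_of_subset_of_one_le' ?_ ?_
  · intro p hp
    simp only [Finset.mem_filter, Finset.mem_range] at hp ⊢
    exact ⟨hp.2, Nat.prime_of_mem_primeFactors hp.1⟩
  · intro p hp _
    exact (Finset.mem_filter.1 hp).2.pos

end VM

open Finset Polynomial

namespace VM

lemma round_le_int (x : ℝ) (z : ℤ) : |x - round x| ≤ |x - z| := round_le x z

lemma caseB (k : ℕ) (C e : ℝ) (hC : 0 < C) (ht0 : tri (k - 1) ≠ 0)
    (hw : ∀ M : ℕ, 1 ≤ M → ∀ a b : ℝ, (∀ d : ℕ, 1 ≤ d → d < M → ∀ n : ℤ, (1:ℝ) / M ^ (k - 1) ≤ |k * a * d - n|) →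
      M * ‖∑ m ∈ Finset.Icc (1:ℤ) M, ∑ x ∈ Finset.Icc (1:ℤ) M, ee (a * (m + x) ^ k + b * (m + x))‖ ^ (2 * tri (k - 1)) ≤
        C * (M:ℝ) ^ (4 * (tri (k - 1) : ℝ) + e))
    (M L m : ℕ) (hM : 1 ≤ M) (hL : 1 ≤ L) (hm : 1 ≤ m) (α α₁ Δ : ℝ) (hΔ : 0 < Δ)
    (h1 : 2 * (m:ℝ) * L < (2 * L * Δ) ^ (2 * m))
    (hs : (2 * (m:ℝ) * L) ^ (2 * tri (k - 1)) * C * (M:ℝ) ^ e ≤ M)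
    (hmin : ∀ h : ℕ, 1 ≤ h → h ≤ m * L → ∀ d : ℕ, 1 ≤ d → d < M → ∀ n : ℤ, (1:ℝ) / M ^ (k - 1) ≤ |k * (h * α) * d - n|) :
    ∃ n : ℕ, 1 ≤ n ∧ n ≤ 2 * M ∧ |(α * (n:ℝ) ^ k + α₁ * n) - round (α * (n:ℝ) ^ k + α₁ * n)| ≤ Δ := by
  classical
  set I : Finset (ℤ × ℤ) := Finset.Icc (1:ℤ) M ×ˢ Finset.Icc (1:ℤ) M with hI
  have hM0 : (0:ℝ) < M := by exact_mod_cast hM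
  have hmL : (0:ℝ) < 2 * (m:ℝ) * L := by
    have : (0:ℝ) < m := by exact_mod_cast hm
    have : (0:ℝ) < L := by exact_mod_cast hL
    positivity
  have hcard : (I.card : ℝ) = (M:ℝ) ^ 2 := by
    rw [hI, Finset.card_product]; simp [sq]
  obtain ⟨i, hi, hb⟩ := fejer I ⟨(1, 1), by simp [hI]; omega⟩
    (fun i => α * ((i.1:ℝ) + i.2) ^ k + α₁ * ((i.1:ℝ) + i.2)) L m hL hm Δ hΔ h1 (by
      intro h hh1 hh2
      have := hw M hM (h * α) (h * α₁) (hmin h hh1 hh2)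
      rw [hI, Finset.sum_product, ← hI, hcard]
      have e1 : ∀ x y : ℤ, ee ((h:ℝ) * (α * ((x:ℝ) + y) ^ k + α₁ * ((x:ℝ) + y))) = ee (h * α * ((x:ℝ) + y) ^ k + h * α₁ * ((x:ℝ) + y)) := by
        intro x y; congr 1; ring
      simp only [e1]
      set T := ‖∑ m ∈ Finset.Icc (1:ℤ) M, ∑ x ∈ Finset.Icc (1:ℤ) M, ee (h * α * ((m:ℝ) + x) ^ k + h * α₁ * ((m:ℝ) + x))‖ with hT
      have hT0 : 0 ≤ T := norm_nonneg _
      by_contra hcon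
      push Not at hcon
      rw [div_lt_iff₀ hmL] at hcon
      set s := tri (k - 1) with hsdef
      rw [Real.rpow_add hM0] at this
      have e2 : (M:ℝ) ^ (4 * (s:ℝ)) = ((M:ℝ) ^ 2) ^ (2 * s) := by
        rw [← pow_mul, ← Real.rpow_natCast]; congr 1; push_cast; ring
      rw [e2] at this
      have h3 : ((M:ℝ) ^ 2) ^ (2 * s) < (T * (2 * m * L)) ^ (2 * s) :=
        pow_lt_pow_left₀ hcon (by positivity) (by omega)
      have hMe : 0 < (M:ℝ) ^ e := Real.rpow_pos_of_pos hM0 _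
      have h4 : (C * (M:ℝ) ^ e) * ((M:ℝ) ^ 2) ^ (2 * s) < (C * (M:ℝ) ^ e) * (T * (2 * m * L)) ^ (2 * s) :=
        mul_lt_mul_of_pos_left h3 (by positivity)
      have h5 : (C * (M:ℝ) ^ e) * (T * (2 * m * L)) ^ (2 * s) ≤ M * T ^ (2 * s) := by
        rw [mul_pow]
        calc _ = ((2 * (m:ℝ) * L) ^ (2 * s) * C * (M:ℝ) ^ e) * T ^ (2 * s) := by ring
          _ ≤ _ := mul_le_mul_of_nonneg_right hs (by positivity)
      linarith)
  simp only [hI, Finset.mem_product, Finset.mem_Icc] at hi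
  refine ⟨(i.1 + i.2).toNat, by omega, by omega, ?_⟩
  have e : (((i.1 + i.2).toNat : ℕ) : ℝ) = (i.1:ℝ) + i.2 := by
    have : (((i.1 + i.2).toNat : ℕ) : ℤ) = i.1 + i.2 := Int.toNat_of_nonneg (by omega)
    exact_mod_cast congrArg (Int.cast (R := ℝ)) this
  rw [e]
  exact hb

lemma caseA_small (k : ℕ) (hk : 1 ≤ k) (α α₁ β : ℝ) (a : ℤ) (q1 q2 d T : ℕ) (hq1 : 0 < q1) (hq2 : 0 < q2) (hd : 0 < d)
    (hdk : q2 ∣ d ^ k) (hT : 0 < T)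
    (hα : α = a / ((q1 * q2 : ℕ) : ℝ) + β) :
    ∃ n : ℕ, 1 ≤ n ∧ n ≤ d * q1 * T ∧ |(α * (n:ℝ) ^ k + α₁ * n) - round (α * (n:ℝ) ^ k + α₁ * n)| ≤
      1 / (T + 1) + |β| * (d * q1 * T) ^ k := by
  obtain ⟨t, ht0, htT, ht⟩ := Real.exists_nat_abs_mul_sub_round_le (α₁ * (d * q1)) hT
  obtain ⟨w, hw⟩ := hdk
  obtain ⟨j, rfl⟩ : ∃ j, k = j + 1 := ⟨k - 1, by omega⟩
  refine ⟨d * q1 * t, Nat.mul_pos (Nat.mul_pos hd hq1) ht0, Nat.mul_le_mul_left _ htT, ?_⟩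
  set z : ℤ := a * w * q1 ^ j * t ^ (j + 1) + round ((t:ℝ) * (α₁ * (d * q1))) with hz
  refine (round_le_int _ z).trans ?_
  have hq1' : (q1:ℝ) ≠ 0 := by positivity
  have hq2' : (q2:ℝ) ≠ 0 := by positivity
  have hw' : (d:ℝ) ^ (j + 1) = q2 * w := by exact_mod_cast hw
  have e : α * ((d * q1 * t : ℕ) : ℝ) ^ (j + 1) + α₁ * ((d * q1 * t : ℕ) : ℝ) - z =
      ((t:ℝ) * (α₁ * (d * q1)) - round ((t:ℝ) * (α₁ * (d * q1)))) + β * ((d * q1 * t : ℕ) : ℝ) ^ (j + 1) := by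
    rw [hα, hz]
    push_cast
    rw [mul_pow, mul_pow, hw']
    field_simp
    ring
  rw [e]
  refine (abs_add_le _ _).trans (add_le_add ht ?_)
  rw [abs_mul, abs_of_nonneg (by positivity : (0:ℝ) ≤ ((d * q1 * t : ℕ) : ℝ) ^ (j + 1))]
  refine mul_le_mul_of_nonneg_left (pow_le_pow_left₀ (by positivity) ?_ _) (abs_nonneg _)
  push_cast
  exact mul_le_mul_of_nonneg_left (by exact_mod_cast htT) (by positivity)

lemma caseA_large (k : ℕ) (hk : 2 ≤ k) (α α₁ β : ℝ) (a : ℤ) (q1 q2 d L m Y : ℕ) (hq1 : 0 < q1) (hq2 : 0 < q2) (hd : 0 < d)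
    (hdk : q2 ∣ d ^ k) (hdq : d ∣ q2) (hcop : q1.Coprime q2) (haq : a.natAbs.Coprime q1) (hsq : Squarefree q1)
    (hpr : ∀ p, p.Prime → p ∣ q1 → pp0 k ≤ p)
    (hL : 1 ≤ L) (hm : 1 ≤ m) (hY : 1 ≤ Y) (Δ : ℝ) (hΔ : 0 < Δ)
    (h1 : 2 * (m:ℝ) * L < (2 * L * Δ) ^ (2 * m))
    (u : ℝ) (hu : 0 < u) (hu5 : u ^ 5 = (q1:ℝ) ^ 4)
    (hbig : 8 * ((m:ℝ) * L) ^ 2 * u ≤ q1) (hYu : 8 * ((m:ℝ) * L) ^ 2 * u ≤ Y)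
    (hα : α = a / ((q1 * q2 : ℕ) : ℝ) + β) :
    ∃ n : ℕ, 1 ≤ n ∧ n ≤ 2 * d * Y ∧ |(α * (n:ℝ) ^ k + α₁ * n) - round (α * (n:ℝ) ^ k + α₁ * n)| ≤
      Δ + |β| * (2 * d * Y) ^ k := by
  classical
  obtain ⟨w, hw⟩ := hdk
  set I : Finset (ℤ × ℤ) := Finset.Icc (1:ℤ) Y ×ˢ Finset.Icc (1:ℤ) Y with hI
  have hY0 : (0:ℝ) < Y := by exact_mod_cast hY
  have hq10 : (0:ℝ) < q1 := by exact_mod_cast hq1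
  have hq20 : (0:ℝ) < q2 := by exact_mod_cast hq2
  have hmL : (1:ℝ) ≤ (m:ℝ) * L := by
    exact_mod_cast Nat.mul_le_mul hm hL
  have hcard : (I.card : ℝ) = (Y:ℝ) ^ 2 := by
    rw [hI, Finset.card_product]; simp [sq]
  have hcw : (a * (w:ℤ)).natAbs.Coprime q1 := by
    rw [Int.natAbs_mul, Int.natAbs_natCast]
    refine Nat.Coprime.mul_left haq ?_
    have h1 : (d ^ k).Coprime q1 := Nat.Coprime.pow_left _ (Nat.Coprime.coprime_dvd_left hdq hcop.symm)
    exact Nat.Coprime.coprime_dvd_left (Dvd.intro_left _ hw.symm) h1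
  obtain ⟨i, hi, hb⟩ := fejer I ⟨(1, 1), by simp [hI]; omega⟩
    (fun i => (a * w : ℝ) * ((i.1:ℝ) + i.2) ^ k / q1 + (α₁ * d) * ((i.1:ℝ) + i.2)) L m hL hm Δ hΔ h1 (by
      intro h hh1 hh2
      have hhH : (h:ℝ) ≤ m * L := by exact_mod_cast hh2
      have hc := completion k q1 Y hq1 ((h:ℤ) * (a * w)) (h * (α₁ * d)) ((m:ℝ) * L * u) (by
        intro b
        have h5 := Sq_sqfree k hk q1 hq1.ne' hsq hpr ((h:ℤ) * (a * w)) b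
        have hg : ((h:ℤ) * (a * w)).gcd q1 ≤ h := by
          rw [Int.gcd_eq_natAbs, Int.natAbs_mul, Int.natAbs_natCast, Int.natAbs_natCast, Nat.Coprime.gcd_mul_right_cancel _ hcw]
          exact Nat.gcd_le_left _ hh1
        refine le_of_pow_le_pow_left₀ (n := 5) (by norm_num) (by positivity) (h5.trans ?_)
        have hg' : ((((h:ℤ) * (a * w)).gcd q1 : ℕ) : ℝ) ≤ m * L := le_trans (by exact_mod_cast hg) hhH
        rw [mul_pow, hu5, mul_comm]
        gcongr)
      rw [hI, Finset.sum_product, ← hI, hcard]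
      have e1 : ∀ x y : ℤ, ee ((h:ℝ) * ((a * w : ℝ) * ((x:ℝ) + y) ^ k / q1 + (α₁ * d) * ((x:ℝ) + y))) =
          ee ((((h:ℤ) * (a * w) : ℤ) : ℝ) * ((x:ℝ) + y) ^ k / q1 + h * (α₁ * d) * ((x:ℝ) + y)) := by
        intro x y; congr 1; push_cast; ring
      simp only [e1]
      refine hc.trans ?_
      set H := (m:ℝ) * L with hH
      have hH0 : 0 < H := by linarith
      rw [mul_assoc 2 (m:ℝ), ← hH, le_div_iff₀ (by positivity)]
      have t1 : 2 * H ^ 2 * u * ((Y:ℝ) / q1 + 1) ≤ Y := by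
        have : 2 * H ^ 2 * u * ((Y:ℝ) / q1) ≤ Y / 2 := by
          rw [mul_div_assoc', div_le_iff₀ hq10]
          nlinarith
        nlinarith
      calc _ = (2 * H ^ 2 * u * ((Y:ℝ) / q1 + 1)) * Y := by ring
        _ ≤ Y * Y := by gcongr
        _ = _ := by ring)
  simp only [hI, Finset.mem_product, Finset.mem_Icc] at hi
  set v := (i.1 + i.2).toNat with hv
  have hvY : v ≤ 2 * Y := by omega
  have e : (v : ℝ) = (i.1:ℝ) + i.2 := by
    have : (((i.1 + i.2).toNat : ℕ) : ℤ) = i.1 + i.2 := Int.toNat_of_nonneg (by omega)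
    exact_mod_cast congrArg (Int.cast (R := ℝ)) this
  have hvn : d * v ≤ 2 * d * Y := by nlinarith
  refine ⟨d * v, Nat.mul_pos hd (by omega), hvn, ?_⟩
  simp only [← e] at hb
  set θ := (a * w : ℝ) * (v:ℝ) ^ k / q1 + (α₁ * d) * (v:ℝ) with hθ
  refine (round_le_int _ (round θ)).trans ?_
  have hw' : (d:ℝ) ^ k = q2 * w := by exact_mod_cast hw
  have e2 : α * ((d * v : ℕ) : ℝ) ^ k + α₁ * ((d * v : ℕ) : ℝ) - round θ = (θ - round θ) + β * ((d * v : ℕ) : ℝ) ^ k := by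
    rw [hα]
    have : (a / ((q1 * q2 : ℕ) : ℝ)) * ((d * v : ℕ) : ℝ) ^ k + α₁ * ((d * v : ℕ) : ℝ) = θ := by
      rw [hθ]
      push_cast
      rw [mul_pow, hw']
      field_simp
    rw [← this]; ring
  rw [e2]
  refine (abs_add_le _ _).trans (add_le_add hb ?_)
  rw [abs_mul, abs_of_nonneg (by positivity : (0:ℝ) ≤ ((d * v : ℕ) : ℝ) ^ k)]
  refine mul_le_mul_of_nonneg_left (pow_le_pow_left₀ (by positivity) ?_ _) (abs_nonneg _)
  exact_mod_cast hvn

/-- numeric finish, exponent 5 -/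
lemma numA5 (k : ℕ) (hk : 2 ≤ k) (X R M q B : ℝ) (hX : 0 ≤ X) (hR : 1 ≤ R) (hM : 0 < M) (hq : 1 ≤ q) (hB : 1 ≤ B)
    (hX5 : X ^ 5 ≤ B * R ^ 10 * q ^ 4) (hqM : q ≤ k * R * M) (hbig : 32 * B * k ^ 4 * R ^ 14 ≤ M) :
    X ≤ M ∧ 2 * R * X ^ k ≤ q * M ^ (k - 1) := by
  have hk1 : (1:ℝ) ≤ k := by exact_mod_cast (by omega : 1 ≤ k)
  have hR0 : 0 < R := by linarith
  constructor
  · refine le_of_pow_le_pow_left₀ (n := 5) (by norm_num) hM.le (hX5.trans ?_)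
    calc B * R ^ 10 * q ^ 4 ≤ B * R ^ 10 * (k * R * M) ^ 4 := by gcongr
      _ = (B * k ^ 4 * R ^ 14) * M ^ 4 := by ring
      _ ≤ (32 * B * k ^ 4 * R ^ 14) * M ^ 4 := by
          refine mul_le_mul_of_nonneg_right ?_ (by positivity)
          have : 0 ≤ B * k ^ 4 * R ^ 14 := by positivity
          linarith
      _ ≤ M * M ^ 4 := by gcongr
      _ = M ^ 5 := by ring
  · refine le_of_pow_le_pow_left₀ (n := 5) (by norm_num) (by positivity) ?_
    obtain ⟨j, rfl⟩ : ∃ j, k = j + 2 := ⟨k - 2, by omega⟩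
    have h1 : (j + 2 - 1) = j + 1 := by omega
    rw [h1]
    set K : ℝ := ((j + 2 : ℕ) : ℝ) with hK
    have e1 : (1:ℝ) ≤ 32 ^ (j + 1) := one_le_pow₀ (by norm_num)
    calc (2 * R * X ^ (j + 2)) ^ 5 = 32 * R ^ 5 * (X ^ 5) ^ (j + 2) := by ring
      _ ≤ 32 * R ^ 5 * (B * R ^ 10 * q ^ 4) ^ (j + 2) := by gcongr
      _ = 32 * R ^ 5 * B ^ (j + 2) * R ^ (10 * j + 20) * q ^ 5 * q ^ (4 * j + 3) := by ring
      _ ≤ 32 * R ^ 5 * B ^ (j + 2) * R ^ (10 * j + 20) * q ^ 5 * (K * R * M) ^ (4 * j + 3) := by gcongr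
      _ = q ^ 5 * (32 * 1 * 1 * B ^ (j + 2) * K ^ (4 * j + 3) * R ^ (14 * j + 28)) * M ^ (4 * j + 3) := by ring
      _ ≤ q ^ 5 * (32 * 32 ^ (j + 1) * K ^ 5 * B ^ (j + 2) * K ^ (4 * j + 3) * R ^ (14 * j + 28)) * M ^ (4 * j + 3) := by
          gcongr
          exact one_le_pow₀ hk1
      _ = q ^ 5 * (32 * B * K ^ 4 * R ^ 14) ^ (j + 2) * M ^ (4 * j + 3) := by ring
      _ ≤ q ^ 5 * M ^ (j + 2) * M ^ (4 * j + 3) := by gcongr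
      _ = (q * M ^ (j + 1)) ^ 5 := by ring

/-- numeric finish, exponent 2 -/
lemma numA2 (k : ℕ) (hk : 2 ≤ k) (X R M q B : ℝ) (hX : 0 ≤ X) (hR : 1 ≤ R) (hM : 0 < M) (hq : 1 ≤ q) (hB : 1 ≤ B)
    (hX2 : X ^ 2 ≤ B * R ^ 12 * q) (hqM : q ≤ k * R * M) (hbig : 32 * B * k ^ 4 * R ^ 14 ≤ M) :
    X ≤ M ∧ 2 * R * X ^ k ≤ q * M ^ (k - 1) := by
  have hk1 : (1:ℝ) ≤ k := by exact_mod_cast (by omega : 1 ≤ k)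
  have hR0 : 0 < R := by linarith
  have hbig2 : 4 * B * k * R ^ 13 ≤ M := by
    refine le_trans ?_ hbig
    have h1 : (k:ℝ) ≤ k ^ 4 := le_self_pow₀ hk1 (by norm_num)
    have h2 : R ^ 13 ≤ R ^ 14 := pow_le_pow_right₀ hR (by norm_num)
    gcongr
    norm_num
  constructor
  · refine le_of_pow_le_pow_left₀ (n := 2) (by norm_num) hM.le (hX2.trans ?_)
    calc B * R ^ 12 * q ≤ B * R ^ 12 * (k * R * M) := by gcongr
      _ = (B * k * R ^ 13) * M := by ring
      _ ≤ (4 * B * k * R ^ 13) * M := by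
          refine mul_le_mul_of_nonneg_right ?_ (by positivity)
          have : 0 ≤ B * k * R ^ 13 := by positivity
          linarith
      _ ≤ M * M := by gcongr
      _ = M ^ 2 := by ring
  · refine le_of_pow_le_pow_left₀ (n := 2) (by norm_num) (by positivity) ?_
    obtain ⟨j, rfl⟩ : ∃ j, k = j + 2 := ⟨k - 2, by omega⟩
    have h1 : (j + 2 - 1) = j + 1 := by omega
    rw [h1]
    set K : ℝ := ((j + 2 : ℕ) : ℝ) with hK
    have e1 : (1:ℝ) ≤ 4 ^ (j + 1) := one_le_pow₀ (by norm_num)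
    calc (2 * R * X ^ (j + 2)) ^ 2 = 4 * R ^ 2 * (X ^ 2) ^ (j + 2) := by ring
      _ ≤ 4 * R ^ 2 * (B * R ^ 12 * q) ^ (j + 2) := by gcongr
      _ = 4 * R ^ 2 * B ^ (j + 2) * R ^ (12 * j + 24) * q ^ 2 * q ^ j := by ring
      _ ≤ 4 * R ^ 2 * B ^ (j + 2) * R ^ (12 * j + 24) * q ^ 2 * (K * R * M) ^ j := by gcongr
      _ = q ^ 2 * (4 * 1 * 1 * B ^ (j + 2) * K ^ j * R ^ (13 * j + 26)) * M ^ j := by ring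
      _ ≤ q ^ 2 * (4 * 4 ^ (j + 1) * K ^ 2 * B ^ (j + 2) * K ^ j * R ^ (13 * j + 26)) * M ^ j := by
          gcongr
          exact one_le_pow₀ hk1
      _ = q ^ 2 * (4 * B * K * R ^ 13) ^ (j + 2) * M ^ j := by ring
      _ ≤ q ^ 2 * M ^ (j + 2) * M ^ j := by gcongr
      _ = (q * M ^ (j + 1)) ^ 2 := by ring

lemma beta_bound (k : ℕ) (β X R M q Δ : ℝ) (hR : 1 ≤ R) (hM : 0 < M) (hq : 1 ≤ q) (hX : 0 ≤ X)
    (hβ : |β| ≤ 1 / (q * M ^ (k - 1))) (hΔ : 1 / R ≤ Δ)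
    (h : 2 * R * X ^ k ≤ q * M ^ (k - 1)) : |β| * X ^ k ≤ Δ / 2 := by
  have hD : 0 < q * M ^ (k - 1) := by positivity
  calc |β| * X ^ k ≤ 1 / (q * M ^ (k - 1)) * X ^ k := by gcongr
    _ ≤ (1 / R) / 2 := by
        rw [div_mul_eq_mul_div, one_mul, div_div, div_le_div_iff₀ hD (by positivity)]
        linarith
    _ ≤ Δ / 2 := by linarith

lemma caseA (k : ℕ) (hk : 3 ≤ k) : ∃ B : ℝ, 1 ≤ B ∧ ∀ (α α₁ : ℝ) (a : ℤ) (q L m M : ℕ) (R Δ : ℝ), 0 < q → a.natAbs.Coprime q →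
    1 ≤ L → 1 ≤ m → 1 ≤ M → 1 ≤ R → 1 / R ≤ Δ → Δ ≤ 1 → (m:ℝ) * L ≤ R →
    2 * (m:ℝ) * L < (L * Δ) ^ (2 * m) →
    |α - a / q| ≤ 1 / (q * (M:ℝ) ^ (k - 1)) → (q:ℝ) ≤ k * R * M → 32 * B * k ^ 4 * R ^ 14 ≤ M →
    ∃ n : ℕ, 1 ≤ n ∧ n ≤ M ∧ |(α * (n:ℝ) ^ k + α₁ * n) - round (α * (n:ℝ) ^ k + α₁ * n)| ≤ Δ := by
  obtain ⟨C0, hC0, hdec⟩ := decomp' k (pp0 k) hk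
  have hC1 : (1:ℝ) ≤ C0 := by exact_mod_cast hC0
  refine ⟨18 ^ 5 * (C0:ℝ) ^ 4, ?_, ?_⟩
  · have : (1:ℝ) ≤ (C0:ℝ) ^ 4 := one_le_pow₀ hC1
    linarith
  intro α α₁ a q L m M R Δ hq haq hL hm hM hR hRΔ hΔ1 hH h1 hα hqM hbig
  have hB : (1:ℝ) ≤ 18 ^ 5 * (C0:ℝ) ^ 4 := by
    have : (1:ℝ) ≤ (C0:ℝ) ^ 4 := one_le_pow₀ hC1
    linarith
  have hR0 : 0 < R := by linarith
  have hΔ : 0 < Δ := lt_of_lt_of_le (by positivity) hRΔ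
  have hM0 : (0:ℝ) < M := by exact_mod_cast hM
  have hq1r : (1:ℝ) ≤ q := by exact_mod_cast hq
  obtain ⟨q1, q2, d, hqq, hq1, hq2, hd, hsq, hpr, hcop, hdq, hdk, hd2⟩ := hdec q hq
  have hα' : α = a / ((q1 * q2 : ℕ) : ℝ) + (α - a / q) := by rw [← hqq]; ring
  have hd2r : (d:ℝ) ^ 2 ≤ q2 * C0 := by exact_mod_cast hd2
  have hqr : (q:ℝ) = q1 * q2 := by rw [hqq]; push_cast; ring
  have hq10 : (1:ℝ) ≤ q1 := by exact_mod_cast hq1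
  have hq20 : (1:ℝ) ≤ q2 := by exact_mod_cast hq2
  have hd0 : (1:ℝ) ≤ d := by exact_mod_cast hd
  set H : ℝ := (m:ℝ) * L with hHdef
  have hH1 : (1:ℝ) ≤ H := by
    rw [hHdef]; exact_mod_cast Nat.mul_le_mul hm hL
  by_cases hcase : (q1:ℝ) ≤ (8 * H ^ 2) ^ 5
  · set T := ⌈2 / Δ⌉₊ with hT
    have hT0 : 0 < T := Nat.ceil_pos.2 (by positivity)
    have hT1 : 2 / Δ ≤ T := Nat.le_ceil _
    have hT2 : (T:ℝ) ≤ 3 * R := by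
      have h3 := (Nat.ceil_lt_add_one (show 0 ≤ 2 / Δ by positivity)).le
      have h4 : 2 / Δ ≤ 2 * R := by
        rw [div_le_iff₀ hΔ]
        rw [div_le_iff₀ hR0] at hRΔ
        linarith
      linarith
    obtain ⟨n, hn1, hn2, hn3⟩ := caseA_small k (by omega) α α₁ (α - a / q) a q1 q2 d T hq1 hq2 hd hdk hT0 hα'
    obtain ⟨hXM, hX⟩ := numA2 k (by omega) ((d:ℝ) * q1 * T) R M q _ (by positivity) hR hM0 hq1r hB (by
      calc ((d:ℝ) * q1 * T) ^ 2 = d ^ 2 * q1 * q1 * T ^ 2 := by ring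
        _ ≤ (q2 * C0) * q1 * (8 * R ^ 2) ^ 5 * (3 * R) ^ 2 := by
            have : (q1:ℝ) ≤ (8 * R ^ 2) ^ 5 := hcase.trans (by gcongr)
            gcongr
        _ = (294912 * C0) * R ^ 12 * q := by rw [hqr]; ring
        _ ≤ _ := by
            gcongr
            · norm_num
            · exact le_self_pow₀ hC1 (by norm_num)) hqM hbig
    refine ⟨n, hn1, ?_, hn3.trans ?_⟩
    · have : (n:ℝ) ≤ M := le_trans (by exact_mod_cast hn2) hXM
      exact_mod_cast this
    · have := beta_bound k (α - a / q) ((d:ℝ) * q1 * T) R M q Δ hR hM0 hq1r (by positivity) hα hRΔ hX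
      have h5 : 1 / ((T:ℝ) + 1) ≤ Δ / 2 := by
        rw [div_le_iff₀ hΔ] at hT1
        rw [div_le_iff₀ (by positivity)]
        nlinarith
      linarith
  · push Not at hcase
    set u : ℝ := (q1:ℝ) ^ ((4:ℝ) / 5) with hu
    have hu0 : 0 < u := by positivity
    have hu1 : 1 ≤ u := Real.one_le_rpow hq10 (by norm_num)
    have hu5 : u ^ 5 = (q1:ℝ) ^ 4 := by
      rw [hu, ← Real.rpow_natCast, ← Real.rpow_mul (by positivity), ← Real.rpow_natCast]
      norm_num
    set Y := ⌈8 * H ^ 2 * u⌉₊ with hY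
    have hY0 : 1 ≤ Y := Nat.ceil_pos.2 (by positivity)
    have hY1 : 8 * H ^ 2 * u ≤ Y := Nat.le_ceil _
    have hY2 : (Y:ℝ) ≤ 9 * R ^ 2 * u := by
      have h3 := (Nat.ceil_lt_add_one (show 0 ≤ 8 * H ^ 2 * u by positivity)).le
      have h4 : 1 ≤ H ^ 2 * u := one_le_mul_of_one_le_of_one_le (one_le_pow₀ hH1) hu1
      calc (Y:ℝ) ≤ 9 * H ^ 2 * u := by linarith
        _ ≤ _ := by gcongr
    have hbg : 8 * H ^ 2 * u ≤ q1 := by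
      refine le_of_pow_le_pow_left₀ (n := 5) (by norm_num) (by positivity) ?_
      rw [mul_pow, hu5]
      calc (8 * H ^ 2) ^ 5 * (q1:ℝ) ^ 4 ≤ q1 * (q1:ℝ) ^ 4 := by gcongr
        _ = _ := by ring
    obtain ⟨n, hn1, hn2, hn3⟩ := caseA_large k (by omega) α α₁ (α - a / q) a q1 q2 d L m Y hq1 hq2 hd hdk hdq hcop
      (Nat.Coprime.coprime_dvd_right (Dvd.intro _ hqq.symm) haq) hsq hpr hL hm hY0 (Δ / 2) (by positivity)
      (by rw [show 2 * (L:ℝ) * (Δ / 2) = L * Δ by ring]; exact h1) u hu0 hu5 hbg hY1 hα'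
    obtain ⟨hXM, hX⟩ := numA5 k (by omega) (2 * (d:ℝ) * Y) R M q _ (by positivity) hR hM0 hq1r hB (by
      have hd5 : (d:ℝ) ^ 5 ≤ (q2 * C0) ^ 4 := by
        calc (d:ℝ) ^ 5 ≤ (d:ℝ) ^ 8 := pow_le_pow_right₀ hd0 (by norm_num)
          _ = ((d:ℝ) ^ 2) ^ 4 := by ring
          _ ≤ _ := by gcongr
      calc (2 * (d:ℝ) * Y) ^ 5 ≤ (2 * (d:ℝ) * (9 * R ^ 2 * u)) ^ 5 := by gcongr
        _ = 18 ^ 5 * R ^ 10 * d ^ 5 * u ^ 5 := by ring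
        _ ≤ 18 ^ 5 * R ^ 10 * (q2 * C0) ^ 4 * (q1:ℝ) ^ 4 := by rw [hu5]; gcongr
        _ = _ := by rw [hqr]; ring) hqM hbig
    refine ⟨n, hn1, ?_, hn3.trans ?_⟩
    · have : (n:ℝ) ≤ M := le_trans (by exact_mod_cast hn2) hXM
      exact_mod_cast this
    · have := beta_bound k (α - a / q) (2 * (d:ℝ) * Y) R M q Δ hR hM0 hq1r (by positivity) hα hRΔ hX
      linarith

end VM



open Finset Polynomial

namespace VM

lemma two_tri (k : ℕ) (hk : 1 ≤ k) : ((2 * tri (k - 1) : ℕ) : ℝ) = (k:ℝ) * ((k:ℝ) - 1) := by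
  obtain ⟨j, rfl⟩ : ∃ j, k = j + 1 := ⟨k - 1, by omega⟩
  have h : 2 * tri j = j * (j + 1) := by
    rw [tri]; exact Nat.mul_div_cancel' (Nat.even_mul_succ_self j).two_dvd
  rw [Nat.add_sub_cancel, h]; push_cast; ring

lemma ev_rpow (c δ : ℝ) (hδ : 0 < δ) : ∃ N₀ : ℕ, ∀ N : ℕ, N₀ ≤ N → c ≤ (N:ℝ) ^ δ := by
  have h := (tendsto_rpow_atTop hδ).comp tendsto_natCast_atTop_atTop
  obtain ⟨N₀, h0⟩ := Filter.eventually_atTop.1 (h.eventually_ge_atTop c)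
  exact ⟨N₀, fun N hN => h0 N hN⟩

lemma main_small (k : ℕ) (hk : 6 ≤ k) (ε : ℝ) (hε : 0 < ε) (hεσ : ε < 1 / ((k:ℝ) * ((k:ℝ) - 1))) :
    ∃ N₀ : ℕ, ∀ (α₁ αk : ℝ) (N : ℕ), N₀ ≤ N →
      ∃ n : ℕ, 1 ≤ n ∧ n ≤ N ∧ |(αk * (n:ℝ) ^ k + α₁ * n) - round (αk * (n:ℝ) ^ k + α₁ * n)| ≤
        (N:ℝ) ^ (-(1 / ((k:ℝ) * ((k:ℝ) - 1))) + ε) := by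
  have hk6 : (6:ℝ) ≤ k := by exact_mod_cast hk
  have hkk : (30:ℝ) ≤ (k:ℝ) * ((k:ℝ) - 1) := by nlinarith
  set σ : ℝ := 1 / ((k:ℝ) * ((k:ℝ) - 1)) with hσ
  have hσ0 : 0 < σ := by rw [hσ]; positivity
  have hσ30 : σ ≤ 1 / 30 := by rw [hσ]; exact one_div_le_one_div_of_le (by norm_num) hkk
  set s := tri (k - 1) with hs
  have h2s : ((2 * s : ℕ) : ℝ) = (k:ℝ) * ((k:ℝ) - 1) := two_tri k (by omega)
  have hsσ : ((2 * s : ℕ) : ℝ) * σ = 1 := by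
    rw [h2s, hσ]; exact mul_one_div_cancel (by linarith)
  have hs0 : 0 < s := by
    rcases Nat.eq_zero_or_pos s with h | h
    · rw [h, mul_zero, Nat.cast_zero] at h2s; linarith
    · exact h
  have hs0r : (0:ℝ) < s := by exact_mod_cast hs0
  obtain ⟨C, hC1, hweyl⟩ := weyl k (by omega) (s * ε / 2) (by positivity)
  obtain ⟨B, hB1, hA⟩ := caseA k (by omega)
  set m : ℕ := ⌈2 / ε⌉₊ with hm
  have hm1 : 1 ≤ m := Nat.ceil_pos.2 (by positivity)
  have hmε : 2 ≤ ε * m := by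
    have : 2 / ε ≤ m := Nat.le_ceil _
    rw [div_le_iff₀ hε] at this
    linarith
  have hm1r : (1:ℝ) ≤ m := by exact_mod_cast hm1
  obtain ⟨N1, hN1⟩ := ev_rpow (4 * m + 1) 1 one_pos
  obtain ⟨N2, hN2⟩ := ev_rpow (2 * m) (ε / 2) (by positivity)
  obtain ⟨N3, hN3⟩ := ev_rpow (3 * (32 * B * k ^ 4)) (1 / 2) (by norm_num)
  obtain ⟨N4, hN4⟩ := ev_rpow (3 * C * (4 * m) ^ (2 * s)) (s * ε / 2) (by positivity)
  refine ⟨max (max N1 N2) (max N3 N4) + 4, ?_⟩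
  intro α₁ α N hN
  have g1 := hN1 N (by omega)
  have g2 := hN2 N (by omega)
  have g3 := hN3 N (by omega)
  have g4 := hN4 N (by omega)
  have hN4' : 4 ≤ N := by omega
  rw [Real.rpow_one] at g1
  clear hN1 hN2 hN3 hN4 hN
  have hNr : (4:ℝ) ≤ N := by exact_mod_cast hN4'
  have hN0 : (0:ℝ) < N := by linarith
  have hN1 : (1:ℝ) ≤ N := by linarith
  set Δ : ℝ := (N:ℝ) ^ (-σ + ε) with hΔ
  have hΔ0 : 0 < Δ := by positivity
  set R : ℝ := (N:ℝ) ^ σ with hR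
  have hR1 : 1 ≤ R := Real.one_le_rpow hN1 hσ0.le
  have hR0 : 0 < R := by linarith
  set P : ℝ := (N:ℝ) ^ (σ - ε / 2) with hP
  have hP1 : 1 ≤ P := Real.one_le_rpow hN1 (by linarith)
  set L : ℕ := ⌈P⌉₊ with hL
  have hL1 : 1 ≤ L := Nat.ceil_pos.2 (by linarith)
  have hLP : P ≤ L := Nat.le_ceil _
  have hLP2 : (L:ℝ) ≤ 2 * P := by
    have := (Nat.ceil_lt_add_one (show 0 ≤ P by linarith)).le
    linarith
  set M : ℕ := N / 2 with hM
  have hM1 : 1 ≤ M := by omega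
  have hM2 : 2 * M ≤ N := by omega
  have hM3 : (N:ℝ) / 3 ≤ M := by
    have : N ≤ 3 * M := by omega
    have : (N:ℝ) ≤ 3 * M := by exact_mod_cast this
    linarith
  have hM0 : (0:ℝ) < M := by exact_mod_cast hM1
  have hMN : (M:ℝ) ≤ N := by exact_mod_cast (by omega : M ≤ N)
  -- F1
  have F1 : 2 * (m:ℝ) * L < (L * Δ) ^ (2 * m) := by
    have a1 : (N:ℝ) ^ (ε / 2) ≤ L * Δ := by
      calc (N:ℝ) ^ (ε / 2) = P * Δ := by rw [hP, hΔ, ← Real.rpow_add hN0]; congr 1; ring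
        _ ≤ L * Δ := by gcongr
    have a2 : (N:ℝ) ^ (2:ℝ) ≤ ((N:ℝ) ^ (ε / 2)) ^ (2 * m) := by
      rw [← Real.rpow_natCast, ← Real.rpow_mul hN0.le]
      apply Real.rpow_le_rpow_of_exponent_le hN1
      push_cast
      linarith
    have a3 : P ≤ N := by
      calc P ≤ (N:ℝ) ^ (1:ℝ) := Real.rpow_le_rpow_of_exponent_le hN1 (by linarith)
        _ = N := Real.rpow_one _
    calc 2 * (m:ℝ) * L ≤ 2 * m * (2 * N) := by gcongr; linarith
      _ = 4 * m * N := by ring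
      _ < N * N := by nlinarith
      _ = (N:ℝ) ^ (2:ℝ) := by rw [Real.rpow_two]; ring
      _ ≤ _ := a2
      _ ≤ _ := by gcongr
  have F1' : 2 * (m:ℝ) * L < (2 * L * Δ) ^ (2 * m) := by
    refine F1.trans_le ?_
    have : 0 ≤ (L:ℝ) * Δ := by positivity
    gcongr
    linarith
  -- F2
  have F2 : (2 * (m:ℝ) * L) ^ (2 * s) * C * (M:ℝ) ^ (s * ε / 2) ≤ M := by
    have b1 : (2 * (m:ℝ) * L) ^ (2 * s) ≤ (4 * m) ^ (2 * s) * (N:ℝ) ^ (1 - s * ε) := by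
      calc (2 * (m:ℝ) * L) ^ (2 * s) ≤ (2 * (m:ℝ) * (2 * P)) ^ (2 * s) := by gcongr
        _ = (4 * m) ^ (2 * s) * P ^ (2 * s) := by rw [← mul_pow]; congr 1; ring
        _ = _ := by
            congr 1
            rw [hP, ← Real.rpow_natCast, ← Real.rpow_mul hN0.le]
            congr 1
            have : (σ - ε / 2) * ((2 * s : ℕ) : ℝ) = ((2 * s : ℕ) : ℝ) * σ - s * ε := by push_cast; ring
            rw [this, hsσ]
    have b2 : (M:ℝ) ^ (s * ε / 2) ≤ (N:ℝ) ^ (s * ε / 2) := Real.rpow_le_rpow hM0.le hMN (by positivity)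
    have hC0 : 0 ≤ C := by linarith
    have b3 : 3 * ((4 * (m:ℝ)) ^ (2 * s) * (N:ℝ) ^ (1 - s * ε) * C * (N:ℝ) ^ (s * ε / 2)) ≤ N := by
      calc _ = (3 * C * (4 * m) ^ (2 * s)) * ((N:ℝ) ^ (1 - s * ε) * (N:ℝ) ^ (s * ε / 2)) := by ring
        _ ≤ (N:ℝ) ^ (s * ε / 2) * ((N:ℝ) ^ (1 - s * ε) * (N:ℝ) ^ (s * ε / 2)) := by gcongr
        _ = (N:ℝ) ^ (1:ℝ) := by
            rw [← Real.rpow_add hN0, ← Real.rpow_add hN0]; congr 1; ring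
        _ = N := Real.rpow_one _
    calc _ ≤ (4 * (m:ℝ)) ^ (2 * s) * (N:ℝ) ^ (1 - s * ε) * C * (N:ℝ) ^ (s * ε / 2) := by gcongr
      _ ≤ (N:ℝ) / 3 := by linarith
      _ ≤ M := hM3
  -- F3
  have F3 : (m:ℝ) * L ≤ R := by
    calc (m:ℝ) * L ≤ m * (2 * P) := by gcongr
      _ = (2 * m) * P := by ring
      _ ≤ (N:ℝ) ^ (ε / 2) * P := by gcongr
      _ = R := by rw [hP, hR, ← Real.rpow_add hN0]; congr 1; ring
  -- F4
  have F4 : 32 * B * k ^ 4 * R ^ 14 ≤ M := by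
    have c1 : R ^ 14 ≤ (N:ℝ) ^ ((1:ℝ) / 2) := by
      rw [hR, ← Real.rpow_natCast, ← Real.rpow_mul hN0.le]
      apply Real.rpow_le_rpow_of_exponent_le hN1
      push_cast
      linarith
    have c2 : 3 * (32 * B * k ^ 4) * R ^ 14 ≤ N := by
      calc _ ≤ (N:ℝ) ^ ((1:ℝ) / 2) * (N:ℝ) ^ ((1:ℝ) / 2) := by gcongr
        _ = (N:ℝ) ^ (1:ℝ) := by rw [← Real.rpow_add hN0]; norm_num
        _ = N := Real.rpow_one _
    linarith
  have F5 : 1 / R ≤ Δ := by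
    rw [hR, hΔ, one_div, ← Real.rpow_neg hN0.le]
    exact Real.rpow_le_rpow_of_exponent_le hN1 (by linarith)
  have F6 : Δ ≤ 1 := Real.rpow_le_one_of_one_le_of_nonpos hN1 (by linarith)
  by_cases hmin : ∀ h : ℕ, 1 ≤ h → h ≤ m * L → ∀ d : ℕ, 1 ≤ d → d < M → ∀ n : ℤ, (1:ℝ) / M ^ (k - 1) ≤ |k * (h * α) * d - n|
  · obtain ⟨n, hn1, hn2, hn3⟩ := caseB k C (s * ε / 2) (by linarith) hs0.ne' hweyl M L m hM1 hL1 hm1 α α₁ Δ hΔ0 F1' F2 hmin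
    exact ⟨n, hn1, by omega, hn3⟩
  · push Not at hmin
    obtain ⟨h, hh1, hh2, d, hd1, hd2, z, hz⟩ := hmin
    set Q : ℕ := k * h * d with hQ
    have hQ0 : 0 < Q := by positivity
    have hQr : (0:ℝ) < Q := by exact_mod_cast hQ0
    set r : ℚ := (z:ℚ) / Q with hr
    have hden : r.den ≤ Q := by
      have h1 : ((r.den : ℕ) : ℤ) ∣ (Q:ℤ) := by
        have := Rat.den_dvd z Q
        rw [hr]
        exact_mod_cast this
      exact Nat.le_of_dvd hQ0 (by exact_mod_cast h1)
    have hrr : (r:ℝ) = (z:ℝ) / Q := by rw [hr]; push_cast; rfl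
    have hrd : (r:ℝ) = (r.num:ℝ) / r.den := Rat.cast_def r
    have hdr : (0:ℝ) < r.den := by exact_mod_cast r.den_pos
    have hQle : (Q:ℝ) ≤ k * R * M := by
      have hhr : (h:ℝ) ≤ R := le_trans (by exact_mod_cast hh2) F3
      have hdr : (d:ℝ) ≤ M := by exact_mod_cast hd2.le
      rw [hQ]; push_cast
      gcongr
    obtain ⟨n, hn1, hn2, hn3⟩ := hA α α₁ r.num r.den L m M R Δ r.den_pos r.reduced hL1 hm1 hM1 hR1 F5 F6 F3 F1 (by
      rw [← hrd, hrr]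
      have e1 : α - (z:ℝ) / Q = (k * (h * α) * d - z) / Q := by
        have : (Q:ℝ) = k * h * d := by rw [hQ]; push_cast; ring
        rw [sub_div' hQr.ne', this]; congr 1; ring
      rw [e1, abs_div, abs_of_pos hQr]
      calc _ ≤ (1 / (M:ℝ) ^ (k - 1)) / Q := by gcongr
        _ ≤ (1 / (M:ℝ) ^ (k - 1)) / r.den := by gcongr
        _ = _ := by rw [div_div, mul_comm]) (le_trans (by exact_mod_cast hden) hQle) F4
    exact ⟨n, hn1, by omega, hn3⟩

end VM

theorem small_fractional_parts_binomial (k : ℕ) (hk : 6 ≤ k) (ε : ℝ) (hε : 0 < ε) :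
    ∃ C : ℝ, 0 < C ∧ ∃ N₀ : ℕ, ∀ (α₁ αk : ℝ) (N : ℕ), N₀ ≤ N →
      ∃ n : ℕ, 1 ≤ n ∧ n ≤ N ∧
        nearestIntDist (αk * (n : ℝ) ^ k + α₁ * (n : ℝ)) ≤
          C * (N : ℝ) ^ (-(1 / ((k : ℝ) * ((k : ℝ) - 1))) + ε) := by
  have hk6 : (6:ℝ) ≤ k := by exact_mod_cast hk
  have hkk : (30:ℝ) ≤ (k:ℝ) * ((k:ℝ) - 1) := by nlinarith
  have hσ0 : 0 < 1 / ((k:ℝ) * ((k:ℝ) - 1)) := by positivity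
  obtain ⟨N₀, h⟩ := VM.main_small k hk (min ε (1 / ((k:ℝ) * ((k:ℝ) - 1)) / 2)) (lt_min hε (by positivity))
    (lt_of_le_of_lt (min_le_right _ _) (by linarith))
  refine ⟨1, one_pos, N₀ + 1, fun α₁ αk N hN => ?_⟩
  obtain ⟨n, h1, h2, h3⟩ := h α₁ αk N (by omega)
  refine ⟨n, h1, h2, ?_⟩
  rw [nearestIntDist, one_mul]
  refine h3.trans ?_
  have hN1 : (1:ℝ) ≤ N := by exact_mod_cast (by omega : 1 ≤ N)
  apply Real.rpow_le_rpow_of_exponent_le hN1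
  have := min_le_left ε (1 / ((k:ℝ) * ((k:ℝ) - 1)) / 2)
  linarith
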